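/- (Commutative content of the final Remark.) Let (X, μ) be a σ-finite measure space, 1 < p < ∞, and let T : L^p(X, μ) → L^p(X, μ) be a positive contraction (‖T‖ ≤ 1 and T maps μ-a.e. nonnegative functions to μ-a.e. nonnegative functions). Then there exists a constant C depending only on p such that for every N ∈ ℕ, every strictly increasing finite sequence n_0 < n_1 < ⋯ < n_N of positive integers, and every x ∈ L^p(X, μ): ‖ ( ∑_{i=0}^{N-1} |M_{n_i}(T)x − M_{n_{i+1}}(T)x|^2 )^{1/2} ‖_{L^p(X,μ)} ≤ C ‖x‖_{L^p(X,μ)}. (This follows from the paper's results combined with Akcoglu's dilation theorem.) -/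

import Mathlib

open MeasureTheory Finset ENNReal
open scoped ComplexOrder

/-- One-sided ergodic average `M_n(T) = (1/(n+1)) ∑_{k=0}^{n} T^k`. -/
noncomputable def ergAvg {X : Type*} [MeasurableSpace X] {μ : MeasureTheory.Measure X}
    {p : ℝ≥0∞} [Fact (1 ≤ p)]
    (T : Lp ℂ p μ →L[ℂ] Lp ℂ p μ) (n : ℕ) : Lp ℂ p μ →L[ℂ] Lp ℂ p μ :=
  ((n : ℂ) + 1)⁻¹ • ∑ k ∈ Finset.range (n + 1), T ^ k

/-- A bounded operator on `L^p(X, μ)` is positive if it maps a.e. nonnegative functions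
to a.e. nonnegative functions. -/
def IsPositiveOp {X : Type*} [MeasurableSpace X] {μ : MeasureTheory.Measure X}
    {p : ℝ≥0∞} [Fact (1 ≤ p)]
    (S : Lp ℂ p μ →L[ℂ] Lp ℂ p μ) : Prop :=
  ∀ f : Lp ℂ p μ, (∀ᵐ ω ∂μ, 0 ≤ (f : X → ℂ) ω) → (∀ᵐ ω ∂μ, 0 ≤ (S f : X → ℂ) ω)


namespace QME

/-- dyadic conditional expectation on `range (2^L)` at scale `2^k`. -/
noncomputable def ce (L k : ℕ) (f : ℕ → ℝ) (x : ℕ) : ℝ :=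
  (∑ y ∈ Finset.range (2 ^ L) with y / 2 ^ k = x / 2 ^ k, f y) / 2 ^ k

/-- constant on dyadic blocks of length `2^k`. -/
def BlkC (k : ℕ) (g : ℕ → ℝ) : Prop := ∀ x y, x / 2 ^ k = y / 2 ^ k → g x = g y

lemma div_pow_mono {j k x y : ℕ} (h : j ≤ k) (hxy : x / 2 ^ j = y / 2 ^ j) :
    x / 2 ^ k = y / 2 ^ k := by
  obtain ⟨m, rfl⟩ := Nat.exists_eq_add_of_le h
  rw [pow_add, ← Nat.div_div_eq_div_mul, ← Nat.div_div_eq_div_mul, hxy]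

lemma BlkC.mono {j k : ℕ} {g : ℕ → ℝ} (hg : BlkC k g) (h : j ≤ k) : BlkC j g :=
  fun x y hxy => hg x y (div_pow_mono h hxy)

lemma BlkC_ce (L k : ℕ) (f : ℕ → ℝ) : BlkC k (ce L k f) := by
  intro x y h
  simp only [ce, h]

lemma BlkC.comp {k : ℕ} {g : ℕ → ℝ} (hg : BlkC k g) (φ : ℝ → ℝ) : BlkC k (fun x => φ (g x)) :=
  fun x y h => by simp only [hg x y h]

lemma BlkC.comp2 {k : ℕ} {g h : ℕ → ℝ} (hg : BlkC k g) (hh : BlkC k h) (φ : ℝ → ℝ → ℝ) :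
    BlkC k (fun x => φ (g x) (h x)) :=
  fun x y e => by simp only [hg x y e, hh x y e]

lemma ce_symm (L k : ℕ) (f g : ℕ → ℝ) :
    ∑ x ∈ Finset.range (2 ^ L), g x * ce L k f x = ∑ x ∈ Finset.range (2 ^ L), ce L k g x * f x := by
  simp only [ce, Finset.sum_filter, Finset.mul_sum, Finset.sum_div, Finset.sum_mul]
  rw [Finset.sum_comm]
  refine Finset.sum_congr rfl fun x _ => Finset.sum_congr rfl fun y _ => ?_
  by_cases h : x / 2 ^ k = y / 2 ^ k
  · simp [h]; ring
  · simp [h, Ne.symm h]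

lemma blk_eq (L k x : ℕ) (hk : k ≤ L) (hx : x < 2 ^ L) :
    (Finset.range (2 ^ L)).filter (fun y => y / 2 ^ k = x / 2 ^ k)
      = Finset.Ico (x / 2 ^ k * 2 ^ k) (x / 2 ^ k * 2 ^ k + 2 ^ k) := by
  have h2 : 0 < 2 ^ k := by positivity
  ext y
  simp only [Finset.mem_filter, Finset.mem_range, Finset.mem_Ico]
  rw [Nat.div_eq_iff h2]
  constructor
  · rintro ⟨_, h, h'⟩
    omega
  · rintro ⟨h, h'⟩
    refine ⟨?_, h, by omega⟩
    obtain ⟨m, rfl⟩ := Nat.exists_eq_add_of_le hk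
    have : x / 2 ^ k < 2 ^ m := by
      rw [Nat.div_lt_iff_lt_mul h2, ← pow_add, add_comm]; exact hx
    calc y < x / 2 ^ k * 2 ^ k + 2 ^ k := h'
      _ = (x / 2 ^ k + 1) * 2 ^ k := by ring
      _ ≤ 2 ^ m * 2 ^ k := Nat.mul_le_mul_right _ this
      _ = 2 ^ (k + m) := by rw [← pow_add, add_comm]

lemma blk_card (L k x : ℕ) (hk : k ≤ L) (hx : x < 2 ^ L) :
    ((Finset.range (2 ^ L)).filter (fun y => y / 2 ^ k = x / 2 ^ k)).card = 2 ^ k := by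
  rw [blk_eq L k x hk hx]; simp

lemma ce_of_blkC {L k : ℕ} {g : ℕ → ℝ} (hk : k ≤ L) (hg : BlkC k g) {x : ℕ} (hx : x < 2 ^ L) :
    ce L k g x = g x := by
  unfold ce
  rw [Finset.sum_congr rfl (g := fun _ => g x)
    (fun y hy => hg y x (Finset.mem_filter.1 hy).2)]
  rw [Finset.sum_const, blk_card L k x hk hx]
  simp

lemma sum_mul_ce {L k : ℕ} {g : ℕ → ℝ} (hk : k ≤ L) (hg : BlkC k g) (f : ℕ → ℝ) :
    ∑ x ∈ Finset.range (2 ^ L), g x * ce L k f x = ∑ x ∈ Finset.range (2 ^ L), g x * f x := by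
  rw [ce_symm]
  exact Finset.sum_congr rfl fun x hx => by rw [ce_of_blkC hk hg (Finset.mem_range.1 hx)]

lemma ce_zero {L : ℕ} (f : ℕ → ℝ) {x : ℕ} (hx : x < 2 ^ L) : ce L 0 f x = f x :=
  ce_of_blkC (Nat.zero_le _) (fun x y h => by simp at h; rw [h]) hx

lemma ce_tower {L j k : ℕ} (hj : j ≤ k) (hk : k ≤ L) (f : ℕ → ℝ) (x : ℕ) :
    ce L k (ce L j f) x = ce L k f x := by
  unfold ce
  congr 1
  have h := sum_mul_ce (L := L) (k := j) (g := fun y => if y / 2 ^ k = x / 2 ^ k then 1 else 0)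
    (hj.trans hk) (fun a b hab => by simp only [div_pow_mono hj hab]) f
  simp only [ite_mul, one_mul, zero_mul, ← Finset.sum_filter] at h
  exact h

lemma ce_sub (L k : ℕ) (f g : ℕ → ℝ) (x : ℕ) :
    ce L k (fun y => f y - g y) x = ce L k f x - ce L k g x := by
  simp only [ce, Finset.sum_sub_distrib, sub_div]

lemma ce_nonneg {L k : ℕ} {f : ℕ → ℝ} (hf : ∀ x, 0 ≤ f x) (x : ℕ) : 0 ≤ ce L k f x :=
  div_nonneg (Finset.sum_nonneg fun y _ => hf y) (by positivity)

lemma ce_mono {L k : ℕ} {f g : ℕ → ℝ} (h : ∀ x, f x ≤ g x) (x : ℕ) : ce L k f x ≤ ce L k g x :=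
  div_le_div_of_nonneg_right (Finset.sum_le_sum fun y _ => h y) (by positivity)

/-- running maximum of a martingale. -/
noncomputable def rmax (L : ℕ) (σ : ℕ → ℕ) (f : ℕ → ℝ) : ℕ → ℕ → ℝ
  | 0, x => ce L (σ 0) f x
  | i + 1, x => max (rmax L σ f i x) (ce L (σ (i + 1)) f x)

lemma rmax_blkC {L : ℕ} {σ : ℕ → ℕ} (hσ : Antitone σ) (f : ℕ → ℝ) (i : ℕ) :
    BlkC (σ i) (rmax L σ f i) := by
  induction i with
  | zero => exact BlkC_ce _ _ _
  | succ i ih =>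
    exact (ih.mono (hσ (Nat.le_succ i))).comp2 (BlkC_ce L (σ (i+1)) f) max

lemma ce_le_rmax (L : ℕ) (σ : ℕ → ℕ) (f : ℕ → ℝ) (i : ℕ) (x : ℕ) :
    ce L (σ i) f x ≤ rmax L σ f i x := by
  cases i with
  | zero => exact le_rfl
  | succ i => exact le_max_right _ _

lemma rmax_mono (L : ℕ) (σ : ℕ → ℕ) (f : ℕ → ℝ) (x : ℕ) : Monotone fun i => rmax L σ f i x :=
  monotone_nat_of_le_succ fun _ => le_max_left _ _

lemma rmax_le {L : ℕ} {σ : ℕ → ℕ} {f : ℕ → ℝ} {x : ℕ} {W : ℝ}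
    (h : ∀ i, ce L (σ i) f x ≤ W) (i : ℕ) : rmax L σ f i x ≤ W := by
  induction i with
  | zero => exact h 0
  | succ i ih => exact max_le ih (h _)

lemma rmax_nonneg {L : ℕ} {σ : ℕ → ℕ} {f : ℕ → ℝ} (hf : ∀ x, 0 ≤ f x) (i x : ℕ) :
    0 ≤ rmax L σ f i x := (ce_nonneg hf x).trans (ce_le_rmax L σ f i x)

/-- martingale property -/
lemma mart {L : ℕ} {σ : ℕ → ℕ} (hσ : Antitone σ) (hL : ∀ i, σ i ≤ L) (f : ℕ → ℝ) {i : ℕ}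
    {g : ℕ → ℝ} (hg : BlkC (σ i) g) :
    ∑ x ∈ Finset.range (2 ^ L), g x * ce L (σ (i + 1)) f x =
      ∑ x ∈ Finset.range (2 ^ L), g x * ce L (σ i) f x := by
  rw [sum_mul_ce (hL _) hg, sum_mul_ce (hL _) (hg.mono (hσ (Nat.le_succ i)))]

lemma young_aux {p a b : ℝ} (hp : 1 < p) (ha : 0 ≤ a) (hb : 0 ≤ b) :
    a * b ^ (p - 1) ≤ a ^ p / p + (p - 1) / p * b ^ p := by
  have h := Real.young_inequality_of_nonneg ha (Real.rpow_nonneg hb (p - 1))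
    (Real.HolderConjugate.conjExponent hp)
  have hp0 : p - 1 ≠ 0 := by linarith
  have hp1 : p ≠ 0 := by linarith
  rw [← Real.rpow_mul hb] at h
  have e : (p - 1) * (Real.conjExponent p) = p := by
    unfold Real.conjExponent; field_simp
  rw [e] at h
  have e2 : b ^ p / (Real.conjExponent p) = (p - 1) / p * b ^ p := by
    unfold Real.conjExponent; field_simp
  rw [e2] at h
  exact h

/-- Doob's maximal inequality, first form. -/
lemma doob_aux {L : ℕ} {σ : ℕ → ℕ} (hσ : Antitone σ) (hL : ∀ i, σ i ≤ L) {f : ℕ → ℝ}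
    (hf : ∀ x, 0 ≤ f x) {p : ℝ} (hp : 1 < p) (n : ℕ) :
    ∑ x ∈ Finset.range (2 ^ L), (rmax L σ f n x) ^ p ≤
      p / (p - 1) * ∑ x ∈ Finset.range (2 ^ L), (rmax L σ f n x) ^ (p - 1) * ce L (σ n) f x := by
  have hp0 : 0 < p - 1 := by linarith
  have hp1 : 0 < p := by linarith
  have hc : 1 ≤ p / (p - 1) := by rw [le_div_iff₀ hp0]; linarith
  induction n with
  | zero =>
    have : ∀ x, rmax L σ f 0 x ^ p = (rmax L σ f 0 x) ^ (p - 1) * ce L (σ 0) f x := by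
      intro x
      have h0 := ce_nonneg (L := L) (k := σ 0) hf x
      show ce L (σ 0) f x ^ p = ce L (σ 0) f x ^ (p - 1) * ce L (σ 0) f x
      rw [← Real.rpow_add_one' h0 (by linarith)]; simp
    simp only [this]
    refine le_mul_of_one_le_left (Finset.sum_nonneg fun x _ => ?_) hc
    exact mul_nonneg (Real.rpow_nonneg (rmax_nonneg hf _ _) _) (ce_nonneg hf x)
  | succ i ih =>
    have hm := mart hσ hL f (i := i) (g := fun x => (rmax L σ f i x) ^ (p - 1))
      ((rmax_blkC hσ f i).comp (fun t => t ^ (p - 1)))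
    rw [← hm] at ih
    have key : ∀ x, rmax L σ f (i+1) x ^ p ≤ rmax L σ f i x ^ p
        + p / (p - 1) * ((rmax L σ f (i+1) x) ^ (p - 1) * ce L (σ (i+1)) f x
          - (rmax L σ f i x) ^ (p - 1) * ce L (σ (i+1)) f x) := by
      intro x
      rcases le_total (ce L (σ (i+1)) f x) (rmax L σ f i x) with h | h
      · have : rmax L σ f (i+1) x = rmax L σ f i x := max_eq_left h
        rw [this]; simp
      · have e : rmax L σ f (i+1) x = ce L (σ (i+1)) f x := max_eq_right h
        rw [e]
        set a := ce L (σ (i+1)) f x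
        have ha : 0 ≤ a := ce_nonneg hf x
        set b := rmax L σ f i x
        have hb : 0 ≤ b := rmax_nonneg hf i x
        have h1 : a ^ (p - 1) * a = a ^ p := by
          rw [← Real.rpow_add_one' ha (by linarith)]; simp
        rw [h1]
        have hy := young_aux hp ha hb
        have h2 : p / (p - 1) * (a * b ^ (p-1)) ≤ p / (p - 1) * (a ^ p / p + (p - 1) / p * b ^ p) :=
          mul_le_mul_of_nonneg_left hy (by positivity)
        have h3 : p / (p - 1) * (a ^ p / p + (p - 1) / p * b ^ p) = a ^ p / (p - 1) + b ^ p := by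
          field_simp
        have h4 : p / (p - 1) * a ^ p = a ^ p + a ^ p / (p - 1) := by field_simp; ring
        rw [mul_sub, h4, mul_comm (b ^ (p-1)) a]
        linarith
    calc _ ≤ ∑ x ∈ Finset.range (2 ^ L), (rmax L σ f i x ^ p
        + p / (p - 1) * ((rmax L σ f (i+1) x) ^ (p - 1) * ce L (σ (i+1)) f x
          - (rmax L σ f i x) ^ (p - 1) * ce L (σ (i+1)) f x)) :=
          Finset.sum_le_sum fun x _ => key x
      _ ≤ _ := by
          rw [Finset.sum_add_distrib, ← Finset.mul_sum, Finset.sum_sub_distrib, mul_sub]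
          linarith

/-- pointwise absorption -/
lemma absorb {p c a b : ℝ} (hp : 1 < p) (hc : 0 < c) (ha : 0 ≤ a) (hb : 0 ≤ b) :
    c * (b ^ (p - 1) * a) ≤ b ^ p / 2 + c * (2 * c) ^ (p - 1) * a ^ p := by
  have e : ∀ t : ℝ, 0 ≤ t → t ^ (p - 1) * t = t ^ p := by
    intro t ht
    rw [← Real.rpow_add_one' ht (by linarith)]; simp
  rcases le_total (2 * c * a) b with h | h
  · have h1 : c * (b ^ (p - 1) * a) ≤ b ^ p / 2 := by
      rw [← e b hb]
      have : 0 ≤ b ^ (p - 1) := Real.rpow_nonneg hb _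
      nlinarith
    have : 0 ≤ c * (2 * c) ^ (p - 1) * a ^ p := by positivity
    linarith
  · have h1 : b ^ (p - 1) ≤ (2 * c) ^ (p - 1) * a ^ (p - 1) := by
      rw [← Real.mul_rpow (by positivity) ha]
      exact Real.rpow_le_rpow hb h (by linarith)
    have : c * (b ^ (p - 1) * a) ≤ c * (((2 * c) ^ (p - 1) * a ^ (p - 1)) * a) := by gcongr
    rw [mul_assoc, e a ha, ← mul_assoc] at this
    have : 0 ≤ b ^ p / 2 := by positivity
    linarith

lemma doob {L : ℕ} {σ : ℕ → ℕ} (hσ : Antitone σ) (hL : ∀ i, σ i ≤ L) {f : ℕ → ℝ}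
    (hf : ∀ x, 0 ≤ f x) {p : ℝ} (hp : 1 < p) (n : ℕ) :
    ∑ x ∈ Finset.range (2 ^ L), (rmax L σ f n x) ^ p ≤
      2 * (p / (p - 1) * (2 * (p / (p - 1))) ^ (p - 1)) * ∑ x ∈ Finset.range (2 ^ L), f x ^ p := by
  have hp0 : 0 < p - 1 := by linarith
  have h := doob_aux hσ hL hf hp n
  rw [sum_mul_ce (hL n) ((rmax_blkC hσ f n).comp (fun t => t ^ (p - 1)))] at h
  have h2 : ∑ x ∈ Finset.range (2 ^ L), p / (p - 1) * (rmax L σ f n x ^ (p - 1) * f x) ≤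
      ∑ x ∈ Finset.range (2 ^ L), ((rmax L σ f n x) ^ p / 2 +
        p / (p - 1) * (2 * (p / (p - 1))) ^ (p - 1) * f x ^ p) :=
    Finset.sum_le_sum fun x _ => absorb hp (by positivity) (hf x) (rmax_nonneg hf n x)
  rw [Finset.sum_add_distrib, ← Finset.sum_div, ← Finset.mul_sum, ← Finset.mul_sum] at h2
  linarith

/-- Square function weighted, high exponents. -/
lemma sq_high {L : ℕ} {σ : ℕ → ℕ} (hσ : Antitone σ) (hL : ∀ i, σ i ≤ L) {f w F W : ℕ → ℝ}
    (hw : ∀ x, 0 ≤ w x) (hF : ∀ i x, |ce L (σ i) f x| ≤ F x)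
    (hW : ∀ i x, ce L (σ i) w x ≤ W x) (n : ℕ) :
    ∑ i ∈ Finset.range n, ∑ x ∈ Finset.range (2 ^ L),
      (ce L (σ (i + 1)) f x - ce L (σ i) f x) ^ 2 * w x ≤
      5 * ∑ x ∈ Finset.range (2 ^ L), F x ^ 2 * W x := by
  have hF0 : ∀ x, 0 ≤ F x := fun x => (abs_nonneg _).trans (hF 0 x)
  have hsq : ∀ i x, (ce L (σ i) f x) ^ 2 ≤ F x ^ 2 := fun i x =>
    sq_le_sq' (by linarith [neg_abs_le (ce L (σ i) f x), hF i x]) ((le_abs_self _).trans (hF i x))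
  have main : ∑ i ∈ Finset.range n, ∑ x ∈ Finset.range (2 ^ L),
      (ce L (σ (i + 1)) f x - ce L (σ i) f x) ^ 2 * w x ≤
      ∑ x ∈ Finset.range (2 ^ L), (ce L (σ n) f x ^ 2 + 4 * F x ^ 2) * rmax L σ w n x := by
    induction n with
    | zero =>
      simp only [Finset.range_zero, Finset.sum_empty]
      exact Finset.sum_nonneg fun x _ => mul_nonneg (by positivity) (rmax_nonneg hw _ _)
    | succ n ih =>
      rw [Finset.sum_range_succ]
      set a := ce L (σ n) f with ha
      set b := ce L (σ (n+1)) f with hb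
      set U := rmax L σ w n with hU
      set U' := rmax L σ w (n+1) with hU'
      have ba : BlkC (σ n) a := BlkC_ce _ _ _
      have bb : BlkC (σ (n+1)) b := BlkC_ce _ _ _
      have bU : BlkC (σ n) U := rmax_blkC hσ w n
      have s1 : ∑ x ∈ Finset.range (2 ^ L), (b x - a x) ^ 2 * w x ≤
          ∑ x ∈ Finset.range (2 ^ L), (b x - a x) ^ 2 * U' x := by
        rw [← sum_mul_ce (hL (n+1)) (f := w) (g := fun x => (b x - a x) ^ 2)
          (bb.comp2 (ba.mono (hσ (Nat.le_succ n))) (fun s t => (s - t) ^ 2))]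
        exact Finset.sum_le_sum fun x _ => mul_le_mul_of_nonneg_left
          (ce_le_rmax L σ w (n+1) x) (sq_nonneg _)
      have s2 : ∑ x ∈ Finset.range (2 ^ L), (U x * a x) * b x =
          ∑ x ∈ Finset.range (2 ^ L), (U x * a x) * a x :=
        mart hσ hL f (i := n) (g := fun x => U x * a x) (bU.comp2 ba (fun s t => s * t))
      have s3 : ∑ x ∈ Finset.range (2 ^ L), (b x - a x) ^ 2 * U' x ≤
          ∑ x ∈ Finset.range (2 ^ L), ((b x ^ 2 + 4 * F x ^ 2) * U' x
            - (a x ^ 2 + 4 * F x ^ 2) * U x - 2 * ((U x * a x) * b x - (U x * a x) * a x)) := by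
        refine Finset.sum_le_sum fun x _ => ?_
        have u1 : U x ≤ U' x := rmax_mono L σ w x (Nat.le_succ n)
        have h1 : (b x - a x) ^ 2 ≤ 4 * F x ^ 2 := by
          have := hsq n x
          have := hsq (n+1) x
          nlinarith [sq_nonneg (b x + a x)]
        have h0 : 0 ≤ b x ^ 2 := sq_nonneg _
        nlinarith [mul_le_mul_of_nonneg_right h1 (sub_nonneg.2 u1), mul_nonneg h0 (sub_nonneg.2 u1)]
      simp only [Finset.sum_sub_distrib, ← Finset.mul_sum] at s3
      rw [s2] at s3
      linarith
  refine main.trans ?_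
  rw [Finset.mul_sum]
  refine Finset.sum_le_sum fun x _ => ?_
  have h1 : ce L (σ n) f x ^ 2 + 4 * F x ^ 2 ≤ 5 * F x ^ 2 := by linarith [hsq n x]
  have h2 : rmax L σ w n x ≤ W x := rmax_le (fun i => hW i x) n
  calc _ ≤ (5 * F x ^ 2) * W x :=
        mul_le_mul h1 h2 (rmax_nonneg hw _ _) (by positivity)
    _ = _ := by ring

end QME

namespace QME

lemma rpow_slope {r a b : ℝ} (hr0 : 0 < r) (hr : r ≤ 1) (ha : 0 ≤ a) (hab : a ≤ b) (hb : b ≤ 1) :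
    r * (b - a) ≤ b ^ r - a ^ r := by
  rcases eq_or_lt_of_le (ha.trans hab) with h0 | h0
  · have : a = 0 := by linarith
    rw [← h0, this]; simp
  · have h1 := rpow_one_add_le_one_add_mul_self (s := a / b - 1) (p := r)
      (by linarith [div_nonneg ha h0.le]) hr0.le hr
    have e : 1 + (a / b - 1) = a / b := by ring
    rw [e, Real.div_rpow ha h0.le, div_le_iff₀ (Real.rpow_pos_of_pos h0 r)] at h1
    have e2 : (1 + r * (a / b - 1)) * b ^ r = b ^ r - r * (b - a) * (b ^ r / b) := by
      field_simp; ring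
    rw [e2] at h1
    have h2 : 1 ≤ b ^ r / b := by
      rw [le_div_iff₀ h0, one_mul]
      calc b = b ^ (1:ℝ) := (Real.rpow_one b).symm
        _ ≤ b ^ r := Real.rpow_le_rpow_of_exponent_ge h0 hb hr
    have h3 : 0 ≤ r * (b - a) := mul_nonneg hr0.le (by linarith)
    nlinarith

lemma cvx_one {p a b : ℝ} (hp : 1 < p) (hp2 : p ≤ 2) (ha : 0 ≤ a) (ha1 : a ≤ 1) (hb : 0 ≤ b)
    (hb1 : b ≤ 1) :
    a ^ p + p * a ^ (p - 1) * (b - a) + p * (p - 1) / 2 * (b - a) ^ 2 ≤ b ^ p := by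
  set h : ℝ → ℝ := fun b => b ^ p - (a ^ p + p * a ^ (p - 1) * (b - a)
    + p * (p - 1) / 2 * (b - a) ^ 2) with hh
  have hd : ∀ t, HasDerivAt h (p * t ^ (p - 1) - (p * a ^ (p - 1) + p * (p - 1) * (t - a))) t := by
    intro t
    have h1 := Real.hasDerivAt_rpow_const (x := t) (p := p) (Or.inr hp.le)
    have h2 : HasDerivAt (fun b => a ^ p + p * a ^ (p - 1) * (b - a)
      + p * (p - 1) / 2 * (b - a) ^ 2) (p * a ^ (p - 1) + p * (p - 1) * (t - a)) t := by
      have i := (hasDerivAt_id t).sub_const a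
      have := ((i.const_mul (p * a ^ (p - 1))).const_add (a ^ p)).add
        ((i.pow 2).const_mul (p * (p - 1) / 2))
      refine this.congr_deriv ?_
      simp; ring
    exact h1.sub h2
  have hcont : Continuous h := continuous_iff_continuousAt.2 fun t => (hd t).continuousAt
  have h0 : h a = 0 := by simp [hh]
  suffices 0 ≤ h b by simp only [hh] at this; linarith
  rcases le_total a b with hab | hab
  · have : MonotoneOn h (Set.Icc a 1) := by
      refine monotoneOn_of_deriv_nonneg (convex_Icc _ _) hcont.continuousOn
        (fun t _ => (hd t).differentiableAt.differentiableWithinAt) ?_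
      intro t ht
      rw [interior_Icc] at ht
      rw [(hd t).deriv]
      have := rpow_slope (r := p - 1) (by linarith) (by linarith) ha ht.1.le ht.2.le
      nlinarith
    rw [← h0]
    exact this ⟨le_rfl, ha1⟩ ⟨hab, hb1⟩ hab
  · have : AntitoneOn h (Set.Icc 0 a) := by
      refine antitoneOn_of_deriv_nonpos (convex_Icc _ _) hcont.continuousOn
        (fun t _ => (hd t).differentiableAt.differentiableWithinAt) ?_
      intro t ht
      rw [interior_Icc] at ht
      rw [(hd t).deriv]
      have := rpow_slope (r := p - 1) (by linarith) (by linarith) ht.1.le ht.2.le ha1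
      nlinarith
    rw [← h0]
    exact this ⟨hb, hab⟩ ⟨ha, le_rfl⟩ hab

lemma cvx {p a b U : ℝ} (hp : 1 < p) (hp2 : p ≤ 2) (hU : 0 < U) (ha : 0 ≤ a) (ha1 : a ≤ U)
    (hb : 0 ≤ b) (hb1 : b ≤ U) :
    a ^ p + p * a ^ (p - 1) * (b - a) + p * (p - 1) / 2 * ((b - a) ^ 2 * U ^ (p - 2)) ≤ b ^ p := by
  have h := cvx_one hp hp2 (a := a / U) (b := b / U) (by positivity)
    ((div_le_one hU).2 ha1) (by positivity) ((div_le_one hU).2 hb1)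
  rw [Real.div_rpow ha hU.le, Real.div_rpow ha hU.le, Real.div_rpow hb hU.le] at h
  have e1 : U ^ (p - 1) = U ^ p / U := by rw [Real.rpow_sub_one hU.ne']
  have e2 : U ^ (p - 2) = U ^ p / U ^ 2 := by
    rw [Real.rpow_sub hU]; norm_cast
  have hUp : 0 < U ^ p := Real.rpow_pos_of_pos hU p
  rw [e1] at h
  rw [e2]
  have h2 := mul_le_mul_of_nonneg_left h hUp.le
  have e3 : U ^ p * (b ^ p / U ^ p) = b ^ p := by field_simp
  rw [e3] at h2
  refine le_trans (le_of_eq ?_) h2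
  field_simp

lemma tangent {p a b : ℝ} (hp : 1 < p) (ha : 0 ≤ a) (hb : 0 ≤ b) :
    a ^ p + p * a ^ (p - 1) * (b - a) ≤ b ^ p := by
  have h := young_aux hp hb ha
  have e : a ^ (p - 1) * a = a ^ p := by
    rw [← Real.rpow_add_one' ha (by linarith)]; simp
  have h2 := mul_le_mul_of_nonneg_left h (by linarith : (0:ℝ) ≤ p)
  have e2 : p * (b ^ p / p + (p - 1) / p * a ^ p) = b ^ p + (p - 1) * a ^ p := by
    field_simp
  rw [e2] at h2
  have : p * a ^ (p - 1) * (b - a) = p * (b * a ^ (p - 1)) - p * a ^ p := by rw [← e]; ring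
  linarith

/-- Square function weighted, low exponents. -/
lemma sq_low {L : ℕ} {σ : ℕ → ℕ} (hσ : Antitone σ) (hL : ∀ i, σ i ≤ L) {f u : ℕ → ℝ}
    (hf : ∀ x, 0 ≤ f x) {p : ℝ} (hp : 1 < p) (hp2 : p ≤ 2)
    (hu : ∀ x < 2 ^ L, 0 < u x) (hu2 : ∀ i, ∀ x < 2 ^ L, ce L (σ i) f x ≤ u x) (n : ℕ) :
    ∑ i ∈ Finset.range n, ∑ x ∈ Finset.range (2 ^ L),
      (ce L (σ (i + 1)) f x - ce L (σ i) f x) ^ 2 * u x ^ (p - 2) ≤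
      2 / (p * (p - 1)) * ∑ x ∈ Finset.range (2 ^ L), f x ^ p := by
  have hc : 0 < p * (p - 1) / 2 := by
    have : 0 < p - 1 := by linarith
    positivity
  have main : p * (p - 1) / 2 * ∑ i ∈ Finset.range n, ∑ x ∈ Finset.range (2 ^ L),
      (ce L (σ (i + 1)) f x - ce L (σ i) f x) ^ 2 * u x ^ (p - 2) ≤
      ∑ x ∈ Finset.range (2 ^ L), ce L (σ n) f x ^ p := by
    induction n with
    | zero =>
      simp only [Finset.range_zero, Finset.sum_empty, mul_zero]
      exact Finset.sum_nonneg fun x _ => Real.rpow_nonneg (ce_nonneg hf x) _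
    | succ n ih =>
      rw [Finset.sum_range_succ, mul_add]
      have hm := mart hσ hL f (i := n) (g := fun x => p * ce L (σ n) f x ^ (p - 1))
        ((BlkC_ce _ _ _).comp (fun t => p * t ^ (p - 1)))
      have : ∑ x ∈ Finset.range (2 ^ L), (ce L (σ n) f x ^ p
          + (p * ce L (σ n) f x ^ (p - 1) * ce L (σ (n+1)) f x
            - p * ce L (σ n) f x ^ (p - 1) * ce L (σ n) f x)
          + p * (p - 1) / 2 * ((ce L (σ (n+1)) f x - ce L (σ n) f x) ^ 2 * u x ^ (p - 2)))
          ≤ ∑ x ∈ Finset.range (2 ^ L), ce L (σ (n+1)) f x ^ p := by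
        refine Finset.sum_le_sum fun x hx => ?_
        rw [Finset.mem_range] at hx
        rw [← mul_sub]
        exact cvx hp hp2 (hu x hx) (ce_nonneg hf x) (hu2 _ x hx) (ce_nonneg hf x) (hu2 _ x hx)
      rw [Finset.sum_add_distrib, Finset.sum_add_distrib, Finset.sum_sub_distrib, hm,
        ← Finset.mul_sum] at this
      linarith
  have fin : ∑ x ∈ Finset.range (2 ^ L), ce L (σ n) f x ^ p ≤ ∑ x ∈ Finset.range (2 ^ L), f x ^ p := by
    have hm := sum_mul_ce (hL n) (f := f) (g := fun x => p * ce L (σ n) f x ^ (p - 1))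
        ((BlkC_ce _ _ _).comp (fun t => p * t ^ (p - 1)))
    have : ∑ x ∈ Finset.range (2 ^ L), (ce L (σ n) f x ^ p
          + (p * ce L (σ n) f x ^ (p - 1) * f x
            - p * ce L (σ n) f x ^ (p - 1) * ce L (σ n) f x)) ≤
        ∑ x ∈ Finset.range (2 ^ L), f x ^ p := by
      refine Finset.sum_le_sum fun x hx => ?_
      rw [← mul_sub]
      exact tangent hp (ce_nonneg hf x) (hf x)
    rw [Finset.sum_add_distrib, Finset.sum_sub_distrib, hm] at this
    linarith
  have e : 2 / (p * (p - 1)) = (p * (p - 1) / 2)⁻¹ := by rw [inv_div]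
  rw [e, ← div_eq_inv_mul, le_div_iff₀ hc, mul_comm]
  exact main.trans fin

end QME

namespace QME

lemma ce_outside {L k : ℕ} (hk : k ≤ L) (f : ℕ → ℝ) {x : ℕ} (hx : 2 ^ L ≤ x) : ce L k f x = 0 := by
  unfold ce
  rw [Finset.filter_eq_empty_iff.2, Finset.sum_empty, zero_div]
  intro y hy h
  rw [Finset.mem_range] at hy
  have := div_pow_mono hk h
  rw [Nat.div_eq_of_lt hy] at this
  have h2 : 1 ≤ x / 2 ^ L := (Nat.one_le_div_iff (by positivity)).2 hx
  omega

lemma sum_shift_right {N s : ℕ} {g : ℕ → ℝ} (hg : ∀ x, 0 ≤ g x) (h0 : ∀ x, N ≤ x → g x = 0) :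
    ∑ x ∈ Finset.range N, g (x + s) ≤ ∑ x ∈ Finset.range N, g x := by
  have h1 : ∑ x ∈ Finset.range N, g (x + s) = ∑ x ∈ Finset.Ico s (N + s), g x := by
    rw [Finset.sum_Ico_eq_sum_range]
    simp [add_comm]
  have h2 : ∑ x ∈ Finset.range N, g x = ∑ x ∈ Finset.range (N + s), g x := by
    rw [Finset.sum_range_add]
    simp [h0]
  rw [h1, h2]
  exact Finset.sum_le_sum_of_subset_of_nonneg (fun x hx => by simp at hx ⊢; omega)
    (fun x _ _ => hg x)

lemma sum_shift_left {N s : ℕ} {g : ℕ → ℝ} (hg : ∀ x, 0 ≤ g x) :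
    ∑ x ∈ Finset.range N, (if s ≤ x then g (x - s) else 0) ≤ ∑ x ∈ Finset.range N, g x := by
  rw [← Finset.sum_filter]
  have h1 : ∑ x ∈ Finset.range N with s ≤ x, g (x - s) =
      ∑ y ∈ ((Finset.range N).filter (fun x => s ≤ x)).image (fun x => x - s), g y := by
    rw [Finset.sum_image]
    intro a ha b hb hab
    simp at ha hb hab
    omega
  rw [h1]
  refine Finset.sum_le_sum_of_subset_of_nonneg (fun x hx => ?_) (fun x _ _ => hg x)
  simp only [Finset.mem_image, Finset.mem_filter, Finset.mem_range] at hx ⊢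
  obtain ⟨a, ha, rfl⟩ := hx
  omega

/-- maximum over three neighbours -/
noncomputable def tri (s : ℕ) (g : ℕ → ℝ) (x : ℕ) : ℝ :=
  max (g x) (max (g (x + s)) (if s ≤ x then g (x - s) else 0))

noncomputable def nmax (L : ℕ) (f : ℕ → ℝ) : ℕ → ℕ → ℝ
  | 0, x => tri (2 ^ L) (rmax L (fun i => L - i) f 0) x
  | i + 1, x => max (nmax L f i x) (tri (2 ^ (L - (i + 1))) (rmax L (fun i => L - i) f (i + 1)) x)

lemma tri_le_nmax (L : ℕ) (f : ℕ → ℝ) (i x : ℕ) :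
    tri (2 ^ (L - i)) (rmax L (fun i => L - i) f i) x ≤ nmax L f i x := by
  cases i with
  | zero => exact le_rfl
  | succ i => exact le_max_right _ _

lemma nmax_mono (L : ℕ) (f : ℕ → ℝ) (x : ℕ) : Monotone fun i => nmax L f i x :=
  monotone_nat_of_le_succ fun _ => le_max_left _ _

lemma anti_sub (L : ℕ) : Antitone (fun i => L - i) := fun a b h => by
  simp only; omega

lemma rmax_outside {L : ℕ} (f : ℕ → ℝ) (i : ℕ) {x : ℕ} (hx : 2 ^ L ≤ x) :
    rmax L (fun i => L - i) f i x = 0 := by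
  induction i with
  | zero => exact ce_outside (by simp) f hx
  | succ i ih =>
    show max (rmax L (fun i => L - i) f i x) (ce L (L - (i+1)) f x) = 0
    rw [ih, ce_outside (by simp) f hx, max_self]

lemma half_shift_right (m x : ℕ) : (x + 2 ^ m) / 2 ^ (m + 1) = x / 2 ^ (m + 1) ∨
    (x + 2 ^ m) / 2 ^ (m + 1) = (x + 2 ^ (m + 1)) / 2 ^ (m + 1) := by
  have h : 0 < 2 ^ m := by positivity
  rw [Nat.add_div_right x (by positivity : 0 < 2 ^ (m+1)), pow_succ]
  generalize 2 ^ m = s at *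
  have h1 := Nat.div_add_mod x (s * 2)
  have h2 := Nat.mod_lt x (by omega : 0 < s * 2)
  generalize x / (s * 2) = q at *
  generalize x % (s * 2) = r at *
  subst h1
  rcases lt_or_ge r s with h3 | h3
  · left
    rw [Nat.div_eq_iff (by omega)]
    constructor
    · nlinarith
    · have : s * 2 * q + r + s < q * (s * 2) + s * 2 := by nlinarith
      omega
  · right
    rw [Nat.div_eq_iff (by omega)]
    constructor
    · nlinarith
    · have : s * 2 * q + r + s < (q + 1) * (s * 2) + s * 2 := by nlinarith
      omega

lemma half_shift_left (m x : ℕ) (hx : 2 ^ m ≤ x) : (x - 2 ^ m) / 2 ^ (m + 1) = x / 2 ^ (m + 1) ∨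
    (2 ^ (m + 1) ≤ x ∧ (x - 2 ^ m) / 2 ^ (m + 1) = (x - 2 ^ (m + 1)) / 2 ^ (m + 1)) := by
  rcases lt_or_ge x (2 ^ (m + 1)) with h | h
  · left
    rw [Nat.div_eq_of_lt h, Nat.div_eq_of_lt (by omega)]
  · obtain ⟨y, rfl⟩ := Nat.exists_eq_add_of_le' h
    have e : y + 2 ^ (m + 1) - 2 ^ m = y + 2 ^ m := by rw [pow_succ]; omega
    rw [e, Nat.add_sub_cancel]
    rcases half_shift_right m y with h | h
    · right; exact ⟨by omega, h⟩
    · left; exact h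

lemma psi_max {p : ℝ} (hp : 0 < p) {a b c : ℝ} {D : ℝ} (hb : 0 ≤ b) (hba : b ≤ a) (hbc : b ≤ c)
    (hD : 0 ≤ D) : c ^ p ≤ a ^ p + ((c ^ p - b ^ p) + D) := by
  have : b ^ p ≤ a ^ p := Real.rpow_le_rpow hb hba hp.le
  linarith

lemma nmax_sum {L : ℕ} {f : ℕ → ℝ} (hf : ∀ x, 0 ≤ f x) {p : ℝ} (hp : 0 < p) (i : ℕ) (hi : i ≤ L) :
    ∑ x ∈ Finset.range (2 ^ L), nmax L f i x ^ p ≤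
      3 * ∑ x ∈ Finset.range (2 ^ L), rmax L (fun i => L - i) f i x ^ p := by
  set G := rmax L (fun i => L - i) f with hG
  have G0 : ∀ i x, 0 ≤ G i x := fun i x => rmax_nonneg hf i x
  have Gout : ∀ i x, 2 ^ L ≤ x → G i x = 0 := fun i x hx => rmax_outside f i hx
  have Gmono : ∀ i x, G i x ≤ G (i+1) x := fun i x => rmax_mono L _ f x (Nat.le_succ i)
  induction i with
  | zero =>
    set g : ℕ → ℝ := fun x => G 0 x ^ p
    have g0 : ∀ x, 0 ≤ g x := fun x => Real.rpow_nonneg (G0 _ _) _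
    have gout : ∀ x, 2 ^ L ≤ x → g x = 0 := fun x hx => by
      simp only [g, Gout 0 x hx, Real.zero_rpow hp.ne']
    have key : ∀ x, nmax L f 0 x ^ p ≤ g x + (g (x + 2 ^ L) + if 2 ^ L ≤ x then g (x - 2 ^ L) else 0) := by
      intro x
      have i0 : 0 ≤ (if 2 ^ L ≤ x then g (x - 2 ^ L) else 0) := by split_ifs; exacts [g0 _, le_rfl]
      show tri (2 ^ L) (G 0) x ^ p ≤ _
      unfold tri
      rcases max_choice (G 0 x) (max (G 0 (x + 2 ^ L)) (if 2 ^ L ≤ x then G 0 (x - 2 ^ L) else 0))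
        with h | h <;> rw [h]
      · linarith [g0 (x + 2 ^ L)]
      · rcases max_choice (G 0 (x + 2 ^ L)) (if 2 ^ L ≤ x then G 0 (x - 2 ^ L) else 0)
          with h | h <;> rw [h]
        · linarith [g0 x]
        · split_ifs with h3
          · have := g0 x; have := g0 (x + 2 ^ L); simp only [g] at *; linarith
          · rw [Real.zero_rpow hp.ne']; linarith [g0 x, g0 (x + 2 ^ L)]
    calc _ ≤ ∑ x ∈ Finset.range (2 ^ L), (g x + (g (x + 2 ^ L) + if 2 ^ L ≤ x then g (x - 2 ^ L) else 0)) :=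
          Finset.sum_le_sum fun x _ => key x
      _ ≤ _ := by
        rw [Finset.sum_add_distrib, Finset.sum_add_distrib]
        have h1 := sum_shift_right (N := 2 ^ L) (s := 2 ^ L) g0 gout
        have h2 := sum_shift_left (N := 2 ^ L) (s := 2 ^ L) g0
        change _ ≤ 3 * ∑ x ∈ Finset.range (2 ^ L), g x
        linarith
  | succ i ih =>
    have ih := ih (by omega)
    set δ : ℕ → ℝ := fun x => G (i+1) x ^ p - G i x ^ p with hδ
    have d0 : ∀ x, 0 ≤ δ x := fun x => sub_nonneg.2 (Real.rpow_le_rpow (G0 _ _) (Gmono i x) hp.le)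
    have dout : ∀ x, 2 ^ L ≤ x → δ x = 0 := fun x hx => by
      simp only [δ, Gout _ x hx, sub_self]
    obtain ⟨m, hm⟩ : ∃ m, L - i = m + 1 := ⟨L - i - 1, by omega⟩
    have hm' : L - (i + 1) = m := by omega
    have bG : BlkC (m+1) (G i) := by
      have := rmax_blkC (L := L) (anti_sub L) f i
      simp only [hm] at this; exact this
    have htri : ∀ x, tri (2 ^ (m+1)) (G i) x ≤ nmax L f i x := by
      intro x; have := tri_le_nmax L f i x; rw [hm] at this; exact this
    have t1 : ∀ x, G i x ≤ nmax L f i x := fun x => (le_max_left _ _).trans (htri x)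
    have t2 : ∀ x, G i (x + 2 ^ m) ≤ nmax L f i x := fun x => by
      rcases half_shift_right m x with h | h
      · rw [bG _ _ h]; exact t1 x
      · rw [bG _ _ h]; exact ((le_max_left _ _).trans (le_max_right _ _)).trans (htri x)
    have t3 : ∀ x, 2 ^ m ≤ x → G i (x - 2 ^ m) ≤ nmax L f i x := fun x hx => by
      rcases half_shift_left m x hx with h | ⟨h', h⟩
      · rw [bG _ _ h]; exact t1 x
      · rw [bG _ _ h]
        refine le_trans ?_ (htri x)
        unfold tri
        rw [if_pos h']
        exact (le_max_right _ _).trans (le_max_right _ _)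
    have n0 : ∀ x, 0 ≤ nmax L f i x := fun x => (G0 i x).trans (t1 x)
    have key : ∀ x, nmax L f (i+1) x ^ p ≤ nmax L f i x ^ p +
        (δ x + (δ (x + 2 ^ m) + if 2 ^ m ≤ x then δ (x - 2 ^ m) else 0)) := by
      intro x
      have i0 : 0 ≤ (if 2 ^ m ≤ x then δ (x - 2 ^ m) else 0) := by split_ifs; exacts [d0 _, le_rfl]
      show max (nmax L f i x) (tri (2 ^ (L - (i+1))) (G (i+1)) x) ^ p ≤ _
      rw [hm']
      unfold tri
      rcases max_choice (nmax L f i x) (max (G (i+1) x) (max (G (i+1) (x + 2 ^ m))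
        (if 2 ^ m ≤ x then G (i+1) (x - 2 ^ m) else 0))) with h | h <;> rw [h]
      · linarith [d0 x, d0 (x + 2 ^ m)]
      rcases max_choice (G (i+1) x) (max (G (i+1) (x + 2 ^ m))
        (if 2 ^ m ≤ x then G (i+1) (x - 2 ^ m) else 0)) with h | h <;> rw [h]
      · have := psi_max hp (G0 i x) (t1 x) (Gmono i x) (add_nonneg (d0 (x + 2 ^ m)) i0)
        simpa only [δ] using this
      rcases max_choice (G (i+1) (x + 2 ^ m))
        (if 2 ^ m ≤ x then G (i+1) (x - 2 ^ m) else 0) with h | h <;> rw [h]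
      · have := psi_max hp (G0 i _) (t2 x) (Gmono i _) (add_nonneg (d0 x) i0)
        have e : δ (x + 2 ^ m) = G (i+1) (x + 2 ^ m) ^ p - G i (x + 2 ^ m) ^ p := rfl
        linarith
      · split_ifs with h3
        · have := psi_max hp (G0 i _) (t3 x h3) (Gmono i _) (add_nonneg (d0 x) (d0 (x + 2 ^ m)))
          have e : δ (x - 2 ^ m) = G (i+1) (x - 2 ^ m) ^ p - G i (x - 2 ^ m) ^ p := rfl
          linarith
        · rw [Real.zero_rpow hp.ne']
          linarith [d0 x, d0 (x + 2 ^ m), Real.rpow_nonneg (n0 x) p]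
    calc _ ≤ ∑ x ∈ Finset.range (2 ^ L), (nmax L f i x ^ p +
        (δ x + (δ (x + 2 ^ m) + if 2 ^ m ≤ x then δ (x - 2 ^ m) else 0))) :=
          Finset.sum_le_sum fun x _ => key x
      _ ≤ _ := by
        rw [Finset.sum_add_distrib, Finset.sum_add_distrib, Finset.sum_add_distrib]
        have h1 := sum_shift_right (N := 2 ^ L) (s := 2 ^ m) d0 dout
        have h2 := sum_shift_left (N := 2 ^ L) (s := 2 ^ m) d0
        have h3 : ∑ x ∈ Finset.range (2 ^ L), δ x =
          ∑ x ∈ Finset.range (2 ^ L), G (i+1) x ^ p - ∑ x ∈ Finset.range (2 ^ L), G i x ^ p := by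
          simp only [δ, Finset.sum_sub_distrib]
        linarith

/-- centered average -/
noncomputable def cm (L k : ℕ) (f : ℕ → ℝ) (x : ℕ) : ℝ :=
  (∑ y ∈ Finset.range (2 ^ L) with (y < x + 2 ^ k ∧ x < y + 2 ^ k), f y) / 2 ^ k

lemma cm_le_nmax {L k : ℕ} (hk : k ≤ L) {f : ℕ → ℝ} (hf : ∀ x, 0 ≤ f x) (x : ℕ) :
    cm L k f x ≤ 3 * nmax L f L x := by
  have hn : tri (2 ^ k) (ce L k f) x ≤ nmax L f L x := by
    have h1 := tri_le_nmax L f (L - k) x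
    have e : L - (L - k) = k := by omega
    rw [e] at h1
    refine le_trans ?_ (h1.trans (nmax_mono L f x (by omega)))
    have h2 : ∀ z, ce L k f z ≤ rmax L (fun i => L - i) f (L - k) z := fun z => by
      have := ce_le_rmax L (fun i => L - i) f (L - k) z
      simp only [e] at this; exact this
    unfold tri
    refine max_le_max (h2 _) (max_le_max (h2 _) ?_)
    split_ifs
    · exact h2 _
    · exact le_rfl
  have hP : (0:ℝ) < 2 ^ k := by positivity
  have hsub : (Finset.range (2 ^ L)).filter (fun y => y < x + 2 ^ k ∧ x < y + 2 ^ k) ⊆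
      ((Finset.range (2 ^ L)).filter (fun y => y / 2 ^ k = x / 2 ^ k)) ∪
      (((Finset.range (2 ^ L)).filter (fun y => y / 2 ^ k = (x + 2 ^ k) / 2 ^ k)) ∪
      (if 2 ^ k ≤ x then ((Finset.range (2 ^ L)).filter (fun y => y / 2 ^ k = (x - 2 ^ k) / 2 ^ k))
        else ∅)) := by
    intro y hy
    simp only [Finset.mem_filter, Finset.mem_range, Finset.mem_union] at hy ⊢
    obtain ⟨h1, h2, h3⟩ := hy
    have hp : 0 < 2 ^ k := by positivity
    have a1 : y / 2 ^ k ≤ (x + 2 ^ k) / 2 ^ k := Nat.div_le_div_right h2.le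
    have a2 : x / 2 ^ k ≤ (y + 2 ^ k) / 2 ^ k := Nat.div_le_div_right h3.le
    rw [Nat.add_div_right _ hp] at a1 a2
    rw [Nat.add_div_right _ hp]
    by_cases e1 : y / 2 ^ k = x / 2 ^ k
    · left; exact ⟨h1, e1⟩
    by_cases e2 : y / 2 ^ k = x / 2 ^ k + 1
    · right; left; exact ⟨h1, e2⟩
    · right; right
      have e3 : y / 2 ^ k + 1 = x / 2 ^ k := by omega
      have e4 : 2 ^ k ≤ x := by
        by_contra hlt
        have hx0 : x / 2 ^ k = 0 := Nat.div_eq_of_lt (by omega)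
        rw [hx0] at e3
        exact absurd e3 (Nat.succ_ne_zero _)
      rw [if_pos e4]
      simp only [Finset.mem_filter, Finset.mem_range]
      refine ⟨h1, ?_⟩
      obtain ⟨z, rfl⟩ := Nat.exists_eq_add_of_le' e4
      rw [Nat.add_div_right _ hp] at e3
      rw [Nat.add_sub_cancel]; omega
  have h1 : ∑ y ∈ Finset.range (2 ^ L) with (y < x + 2 ^ k ∧ x < y + 2 ^ k), f y ≤
      2 ^ k * ce L k f x + (2 ^ k * ce L k f (x + 2 ^ k) +
        2 ^ k * (if 2 ^ k ≤ x then ce L k f (x - 2 ^ k) else 0)) := by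
    refine (Finset.sum_le_sum_of_subset_of_nonneg hsub (fun y _ _ => hf y)).trans ?_
    have un : ∀ s t : Finset ℕ, ∑ y ∈ s ∪ t, f y ≤ ∑ y ∈ s, f y + ∑ y ∈ t, f y := fun s t => by
      rw [← Finset.sum_union_inter]
      linarith [Finset.sum_nonneg (s := s ∩ t) (fun y _ => hf y)]
    have e : ∀ z, 2 ^ k * ce L k f z = ∑ y ∈ Finset.range (2 ^ L) with y / 2 ^ k = z / 2 ^ k, f y :=
      fun z => by unfold ce; field_simp
    refine (un _ _).trans (add_le_add (le_of_eq (e x).symm) ((un _ _).trans (add_le_add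
      (le_of_eq (e _).symm) ?_)))
    split_ifs
    · exact le_of_eq (e _).symm
    · simp
  unfold cm
  rw [div_le_iff₀ hP]
  have b1 : ce L k f x ≤ nmax L f L x := (le_max_left _ _).trans hn
  have b2 : ce L k f (x + 2 ^ k) ≤ nmax L f L x :=
    ((le_max_left _ _).trans (le_max_right _ _)).trans hn
  have b3 : (if 2 ^ k ≤ x then ce L k f (x - 2 ^ k) else 0) ≤ nmax L f L x :=
    ((le_max_right _ _).trans (le_max_right _ _)).trans hn
  have := mul_le_mul_of_nonneg_left b1 hP.le
  have := mul_le_mul_of_nonneg_left b2 hP.le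
  have := mul_le_mul_of_nonneg_left b3 hP.le
  linarith

end QME

namespace QME

lemma nmax_nonneg {L : ℕ} {f : ℕ → ℝ} (hf : ∀ x, 0 ≤ f x) (i x : ℕ) : 0 ≤ nmax L f i x :=
  ((rmax_nonneg hf i x).trans (le_max_left _ _)).trans (tri_le_nmax L f i x)

lemma cm_mono {L k : ℕ} {f g : ℕ → ℝ} (x : ℕ) (h : ∀ y < 2 ^ L, f y ≤ g y) :
    cm L k f x ≤ cm L k g x := by
  unfold cm
  gcongr with y hy
  exact h y (Finset.mem_range.1 (Finset.mem_filter.1 hy).1)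

lemma cm_big {L k : ℕ} (hk : L ≤ k) {f : ℕ → ℝ} (hf : ∀ x, 0 ≤ f x) {x : ℕ} (hx : x < 2 ^ L) :
    cm L k f x ≤ cm L L f x := by
  have h : ∀ k, L ≤ k → (Finset.range (2 ^ L)).filter (fun y => y < x + 2 ^ k ∧ x < y + 2 ^ k)
      = Finset.range (2 ^ L) := fun k hk => by
    rw [Finset.filter_eq_self]
    intro y hy
    have : 2 ^ L ≤ 2 ^ k := Nat.pow_le_pow_right (by norm_num) hk
    rw [Finset.mem_range] at hy
    omega
  unfold cm
  rw [h k hk, h L le_rfl]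
  have := Finset.sum_nonneg (s := Finset.range (2 ^ L)) (fun y _ => hf y)
  gcongr
  norm_num

lemma rdf_step {q : ℝ} (hq : 1 < q) : ∃ A : ℝ, 1 ≤ A ∧ ∀ L (f : ℕ → ℝ), (∀ x, 0 ≤ f x) →
    ∑ x ∈ Finset.range (2 ^ L), (nmax L f L x / (2 * A)) ^ q ≤
      (1 / 2) ^ q * ∑ x ∈ Finset.range (2 ^ L), f x ^ q := by
  set c := 3 * (2 * (q / (q - 1) * (2 * (q / (q - 1))) ^ (q - 1))) with hc
  have hq1 : 0 < q - 1 := by linarith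
  have hc0 : 0 < c := by positivity
  refine ⟨max 1 (c ^ (1 / q)), le_max_left _ _, fun L f hf => ?_⟩
  set A := max 1 (c ^ (1 / q))
  have hA : c ≤ A ^ q := by
    calc c = (c ^ (1 / q)) ^ q := by
          rw [← Real.rpow_mul hc0.le, one_div_mul_cancel (by linarith), Real.rpow_one]
      _ ≤ _ := Real.rpow_le_rpow (by positivity) (le_max_right _ _) (by linarith)
  have hA0 : 0 < A := lt_of_lt_of_le one_pos (le_max_left _ _)
  have h1 := nmax_sum (L := L) hf (by linarith : 0 < q) L le_rfl
  have h2 := doob (L := L) (anti_sub L) (fun i => Nat.sub_le _ _) hf hq L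
  have h3 : ∑ x ∈ Finset.range (2 ^ L), nmax L f L x ^ q ≤ c * ∑ x ∈ Finset.range (2 ^ L), f x ^ q := by
    rw [hc]; linarith
  have h4 : ∑ x ∈ Finset.range (2 ^ L), (nmax L f L x / (2 * A)) ^ q =
      (1 / 2) ^ q * (A ^ q)⁻¹ * ∑ x ∈ Finset.range (2 ^ L), nmax L f L x ^ q := by
    rw [Finset.mul_sum]
    refine Finset.sum_congr rfl fun x _ => ?_
    rw [Real.div_rpow (nmax_nonneg hf _ _) (by positivity), Real.mul_rpow (by norm_num) hA0.le,
      Real.div_rpow (by norm_num) (by norm_num), Real.one_rpow]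
    field_simp
  rw [h4, mul_assoc]
  have hAq : 0 < A ^ q := by positivity
  have S0 : 0 ≤ ∑ x ∈ Finset.range (2 ^ L), f x ^ q :=
    Finset.sum_nonneg fun x _ => Real.rpow_nonneg (hf x) _
  gcongr
  rw [inv_mul_le_iff₀ hAq]
  exact h3.trans (mul_le_mul_of_nonneg_right hA S0)

noncomputable def itr (L : ℕ) (A : ℝ) (f : ℕ → ℝ) : ℕ → ℕ → ℝ
  | 0 => f
  | i + 1 => fun x => nmax L (itr L A f i) L x / (2 * A)

lemma itr_nonneg {L : ℕ} {A : ℝ} (hA : 1 ≤ A) {f : ℕ → ℝ} (hf : ∀ x, 0 ≤ f x) (i : ℕ) :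
    ∀ x, 0 ≤ itr L A f i x := by
  induction i with
  | zero => exact hf
  | succ i ih => intro x; exact div_nonneg (nmax_nonneg ih _ _) (by linarith)

theorem rdf {q : ℝ} (hq : 1 < q) : ∃ B : ℝ, 1 ≤ B ∧ ∀ L (f : ℕ → ℝ), (∀ x, 0 ≤ f x) →
    ∃ u : ℕ → ℝ, (∀ x, 0 ≤ u x) ∧ (∀ x < 2 ^ L, f x ≤ u x) ∧
      ∑ x ∈ Finset.range (2 ^ L), u x ^ q ≤ B * ∑ x ∈ Finset.range (2 ^ L), f x ^ q ∧
      ∀ k, ∀ z < 2 ^ L, cm L k u z ≤ B * u z := by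
  obtain ⟨A, hA, hstep⟩ := rdf_step hq
  have hq0 : 0 < q := by linarith
  refine ⟨max (2 ^ q) (6 * A), le_max_of_le_right (by linarith), fun L f hf => ?_⟩
  set v := itr L A f
  have v0 : ∀ i x, 0 ≤ v i x := itr_nonneg hA hf
  set U : ℕ → ℕ → ℝ := fun m x => ∑ i ∈ Finset.range m, v i x with hU
  have U0 : ∀ m x, 0 ≤ U m x := fun m x => Finset.sum_nonneg fun i _ => v0 i x
  have Umono : ∀ x, Monotone fun m => U m x := fun x => monotone_nat_of_le_succ fun m => by
    simp only [hU, Finset.sum_range_succ]; linarith [v0 m x]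
  set nrm : (ℕ → ℝ) → ℝ := fun g => (∑ x ∈ Finset.range (2 ^ L), g x ^ q) ^ (1 / q) with hnrm
  have hn : ∀ g : ℕ → ℝ, (∀ x, 0 ≤ g x) → nrm g ^ q = ∑ x ∈ Finset.range (2 ^ L), g x ^ q := by
    intro g hg
    rw [hnrm]
    simp only
    rw [← Real.rpow_mul (Finset.sum_nonneg fun x _ => Real.rpow_nonneg (hg x) _),
      one_div_mul_cancel hq0.ne', Real.rpow_one]
  have n0 : ∀ g : ℕ → ℝ, (∀ x, 0 ≤ g x) → 0 ≤ nrm g := fun g hg =>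
    Real.rpow_nonneg (Finset.sum_nonneg fun x _ => Real.rpow_nonneg (hg x) _) _
  have nv : ∀ i, nrm (v i) ≤ (1 / 2) ^ i * nrm f := by
    intro i
    induction i with
    | zero => simp [v, itr]
    | succ i ih =>
      have h1 := hstep L (v i) (v0 i)
      change ∑ x ∈ Finset.range (2 ^ L), v (i+1) x ^ q ≤ _ at h1
      rw [← hn _ (v0 _), ← hn _ (v0 _), ← Real.mul_rpow (by norm_num) (n0 _ (v0 _))] at h1
      have h2 := (Real.rpow_le_rpow_iff (n0 _ (v0 _)) (by have := n0 _ (v0 i); positivity) hq0).1 h1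
      rw [pow_succ]; nlinarith
  have nU : ∀ m, nrm (U m) ≤ 2 * (1 - (1/2) ^ m) * nrm f := by
    intro m
    induction m with
    | zero =>
      simp [hnrm, hU, Real.zero_rpow hq0.ne', Real.zero_rpow (inv_ne_zero hq0.ne')]
    | succ m ih =>
      have h1 := Real.Lp_add_le_of_nonneg (Finset.range (2 ^ L)) hq.le (f := U m) (g := v m)
        (fun x _ => U0 m x) (fun x _ => v0 m x)
      have e : nrm (U (m+1)) ≤ nrm (U m) + nrm (v m) := by
        simpa [hnrm, hU, Finset.sum_range_succ] using h1
      have := nv m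
      rw [pow_succ]; linarith
  have nU2 : ∀ m, nrm (U m) ≤ 2 * nrm f := fun m => (nU m).trans (by
    have : (0:ℝ) ≤ (1/2) ^ m := by positivity
    nlinarith [n0 f hf])
  have sU : ∀ m, ∑ x ∈ Finset.range (2 ^ L), U m x ^ q ≤ 2 ^ q * ∑ x ∈ Finset.range (2 ^ L), f x ^ q := by
    intro m
    rw [← hn _ (U0 m), ← hn _ hf, ← Real.mul_rpow (by norm_num) (n0 _ hf)]
    exact Real.rpow_le_rpow (n0 _ (U0 m)) (nU2 m) hq0.le
  have bd : ∀ x < 2 ^ L, ∀ m, U m x ≤ 2 * nrm f := by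
    intro x hx m
    refine le_trans ?_ (nU2 m)
    rw [← Real.rpow_le_rpow_iff (U0 m x) (n0 _ (U0 m)) hq0, hn _ (U0 m)]
    exact Finset.single_le_sum (f := fun x => U m x ^ q) (fun y _ => Real.rpow_nonneg (U0 m y) q)
      (Finset.mem_range.2 hx)
  set u : ℕ → ℝ := fun x => if x < 2 ^ L then ⨆ m, U m x else 0 with hu
  have lim : ∀ x < 2 ^ L, Filter.Tendsto (fun m => U m x) Filter.atTop (nhds (u x)) := by
    intro x hx
    simp only [hu, if_pos hx]
    exact tendsto_atTop_ciSup (Umono x) ⟨2 * nrm f, by rintro _ ⟨m, rfl⟩; exact bd x hx m⟩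
  have Ule : ∀ x < 2 ^ L, ∀ m, U m x ≤ u x := fun x hx m => (Umono x).ge_of_tendsto (lim x hx) m
  have u0 : ∀ x, 0 ≤ u x := by
    intro x
    by_cases hx : x < 2 ^ L
    · exact (U0 0 x).trans (Ule x hx 0)
    · simp [hu, hx]
  have key : ∀ k ≤ L, ∀ z < 2 ^ L, cm L k u z ≤ 6 * A * u z := by
    intro k hk z hz
    have h1 : ∀ m, cm L k (U m) z ≤ 6 * A * u z := by
      intro m
      have e1 : cm L k (U m) z = ∑ i ∈ Finset.range m, cm L k (v i) z := by
        unfold cm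
        rw [← Finset.sum_div, hU, Finset.sum_comm]
      rw [e1]
      calc _ ≤ ∑ i ∈ Finset.range m, 6 * A * v (i+1) z := by
            refine Finset.sum_le_sum fun i _ => ?_
            refine (cm_le_nmax hk (v0 i) z).trans (le_of_eq ?_)
            show _ = 6 * A * (nmax L (v i) L z / (2 * A))
            field_simp; ring
        _ = 6 * A * ∑ i ∈ Finset.range m, v (i+1) z := by rw [Finset.mul_sum]
        _ ≤ 6 * A * U (m+1) z := by
            gcongr
            simp only [hU]
            rw [Finset.sum_range_succ']
            linarith [v0 0 z]
        _ ≤ _ := by have := Ule z hz (m+1); gcongr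
    refine le_of_tendsto (f := fun m => cm L k (U m) z) (x := Filter.atTop) ?_
      (Filter.Eventually.of_forall h1)
    unfold cm
    refine Filter.Tendsto.div_const ?_ _
    refine tendsto_finsetSum _ fun y hy => lim y ?_
    exact Finset.mem_range.1 (Finset.mem_filter.1 hy).1
  refine ⟨u, u0, fun x hx => ?_, ?_, fun k z hz => ?_⟩
  · have := Ule x hx 1
    simpa [hU, v, itr] using this
  · refine le_trans (?_ : _ ≤ 2 ^ q * ∑ x ∈ Finset.range (2 ^ L), f x ^ q) ?_
    · refine le_of_tendsto (f := fun m => ∑ x ∈ Finset.range (2 ^ L), U m x ^ q) (x := Filter.atTop) ?_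
        (Filter.Eventually.of_forall sU)
      refine tendsto_finsetSum _ fun y hy => ?_
      exact (lim y (Finset.mem_range.1 hy)).rpow_const (Or.inr hq0.le)
    · exact mul_le_mul_of_nonneg_right (le_max_left _ _)
        (Finset.sum_nonneg fun x _ => Real.rpow_nonneg (hf x) _)
  · refine le_trans ?_ (mul_le_mul_of_nonneg_right (le_max_right (2 ^ q) (6 * A)) (u0 z))
    rcases le_total k L with h | h
    · exact key k h z hz
    · exact (cm_big h u0 hz).trans (key L le_rfl z hz)

end QME

namespace QME

lemma zsum_full {P : ℕ} {d : ℕ → ℝ} (hz : ∀ b, ∑ y ∈ Finset.Ico (b * P) (b * P + P), d y = 0)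
    (c m : ℕ) : ∑ y ∈ Finset.Ico (c * P) ((c + m) * P), d y = 0 := by
  induction m with
  | zero => simp
  | succ m ih =>
    have e : (c + (m + 1)) * P = (c + m) * P + P := by ring
    rw [e, ← Finset.sum_Ico_consecutive d (Nat.mul_le_mul_right P (Nat.le_add_right c m))
      (Nat.le_add_right _ _), ih, hz, add_zero]

lemma cs_Ico {d : ℕ → ℝ} {a b P : ℕ} (h : b ≤ a + P) :
    (∑ y ∈ Finset.Ico a b, d y) ^ 2 ≤ P * ∑ y ∈ Finset.Ico a b, d y ^ 2 := by
  refine (sq_sum_le_card_mul_sum_sq (s := Finset.Ico a b) (f := d)).trans ?_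
  have h0 : 0 ≤ ∑ y ∈ Finset.Ico a b, d y ^ 2 := Finset.sum_nonneg fun _ _ => sq_nonneg _
  refine mul_le_mul_of_nonneg_right ?_ h0
  rw [Nat.card_Ico]
  exact_mod_cast (by omega : b - a ≤ P)

lemma zsum_sq {P : ℕ} (hP : 0 < P) {d : ℕ → ℝ}
    (hz : ∀ b, ∑ y ∈ Finset.Ico (b * P) (b * P + P), d y = 0) {a b : ℕ} (hab : a ≤ b) :
    (∑ y ∈ Finset.Ico a b, d y) ^ 2 ≤ 2 * P * ∑ y ∈ Finset.Ico a b, d y ^ 2 := by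
  have h0 : ∀ a b, 0 ≤ ∑ y ∈ Finset.Ico a b, d y ^ 2 := fun a b => Finset.sum_nonneg fun _ _ => sq_nonneg _
  have ha1 := Nat.div_add_mod a P
  have ha2 := Nat.mod_lt a hP
  have hb1 := Nat.div_add_mod b P
  have hb2 := Nat.mod_lt b hP
  have hle : a / P ≤ b / P := Nat.div_le_div_right hab
  have hPr : (0:ℝ) < P := by exact_mod_cast hP
  rcases hle.eq_or_lt with h | h
  · rw [h] at ha1
    have := cs_Ico (d := d) (a := a) (b := b) (P := P) (by omega)
    nlinarith [mul_nonneg hPr.le (h0 a b)]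
  · obtain ⟨m, hm⟩ : ∃ m, b / P = (a / P + 1) + m := ⟨b / P - (a / P + 1), by omega⟩
    have f0 := zsum_full hz (a / P + 1) m
    rw [← hm] at f0
    have l1 : a ≤ (a / P + 1) * P := by nlinarith
    have l2 : (a / P + 1) * P ≤ b / P * P := Nat.mul_le_mul_right P h
    have l3 : b / P * P ≤ b := Nat.div_mul_le_self b P
    have c1 := cs_Ico (d := d) (a := a) (b := (a / P + 1) * P) (P := P)
      (by have := Nat.div_mul_le_self a P; rw [add_mul]; linarith)
    have c2 := cs_Ico (d := d) (a := b / P * P) (b := b) (P := P) (by nlinarith)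
    rw [← Finset.sum_Ico_consecutive d l1 (l2.trans l3), ← Finset.sum_Ico_consecutive d l2 l3, f0,
      ← Finset.sum_Ico_consecutive (fun y => d y ^ 2) l1 (l2.trans l3),
      ← Finset.sum_Ico_consecutive (fun y => d y ^ 2) l2 l3]
    have := mul_nonneg hPr.le (h0 ((a / P + 1) * P) (b / P * P))
    nlinarith [sq_nonneg (∑ y ∈ Finset.Ico a ((a / P + 1) * P), d y - ∑ y ∈ Finset.Ico (b / P * P) b, d y)]

/-- martingale difference -/
noncomputable def md (L : ℕ) (f : ℕ → ℝ) (j x : ℕ) : ℝ := ce L j f x - ce L (j + 1) f x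

lemma md_outside {L j : ℕ} (hj : j < L) (f : ℕ → ℝ) {x : ℕ} (hx : 2 ^ L ≤ x) : md L f j x = 0 := by
  unfold md; rw [ce_outside hj.le f hx, ce_outside hj f hx, sub_zero]

lemma md_blkC (L : ℕ) (f : ℕ → ℝ) (j : ℕ) : BlkC j (md L f j) :=
  (BlkC_ce L j f).comp2 ((BlkC_ce L (j+1) f).mono (Nat.le_succ j)) (fun a b => a - b)

lemma md_zero {L j : ℕ} (hj : j < L) (f : ℕ → ℝ) (b : ℕ) :
    ∑ y ∈ Finset.Ico (b * 2 ^ (j+1)) (b * 2 ^ (j+1) + 2 ^ (j+1)), md L f j y = 0 := by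
  have hP : 0 < 2 ^ (j+1) := by positivity
  by_cases hx : b * 2 ^ (j+1) < 2 ^ L
  · have e := blk_eq L (j+1) (b * 2 ^ (j+1)) hj hx
    rw [Nat.mul_div_cancel _ hP] at e
    have h1 : ce L (j+1) (md L f j) (b * 2 ^ (j+1)) = 0 := by
      have : ce L (j+1) (md L f j) (b * 2 ^ (j+1)) = ce L (j+1) (fun y => ce L j f y - ce L (j+1) f y) (b * 2 ^ (j+1)) := rfl
      rw [this, ce_sub, ce_tower (Nat.le_succ j) hj, ce_tower le_rfl hj, sub_self]
    unfold ce at h1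
    rw [Nat.mul_div_cancel _ hP, e] at h1
    have h2 : ((2:ℝ) ^ (j+1)) ≠ 0 := by positivity
    simpa [h2] using h1
  · refine Finset.sum_eq_zero fun y hy => md_outside hj f ?_
    rw [Finset.mem_Ico] at hy; omega

lemma md_sum {L : ℕ} (f : ℕ → ℝ) (x k : ℕ) (hk : k ≤ L) :
    ce L k f x = ce L L f x + ∑ j ∈ Finset.range L, if k ≤ j then md L f j x else 0 := by
  rw [← Finset.sum_filter]
  have e : (Finset.range L).filter (fun j => k ≤ j) = Finset.Ico k L := by
    ext j; simp [and_comm]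
  rw [e]
  unfold md
  have : ∑ j ∈ Finset.Ico k L, (ce L j f x - ce L (j + 1) f x) = ce L k f x - ce L L f x := by
    have := Finset.sum_Ico_sub (fun j => ce L j f x) hk
    rw [← neg_inj, ← Finset.sum_neg_distrib]
    simp only [neg_sub]
    exact this
  rw [this]; ring

/-- forward average -/
noncomputable def av (n : ℕ) (g : ℕ → ℝ) (x : ℕ) : ℝ :=
  (∑ t ∈ Finset.range (n + 1), g (x + t)) / (n + 1)

lemma av_Ico (n : ℕ) (g : ℕ → ℝ) (x : ℕ) :
    av n g x = (∑ y ∈ Finset.Ico x (x + n + 1), g y) / (n + 1) := by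
  unfold av
  rw [Finset.sum_Ico_eq_sum_range]
  congr 2
  congr 1
  omega

lemma av_diff {n n' : ℕ} (h : n ≤ n') (g : ℕ → ℝ) (x : ℕ) :
    av n g x - av n' g x = ((n' - n : ℝ) * av n g x -
      ∑ y ∈ Finset.Ico (x + n + 1) (x + n' + 1), g y) / (n' + 1) := by
  have h1 := av_Ico n g x
  have h2 := av_Ico n' g x
  rw [← Finset.sum_Ico_consecutive g (by omega : x ≤ x + n + 1) (by omega : x + n + 1 ≤ x + n' + 1)] at h2
  have p1 : (n:ℝ) + 1 ≠ 0 := by positivity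
  have p2 : (n':ℝ) + 1 ≠ 0 := by positivity
  rw [h2, h1]
  field_simp
  ring

lemma av_md {L n : ℕ} (f : ℕ → ℝ) {x : ℕ} (hx : x + n < 2 ^ L) :
    av n f x = ce L L f x + ∑ j ∈ Finset.range L, av n (md L f j) x := by
  unfold av
  have p1 : (n:ℝ) + 1 ≠ 0 := by positivity
  rw [← Finset.sum_div, Finset.sum_comm, eq_comm]
  rw [eq_div_iff p1, add_mul, div_mul_cancel₀ _ p1]
  have h0 : ce L L f x * ((n:ℝ) + 1) = ∑ t ∈ Finset.range (n+1), ce L L f (x + t) := by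
    rw [Finset.sum_congr rfl (g := fun _ => ce L L f x)]
    · simp; ring
    · intro t ht
      rw [Finset.mem_range] at ht
      apply BlkC_ce
      rw [Nat.div_eq_of_lt (by omega), Nat.div_eq_of_lt (by omega)]
  rw [h0, ← Finset.sum_add_distrib]
  refine Finset.sum_congr rfl fun t ht => ?_
  rw [Finset.mem_range] at ht
  have := md_sum (L := L) f (x + t) 0 (Nat.zero_le _)
  rw [ce_zero f (by omega)] at this
  simpa using this.symm

/-- disjoint increments -/
lemma incr {n : ℕ → ℕ} (hn : StrictMono n) (M R x : ℕ) {g : ℕ → ℝ} (hg : ∀ y, 0 ≤ g y) :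
    ∑ i ∈ Finset.range M with n (i+1) < R, ∑ y ∈ Finset.Ico (x + n i + 1) (x + n (i+1) + 1), g y ≤
      ∑ y ∈ Finset.Ico x (x + R), g y := by
  rw [← Finset.sum_biUnion]
  · refine Finset.sum_le_sum_of_subset_of_nonneg ?_ fun y _ _ => hg y
    intro y hy
    simp only [Finset.mem_biUnion, Finset.mem_filter, Finset.mem_range, Finset.mem_Ico] at hy ⊢
    obtain ⟨i, hi, hy⟩ := hy
    omega
  · intro i _ i' _ hii
    rw [Function.onFun, Finset.disjoint_left]
    intro y hy hy'
    rw [Finset.mem_Ico] at hy hy'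
    rcases lt_or_gt_of_ne hii with h | h
    · have : n (i+1) ≤ n i' := hn.monotone h
      omega
    · have : n (i'+1) ≤ n i := hn.monotone h
      omega

end QME

namespace QME

/-- indices of short jumps at scale κ -/
def shortI (n : ℕ → ℕ) (M κ : ℕ) : Finset ℕ :=
  (Finset.range M).filter (fun i => 2 ^ κ ≤ 2 * n i ∧ n (i+1) < 2 ^ κ)

lemma shortI_incr {n : ℕ → ℕ} (hn : StrictMono n) (M κ x : ℕ) {g : ℕ → ℝ} (hg : ∀ y, 0 ≤ g y) :
    ∑ i ∈ shortI n M κ, ∑ y ∈ Finset.Ico (x + n i + 1) (x + n (i+1) + 1), g y ≤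
      ∑ y ∈ Finset.Ico x (x + 2 ^ κ), g y := by
  refine le_trans ?_ (incr hn M (2 ^ κ) x hg)
  refine Finset.sum_le_sum_of_subset_of_nonneg ?_ fun i _ _ => Finset.sum_nonneg fun y _ => hg y
  intro i hi
  simp only [shortI, Finset.mem_filter] at hi ⊢
  tauto

lemma short_delta {n : ℕ → ℕ} (hn : StrictMono n) (M κ : ℕ) :
    ∑ i ∈ shortI n M κ, ((n (i+1) : ℝ) - n i) ^ 2 ≤ 4 ^ κ := by
  have h1 := shortI_incr hn M κ 0 (g := fun _ => 1) (fun _ => zero_le_one)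
  have h2 : ∀ i ∈ shortI n M κ, ((n (i+1) : ℝ) - n i) ^ 2 ≤
      2 ^ κ * ∑ y ∈ Finset.Ico (0 + n i + 1) (0 + n (i+1) + 1), (1:ℝ) := by
    intro i hi
    simp only [shortI, Finset.mem_filter] at hi
    have hlt := hn (Nat.lt_succ_self i)
    have e : ∑ y ∈ Finset.Ico (0 + n i + 1) (0 + n (i+1) + 1), (1:ℝ) = (n (i+1) : ℝ) - n i := by
      rw [Finset.sum_const, Nat.card_Ico, nsmul_eq_mul, mul_one,
        show 0 + n (i+1) + 1 - (0 + n i + 1) = n (i+1) - n i by omega, Nat.cast_sub hlt.le]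
    rw [e, sq]
    have a1 : (n i : ℝ) ≤ n (i+1) := by exact_mod_cast hlt.le
    have a2 : (n (i+1) : ℝ) ≤ 2 ^ κ := by exact_mod_cast hi.2.2.le
    have a3 : (0:ℝ) ≤ n i := by positivity
    gcongr <;> linarith
  refine (Finset.sum_le_sum h2).trans ?_
  rw [← Finset.mul_sum]
  have h3 : ∑ y ∈ Finset.Ico 0 (0 + 2 ^ κ), (1:ℝ) = 2 ^ κ := by simp
  rw [h3] at h1
  calc _ ≤ (2:ℝ) ^ κ * 2 ^ κ := by gcongr
    _ = 4 ^ κ := by rw [← mul_pow]; norm_num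

lemma short_gen {n : ℕ → ℕ} (hn : StrictMono n) (M κ x : ℕ) {d : ℕ → ℝ} {a b : ℝ} (ha0 : 0 ≤ a)
    (ha : ∀ m, 2 ^ κ ≤ 2 * m → m < 2 ^ κ → av m d x ^ 2 ≤ a)
    (hb : ∑ i ∈ shortI n M κ, (∑ y ∈ Finset.Ico (x + n i + 1) (x + n (i+1) + 1), d y) ^ 2 ≤ b) :
    ∑ i ∈ shortI n M κ, (av (n i) d x - av (n (i+1)) d x) ^ 2 ≤ 8 * (a + b / 4 ^ κ) := by
  have h4 : (0:ℝ) < 4 ^ κ := by positivity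
  have key : ∀ i ∈ shortI n M κ, (av (n i) d x - av (n (i+1)) d x) ^ 2 ≤
      8 / 4 ^ κ * (((n (i+1) : ℝ) - n i) ^ 2 * a +
        (∑ y ∈ Finset.Ico (x + n i + 1) (x + n (i+1) + 1), d y) ^ 2) := by
    intro i hi
    simp only [shortI, Finset.mem_filter] at hi
    have hlt := hn (Nat.lt_succ_self i)
    rw [av_diff hlt.le, div_pow, div_le_iff₀ (by positivity)]
    set s := ∑ y ∈ Finset.Ico (x + n i + 1) (x + n (i+1) + 1), d y
    have h1 := ha (n i) hi.2.1 (hlt.trans hi.2.2)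
    have h2 : (4:ℝ) ^ κ ≤ 4 * ((n (i+1) : ℝ) + 1) ^ 2 := by
      have : (2:ℝ) ^ κ ≤ 2 * ((n (i+1) : ℝ) + 1) := by
        have : (2:ℝ) ^ κ ≤ 2 * n i := by exact_mod_cast hi.2.1
        have h5 : (n i : ℝ) ≤ n (i+1) := by exact_mod_cast hlt.le
        linarith
      calc (4:ℝ) ^ κ = (2 ^ κ) ^ 2 := by rw [← pow_mul, mul_comm, pow_mul]; norm_num
        _ ≤ (2 * ((n (i+1) : ℝ) + 1)) ^ 2 := by gcongr
        _ = _ := by ring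
    set D : ℝ := (n (i+1) : ℝ) - n i
    have h3 : (D * av (n i) d x - s) ^ 2 ≤ 2 * (D ^ 2 * a + s ^ 2) := by
      have : D ^ 2 * av (n i) d x ^ 2 ≤ D ^ 2 * a := by gcongr
      nlinarith [sq_nonneg (D * av (n i) d x + s)]
    have h6 : 0 ≤ D ^ 2 * a + s ^ 2 := by positivity
    calc _ ≤ 2 * (D ^ 2 * a + s ^ 2) := h3
      _ = (8 / 4 ^ κ * (D ^ 2 * a + s ^ 2)) * (4 ^ κ / 4) := by field_simp; ring
      _ ≤ _ := by gcongr; linarith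
  refine (Finset.sum_le_sum key).trans ?_
  rw [← Finset.mul_sum, Finset.sum_add_distrib, ← Finset.sum_mul]
  have h5 := mul_le_mul_of_nonneg_right (short_delta hn M κ) ha0
  calc _ ≤ 8 / 4 ^ κ * (4 ^ κ * a + b) := by gcongr
    _ = _ := by field_simp

lemma fine_av {P κ m x : ℕ} (hP : 0 < P) {d : ℕ → ℝ}
    (hz : ∀ b, ∑ y ∈ Finset.Ico (b * P) (b * P + P), d y = 0) (h1 : 2 ^ κ ≤ 2 * m) (h2 : m < 2 ^ κ) :
    av m d x ^ 2 ≤ 8 * P / 4 ^ κ * ∑ y ∈ Finset.Ico x (x + 2 ^ κ), d y ^ 2 := by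
  have h4 : (0:ℝ) < 4 ^ κ := by positivity
  rw [av_Ico, div_pow, div_le_iff₀ (by positivity)]
  have h5 : (4:ℝ) ^ κ ≤ 4 * ((m : ℝ) + 1) ^ 2 := by
    have : (2:ℝ) ^ κ ≤ 2 * ((m : ℝ) + 1) := by
      have : (2:ℝ) ^ κ ≤ 2 * m := by exact_mod_cast h1
      linarith
    calc (4:ℝ) ^ κ = (2 ^ κ) ^ 2 := by rw [← pow_mul, mul_comm, pow_mul]; norm_num
      _ ≤ (2 * ((m : ℝ) + 1)) ^ 2 := by gcongr
      _ = _ := by ring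
  have h6 := zsum_sq hP hz (a := x) (b := x + m + 1) (by omega)
  have h7 : ∑ y ∈ Finset.Ico x (x + m + 1), d y ^ 2 ≤ ∑ y ∈ Finset.Ico x (x + 2 ^ κ), d y ^ 2 :=
    Finset.sum_le_sum_of_subset_of_nonneg (Finset.Ico_subset_Ico le_rfl (by omega))
      fun _ _ _ => sq_nonneg _
  set G := ∑ y ∈ Finset.Ico x (x + 2 ^ κ), d y ^ 2
  have G0 : 0 ≤ G := Finset.sum_nonneg fun _ _ => sq_nonneg _
  calc _ ≤ 2 * P * G := h6.trans (by gcongr)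
    _ = 8 * P / 4 ^ κ * G * (4 ^ κ / 4) := by field_simp; ring
    _ ≤ _ := by gcongr; linarith

lemma fine_short {n : ℕ → ℕ} (hn : StrictMono n) {M P κ x : ℕ} (hP : 0 < P) {d : ℕ → ℝ}
    (hz : ∀ b, ∑ y ∈ Finset.Ico (b * P) (b * P + P), d y = 0) :
    ∑ i ∈ shortI n M κ, (av (n i) d x - av (n (i+1)) d x) ^ 2 ≤
      80 * P / 4 ^ κ * ∑ y ∈ Finset.Ico x (x + 2 ^ κ), d y ^ 2 := by
  set G := ∑ y ∈ Finset.Ico x (x + 2 ^ κ), d y ^ 2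
  have G0 : 0 ≤ G := Finset.sum_nonneg fun _ _ => sq_nonneg _
  have h := short_gen hn M κ x (d := d) (a := 8 * P / 4 ^ κ * G) (b := 2 * P * G) (by positivity)
    (fun m h1 h2 => fine_av hP hz h1 h2) ?_
  · refine h.trans (le_of_eq ?_); field_simp; ring
  · refine le_trans (Finset.sum_le_sum fun i _ => zsum_sq hP hz
      (by have := hn (Nat.lt_succ_self i); simp only [Nat.succ_eq_add_one] at this; omega)) ?_
    rw [← Finset.mul_sum]
    gcongr
    exact shortI_incr hn M κ x (fun y => sq_nonneg (d y))

lemma av_abs_le {κ m x : ℕ} {d : ℕ → ℝ} {c : ℝ} (hd : ∀ t < 2 ^ κ, |d (x + t)| ≤ c) (h2 : m < 2 ^ κ) :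
    |av m d x| ≤ c := by
  unfold av
  have hp : (0:ℝ) < (m:ℝ) + 1 := by positivity
  rw [abs_div, abs_of_pos hp, div_le_iff₀ hp]
  refine (Finset.abs_sum_le_sum_abs _ _).trans ?_
  refine (Finset.sum_le_sum (g := fun _ => c) fun t ht => hd t ?_).trans ?_
  · rw [Finset.mem_range] at ht; omega
  · simp; linarith

lemma coarse_short {n : ℕ → ℕ} (hn : StrictMono n) {M κ x : ℕ} {d : ℕ → ℝ} {c : ℝ} (hc : 0 ≤ c)
    (hd : ∀ t < 2 ^ κ, |d (x + t)| ≤ c) :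
    ∑ i ∈ shortI n M κ, (av (n i) d x - av (n (i+1)) d x) ^ 2 ≤ 16 * c ^ 2 := by
  have h := short_gen hn M κ x (d := d) (a := c ^ 2) (b := 4 ^ κ * c ^ 2) (by positivity)
    (fun m h1 h2 => sq_le_sq' (abs_le.1 (av_abs_le hd h2)).1 (abs_le.1 (av_abs_le hd h2)).2) ?_
  · refine h.trans (le_of_eq ?_); field_simp; ring
  · refine le_trans (Finset.sum_le_sum (g := fun i => ((n (i+1) : ℝ) - n i) ^ 2 * c ^ 2) fun i hi => ?_) ?_
    · simp only [shortI, Finset.mem_filter] at hi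
      have hlt := hn (Nat.lt_succ_self i)
      rw [← mul_pow, ← sq_abs]
      refine pow_le_pow_left₀ (abs_nonneg _) ?_ 2
      refine (Finset.abs_sum_le_sum_abs _ _).trans ?_
      refine (Finset.sum_le_sum (g := fun _ => c) fun y hy => ?_).trans ?_
      · rw [Finset.mem_Ico] at hy
        obtain ⟨t, rfl⟩ := Nat.exists_eq_add_of_le (by omega : x ≤ y)
        exact hd t (by omega)
      · rw [Finset.sum_const, Nat.card_Ico, nsmul_eq_mul,
          show x + n (i+1) + 1 - (x + n i + 1) = n (i+1) - n i by omega, Nat.cast_sub hlt.le]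
    · rw [← Finset.sum_mul]
      gcongr
      exact short_delta hn M κ

def Rel (κ j x y : ℕ) : Prop :=
  (j < κ ∧ x ≤ y ∧ y < x + 2 ^ κ) ∨ (κ ≤ j ∧ x / 2 ^ j ≠ (x + 2 ^ κ) / 2 ^ j ∧
    (y / 2 ^ j = x / 2 ^ j ∨ y / 2 ^ j = (x + 2 ^ κ) / 2 ^ j))

instance (κ j x y : ℕ) : Decidable (Rel κ j x y) := by unfold Rel; infer_instance

noncomputable def alf (κ j : ℕ) : ℝ := if j < κ then 2 ^ j / 4 ^ κ else 1 / 2 ^ j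

/-- the majorant -/
noncomputable def GG (L : ℕ) (f : ℕ → ℝ) (κ j x : ℕ) : ℝ :=
  alf κ j * ∑ y ∈ Finset.range (2 ^ L) with Rel κ j x y, md L f j y ^ 2

lemma GG_fine {L : ℕ} (f : ℕ → ℝ) {κ j x : ℕ} (hx : x + 2 ^ κ < 2 ^ L) (hj : j < κ) :
    GG L f κ j x = 2 ^ j / 4 ^ κ * ∑ y ∈ Finset.Ico x (x + 2 ^ κ), md L f j y ^ 2 := by
  unfold GG alf
  rw [if_pos hj]
  congr 2
  ext y
  rw [Finset.mem_filter, Finset.mem_range, Finset.mem_Ico]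
  unfold Rel
  constructor
  · rintro ⟨h, h1 | h1⟩ <;> omega
  · intro h; exact ⟨by omega, Or.inl ⟨hj, h⟩⟩

lemma GG_coarse {L : ℕ} (f : ℕ → ℝ) {κ j x : ℕ} (hx : x + 2 ^ κ < 2 ^ L) (hj : κ ≤ j) (hjL : j ≤ L)
    (hB : x / 2 ^ j ≠ (x + 2 ^ κ) / 2 ^ j) :
    GG L f κ j x = md L f j x ^ 2 + md L f j (x + 2 ^ κ) ^ 2 := by
  unfold GG alf
  rw [if_neg (by omega)]
  have e : (Finset.range (2 ^ L)).filter (fun y => Rel κ j x y) =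
      (Finset.range (2 ^ L)).filter (fun y => y / 2 ^ j = x / 2 ^ j) ∪
      (Finset.range (2 ^ L)).filter (fun y => y / 2 ^ j = (x + 2 ^ κ) / 2 ^ j) := by
    ext y
    simp only [Finset.mem_filter, Finset.mem_union, Finset.mem_range]
    unfold Rel
    constructor
    · rintro ⟨h, h1 | h1⟩
      · omega
      · tauto
    · rintro (h | h)
      · exact ⟨h.1, Or.inr ⟨hj, hB, Or.inl h.2⟩⟩
      · exact ⟨h.1, Or.inr ⟨hj, hB, Or.inr h.2⟩⟩
  have cst : ∀ z < 2 ^ L, ∑ y ∈ Finset.range (2 ^ L) with y / 2 ^ j = z / 2 ^ j, md L f j y ^ 2 =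
      2 ^ j * md L f j z ^ 2 := by
    intro z hz
    rw [Finset.sum_congr rfl (g := fun _ => md L f j z ^ 2)]
    · rw [Finset.sum_const, blk_card L j z hjL hz]; simp
    · intro y hy
      rw [md_blkC L f j _ _ (Finset.mem_filter.1 hy).2]
  rw [e, Finset.sum_union, cst _ (lt_of_le_of_lt (Nat.le_add_right _ _) hx), cst _ hx]
  · field_simp
  · rw [Finset.disjoint_left]
    intro y h1 h2
    simp only [Finset.mem_filter] at h1 h2
    exact hB (h1.2.symm.trans h2.2)

lemma GG_nonneg {L : ℕ} (f : ℕ → ℝ) (κ j x : ℕ) : 0 ≤ GG L f κ j x := by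
  unfold GG
  refine mul_nonneg ?_ (Finset.sum_nonneg fun _ _ => sq_nonneg _)
  unfold alf; split_ifs <;> positivity

lemma coarse_vals {κ j x t : ℕ} (hj : κ ≤ j) (ht : t < 2 ^ κ) :
    (x + t) / 2 ^ j = x / 2 ^ j ∨ (x + t) / 2 ^ j = (x + 2 ^ κ) / 2 ^ j := by
  have h1 : x / 2 ^ j ≤ (x + t) / 2 ^ j := Nat.div_le_div_right (by omega)
  have h2 : (x + t) / 2 ^ j ≤ (x + 2 ^ κ) / 2 ^ j := Nat.div_le_div_right (by omega)
  have h3 : (x + 2 ^ κ) / 2 ^ j ≤ (x + 2 ^ j) / 2 ^ j := Nat.div_le_div_right (by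
    have : 2 ^ κ ≤ 2 ^ j := Nat.pow_le_pow_right (by norm_num) hj
    omega)
  rw [Nat.add_div_right _ (by positivity)] at h3
  omega

lemma av_const {L : ℕ} (f : ℕ → ℝ) {κ j x m : ℕ} (hj : κ ≤ j)
    (hB : x / 2 ^ j = (x + 2 ^ κ) / 2 ^ j) (hm : m < 2 ^ κ) : av m (md L f j) x = md L f j x := by
  unfold av
  have p1 : (m:ℝ) + 1 ≠ 0 := by positivity
  rw [div_eq_iff p1, Finset.sum_congr rfl (g := fun _ => md L f j x)]
  · simp; ring
  · intro t ht
    rw [Finset.mem_range] at ht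
    apply md_blkC
    rcases coarse_vals (x := x) (t := t) hj (by omega) with h | h
    · exact h
    · rw [h, hB]

lemma coarse_bd {L : ℕ} (f : ℕ → ℝ) {κ j x : ℕ} (hj : κ ≤ j) :
    ∀ t < 2 ^ κ, |md L f j (x + t)| ≤ |md L f j x| + |md L f j (x + 2 ^ κ)| := by
  intro t ht
  rcases coarse_vals (x := x) (t := t) hj ht with h | h
  · rw [md_blkC L f j _ _ h]; linarith [abs_nonneg (md L f j (x + 2 ^ κ))]
  · rw [md_blkC L f j _ _ h]; linarith [abs_nonneg (md L f j x)]

lemma pt_long {L : ℕ} (f : ℕ → ℝ) {κ j x m : ℕ} (hx : x + 2 ^ κ < 2 ^ L) (hjL : j < L)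
    (h1 : 2 ^ κ ≤ 2 * m) (h2 : m < 2 ^ κ) :
    (av m (md L f j) x - if κ ≤ j then md L f j x else 0) ^ 2 ≤ 160 * GG L f κ j x := by
  rcases lt_or_ge j κ with hj | hj
  · rw [if_neg (by omega), sub_zero, GG_fine f hx hj]
    refine (fine_av (by positivity) (md_zero hjL f) h1 h2).trans ?_
    have G0 : 0 ≤ ∑ y ∈ Finset.Ico x (x + 2 ^ κ), md L f j y ^ 2 := Finset.sum_nonneg fun _ _ => sq_nonneg _
    rw [← mul_assoc]
    gcongr ?_ * _
    push_cast
    rw [pow_succ, ← mul_div_assoc]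
    gcongr ?_ / _
    have : (0:ℝ) < 2 ^ j := by positivity
    linarith
  · rw [if_pos hj]
    by_cases hB : x / 2 ^ j = (x + 2 ^ κ) / 2 ^ j
    · rw [av_const f hj hB h2, sub_self]
      have := GG_nonneg (L := L) f κ j x
      nlinarith
    · rw [GG_coarse f hx hj hjL.le hB]
      have := av_abs_le (coarse_bd (L := L) (x := x) f hj) h2
      have h3 : |av m (md L f j) x - md L f j x| ≤ 2 * (|md L f j x| + |md L f j (x + 2 ^ κ)|) := by
        refine (abs_sub _ _).trans ?_
        linarith [abs_nonneg (md L f j (x + 2 ^ κ)), abs_nonneg (md L f j x)]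
      rw [← sq_abs]
      have h4 := pow_le_pow_left₀ (abs_nonneg _) h3 2
      nlinarith [sq_abs (md L f j x), sq_abs (md L f j (x + 2 ^ κ)),
        sq_nonneg (|md L f j x| - |md L f j (x + 2 ^ κ)|), sq_nonneg (md L f j x), sq_nonneg (md L f j (x + 2 ^ κ))]

lemma pt_short {L : ℕ} (f : ℕ → ℝ) {n : ℕ → ℕ} (hn : StrictMono n) {M κ j x : ℕ}
    (hx : x + 2 ^ κ < 2 ^ L) (hjL : j < L) :
    ∑ i ∈ shortI n M κ, (av (n i) (md L f j) x - av (n (i+1)) (md L f j) x) ^ 2 ≤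
      160 * GG L f κ j x := by
  rcases lt_or_ge j κ with hj | hj
  · rw [GG_fine f hx hj]
    refine (fine_short hn (by positivity) (md_zero hjL f)).trans (le_of_eq ?_)
    push_cast
    rw [pow_succ]; ring
  · by_cases hB : x / 2 ^ j = (x + 2 ^ κ) / 2 ^ j
    · rw [Finset.sum_eq_zero]
      · have := GG_nonneg (L := L) f κ j x
        linarith
      · intro i hi
        simp only [shortI, Finset.mem_filter] at hi
        have hlt := hn (Nat.lt_succ_self i)
        rw [av_const f hj hB (hlt.trans hi.2.2), av_const f hj hB hi.2.2, sub_self]; norm_num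
    · rw [GG_coarse f hx hj hjL.le hB]
      refine (coarse_short hn (by positivity) (coarse_bd (L := L) (x := x) f hj)).trans ?_
      nlinarith [sq_abs (md L f j x), sq_abs (md L f j (x + 2 ^ κ)),
        sq_nonneg (|md L f j x| - |md L f j (x + 2 ^ κ)|), sq_nonneg (md L f j x), sq_nonneg (md L f j (x + 2 ^ κ))]

end QME

namespace QME

def dst (j κ : ℕ) : ℕ := (j - κ) + (κ - j)

lemma dst_comm (j κ : ℕ) : dst j κ = dst κ j := by unfold dst; omega

/-- weight condition -/
def WU (L : ℕ) (w : ℕ → ℝ) (C τ : ℝ) : Prop :=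
  ∀ κ j y (S : Finset ℕ), j ≤ L → y < 2 ^ L → S ⊆ Finset.range (2 ^ L) → S.card ≤ 2 * 2 ^ κ →
    (∀ x ∈ S, x < y + 2 * 2 ^ (max j κ) ∧ y < x + 2 * 2 ^ (max j κ)) →
    ∑ x ∈ S, w x ≤ C * 2 ^ κ * τ ^ dst j κ * ce L j w y

lemma alf_eq (κ j : ℕ) : alf κ j * 2 ^ κ = (1 / 2) ^ dst j κ := by
  unfold alf dst
  split_ifs with h
  · obtain ⟨m, rfl⟩ := Nat.exists_eq_add_of_lt h
    have e1 : j - (j + m + 1) + (j + m + 1 - j) = m + 1 := by omega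
    have e2 : (4:ℝ) ^ (j + m + 1) = 2 ^ (j + m + 1) * 2 ^ (j + m + 1) := by rw [← mul_pow]; norm_num
    rw [e1, e2, div_mul_eq_mul_div, mul_div_mul_right _ _ (by positivity), div_pow, one_pow,
      div_eq_div_iff (by positivity) (by positivity)]
    ring
  · obtain ⟨m, rfl⟩ := Nat.exists_eq_add_of_le (not_lt.1 h)
    have e1 : κ + m - κ + (κ - (κ + m)) = m := by omega
    rw [e1, div_pow, one_pow, pow_add]
    field_simp

lemma rel_card {J κ j y : ℕ} :
    ((Finset.range J).filter (fun x => Rel κ j x y)).card ≤ 2 * 2 ^ κ := by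
  rcases lt_or_ge j κ with h | h
  · have : (Finset.range J).filter (fun x => Rel κ j x y) ⊆ Finset.Ico (y + 1 - 2 ^ κ) (y + 1) := by
      intro x hx
      rw [Finset.mem_filter] at hx
      rw [Finset.mem_Ico]
      rcases hx.2 with h1 | h1 <;> omega
    refine (Finset.card_le_card this).trans ?_
    rw [Nat.card_Ico]; omega
  · set P := 2 ^ j with hP
    set s := 2 ^ κ with hs
    have hP0 : 0 < P := by positivity
    have hsP : s ≤ P := Nat.pow_le_pow_right (by norm_num) h
    set q := y / P with hq
    have : (Finset.range J).filter (fun x => Rel κ j x y) ⊆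
        Finset.Ico (q * P - s) (q * P) ∪ Finset.Ico ((q * P + P) - s) (q * P + P) := by
      intro x hx
      rw [Finset.mem_filter] at hx
      rw [Finset.mem_union, Finset.mem_Ico, Finset.mem_Ico]
      rcases hx.2 with h1 | ⟨_, h1, h2⟩
      · omega
      · rw [← hP, ← hs] at h1 h2
        have a1 := Nat.div_add_mod x P
        have a2 := Nat.mod_lt x hP0
        have b1 := Nat.div_add_mod (x + s) P
        have b2 := Nat.mod_lt (x + s) hP0
        have c1 : x / P ≤ (x + s) / P := Nat.div_le_div_right (Nat.le_add_right x s)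
        have c2 : x / P + 1 ≤ (x + s) / P := lt_of_le_of_ne c1 h1
        have c3 : P * (x / P + 1) ≤ P * ((x + s) / P) := Nat.mul_le_mul_left P c2
        rw [mul_comm q P]
        rcases h2 with h2 | h2
        · right
          rw [← hq] at h2
          rw [← h2] at a1 c3
          rw [mul_add, mul_one] at c3
          omega
        · left
          rw [← hq] at h2
          rw [← h2] at b1 c3
          rw [mul_add, mul_one] at c3
          omega
    refine (Finset.card_le_card this).trans ((Finset.card_union_le _ _).trans ?_)
    rw [Nat.card_Ico, Nat.card_Ico]; omega

lemma rel_dist {κ j x y : ℕ} (h : Rel κ j x y) :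
    x < y + 2 * 2 ^ (max j κ) ∧ y < x + 2 * 2 ^ (max j κ) := by
  rcases h with ⟨h, h1, h2⟩ | ⟨h, h1, h2⟩
  · rw [max_eq_right h.le]
    have : 0 < 2 ^ κ := by positivity
    omega
  · rw [max_eq_left h]
    have hP0 : 0 < 2 ^ j := by positivity
    have hsP : 2 ^ κ ≤ 2 ^ j := Nat.pow_le_pow_right (by norm_num) h
    generalize 2 ^ j = P at *
    generalize 2 ^ κ = s at *
    have a1 := Nat.div_add_mod x P
    have a2 := Nat.mod_lt x hP0
    have b1 := Nat.div_add_mod (x + s) P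
    have b2 := Nat.mod_lt (x + s) hP0
    have c1 := Nat.div_add_mod y P
    have c2 := Nat.mod_lt y hP0
    rcases h2 with h2 | h2
    · rw [h2] at c1; omega
    · rw [h2] at c1; omega

lemma w_GG {L : ℕ} {w : ℕ → ℝ} {C τ : ℝ} (hU : WU L w C τ) (f : ℕ → ℝ)
    {J κ j : ℕ} (hJ : J ≤ 2 ^ L) (hj : j < L) :
    ∑ x ∈ Finset.range J, w x * GG L f κ j x ≤
      C * (τ / 2) ^ dst j κ * ∑ x ∈ Finset.range (2 ^ L), md L f j x ^ 2 * w x := by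
  have e1 : ∑ x ∈ Finset.range J, w x * GG L f κ j x = alf κ j * ∑ y ∈ Finset.range (2 ^ L),
      md L f j y ^ 2 * ∑ x ∈ Finset.range J with Rel κ j x y, w x := by
    unfold GG
    simp only [Finset.sum_filter, Finset.mul_sum]
    rw [Finset.sum_comm]
    refine Finset.sum_congr rfl fun y _ => Finset.sum_congr rfl fun x _ => ?_
    split_ifs <;> ring
  have ha : 0 ≤ alf κ j := by unfold alf; split_ifs <;> positivity
  rw [e1]
  calc _ ≤ alf κ j * ∑ y ∈ Finset.range (2 ^ L), md L f j y ^ 2 * (C * 2 ^ κ * τ ^ dst j κ * ce L j w y) := by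
        gcongr with y hy
        refine hU κ j y _ hj.le (Finset.mem_range.1 hy) ?_ rel_card ?_
        · exact (Finset.filter_subset _ _).trans (Finset.range_subset_range.2 hJ)
        · intro x hx; exact rel_dist (Finset.mem_filter.1 hx).2
    _ = (alf κ j * 2 ^ κ) * C * τ ^ dst j κ * ∑ y ∈ Finset.range (2 ^ L), md L f j y ^ 2 * ce L j w y := by
        rw [Finset.mul_sum, Finset.mul_sum]
        refine Finset.sum_congr rfl fun y _ => by ring
    _ = _ := by
        rw [sum_mul_ce hj.le ((md_blkC L f j).comp (fun t => t ^ 2)) w, alf_eq]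
        congr 1
        rw [div_pow, div_pow, one_pow]; ring

lemma geo1 {ρ : ℝ} (h0 : 0 < ρ) (h1 : ρ < 1) (n : ℕ) : ∑ i ∈ Finset.range n, ρ ^ i ≤ 1 / (1 - ρ) := by
  rw [le_div_iff₀ (by linarith), geom_sum_mul_neg]
  have : 0 < ρ ^ n := by positivity
  linarith

lemma geo {ρ : ℝ} (h0 : 0 < ρ) (h1 : ρ < 1) (L κ : ℕ) :
    ∑ j ∈ Finset.range L, ρ ^ dst j κ ≤ 2 / (1 - ρ) := by
  have e : ∑ j ∈ Finset.range L, ρ ^ dst j κ ≤ ∑ j ∈ Finset.range (κ + L), ρ ^ dst j κ :=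
    Finset.sum_le_sum_of_subset_of_nonneg (Finset.range_subset_range.2 (by omega))
      fun _ _ _ => by positivity
  refine e.trans ?_
  rw [Finset.sum_range_add]
  have a1 : ∑ j ∈ Finset.range κ, ρ ^ dst j κ ≤ ∑ j ∈ Finset.range κ, ρ ^ j := by
    rw [← Finset.sum_range_reflect]
    refine Finset.sum_le_sum fun j hj => ?_
    rw [Finset.mem_range] at hj
    refine pow_le_pow_of_le_one h0.le h1.le ?_
    unfold dst; omega
  have a2 : ∑ j ∈ Finset.range L, ρ ^ dst (κ + j) κ = ∑ j ∈ Finset.range L, ρ ^ j := by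
    refine Finset.sum_congr rfl fun j _ => ?_
    congr 1; unfold dst; omega
  rw [a2]
  have := geo1 h0 h1 κ
  have := geo1 h0 h1 L
  have e2 : 2 / (1 - ρ) = 1 / (1 - ρ) + 1 / (1 - ρ) := by ring
  linarith

lemma cs_geo {ρ : ℝ} (h0 : 0 < ρ) (h1 : ρ < 1) (L κ : ℕ) (a : ℕ → ℝ) :
    (∑ j ∈ Finset.range L, a j) ^ 2 ≤ 2 / (1 - ρ) * ∑ j ∈ Finset.range L, (ρ ^ dst j κ)⁻¹ * a j ^ 2 := by
  have h := Finset.sum_sq_le_sum_mul_sum_of_sq_le_mul (Finset.range L) (r := a)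
    (f := fun j => ρ ^ dst j κ) (g := fun j => (ρ ^ dst j κ)⁻¹ * a j ^ 2)
    (fun j _ => by positivity) (fun j _ => by positivity) (fun j _ => by field_simp; exact le_rfl)
  refine h.trans ?_
  refine mul_le_mul_of_nonneg_right (geo h0 h1 L κ) (Finset.sum_nonneg fun j _ => by positivity)

lemma scale_bd {L : ℕ} {w : ℕ → ℝ} (hw : ∀ x, 0 ≤ w x) {C ρ : ℝ}
    (h0 : 0 < ρ) (h1 : ρ < 1) (hU : WU L w C (2 * ρ ^ 2)) (f : ℕ → ℝ)
    {J κ : ℕ} (hJ : J ≤ 2 ^ L) (I : Finset ℕ) (l : ℕ → ℕ → ℕ → ℝ)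
    (hl : ∀ x < J, ∀ j < L, ∑ i ∈ I, l i j x ^ 2 ≤ 160 * GG L f κ j x) :
    ∑ x ∈ Finset.range J, w x * ∑ i ∈ I, (∑ j ∈ Finset.range L, l i j x) ^ 2 ≤
      320 * C / (1 - ρ) * ∑ j ∈ Finset.range L, ρ ^ dst j κ *
        ∑ x ∈ Finset.range (2 ^ L), md L f j x ^ 2 * w x := by
  have hρ : 0 < 1 - ρ := by linarith
  calc _ ≤ ∑ x ∈ Finset.range J, w x * (2 / (1 - ρ) * ∑ j ∈ Finset.range L, (ρ ^ dst j κ)⁻¹ * (160 * GG L f κ j x)) := by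
        refine Finset.sum_le_sum fun x hx => mul_le_mul_of_nonneg_left ?_ (hw x)
        calc _ ≤ ∑ i ∈ I, 2 / (1 - ρ) * ∑ j ∈ Finset.range L, (ρ ^ dst j κ)⁻¹ * l i j x ^ 2 :=
              Finset.sum_le_sum fun i _ => cs_geo h0 h1 L κ _
          _ = 2 / (1 - ρ) * ∑ j ∈ Finset.range L, (ρ ^ dst j κ)⁻¹ * ∑ i ∈ I, l i j x ^ 2 := by
              rw [← Finset.mul_sum, Finset.sum_comm]
              simp only [Finset.mul_sum]
          _ ≤ _ := by
              gcongr with j hj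
              exact hl x (Finset.mem_range.1 hx) j (Finset.mem_range.1 hj)
    _ = 320 / (1 - ρ) * ∑ j ∈ Finset.range L, (ρ ^ dst j κ)⁻¹ * ∑ x ∈ Finset.range J, w x * GG L f κ j x := by
        simp only [Finset.mul_sum]
        rw [Finset.sum_comm]
        refine Finset.sum_congr rfl fun j _ => Finset.sum_congr rfl fun x _ => ?_
        ring
    _ ≤ 320 / (1 - ρ) * ∑ j ∈ Finset.range L, (ρ ^ dst j κ)⁻¹ * (C * (2 * ρ ^ 2 / 2) ^ dst j κ *
        ∑ x ∈ Finset.range (2 ^ L), md L f j x ^ 2 * w x) := by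
        gcongr with j hj
        exact w_GG hU f hJ (Finset.mem_range.1 hj)
    _ = _ := by
        simp only [Finset.mul_sum]
        refine Finset.sum_congr rfl fun j _ => Finset.sum_congr rfl fun x _ => ?_
        have e : (2 * ρ ^ 2 / 2) ^ dst j κ = ρ ^ dst j κ * ρ ^ dst j κ := by
          rw [← mul_pow]; congr 1; ring
        rw [e]
        field_simp

end QME

namespace QME

lemma size_lo {n : ℕ} (h : 0 < n) : 2 ^ Nat.size n ≤ 2 * n := by
  have h1 : 0 < Nat.size n := Nat.size_pos.2 h
  obtain ⟨m, hm⟩ := Nat.exists_eq_succ_of_ne_zero h1.ne'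
  have : 2 ^ m ≤ n := Nat.lt_size.1 (by omega)
  rw [hm, pow_succ]; omega

def longA (n : ℕ → ℕ) (M κ : ℕ) : Finset ℕ :=
  (Finset.range M).filter (fun i => Nat.size (n i) = κ ∧ κ < Nat.size (n (i+1)))
def longB (n : ℕ → ℕ) (M κ : ℕ) : Finset ℕ :=
  (Finset.range M).filter (fun i => Nat.size (n (i+1)) = κ ∧ Nat.size (n i) < κ)

lemma size_mono {n : ℕ → ℕ} (hn : StrictMono n) {a b : ℕ} (h : a ≤ b) : Nat.size (n a) ≤ Nat.size (n b) :=
  Nat.size_le_size (hn.monotone h)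

lemma longA_card {n : ℕ → ℕ} (hn : StrictMono n) (M κ : ℕ) : (longA n M κ).card ≤ 1 := by
  rw [Finset.card_le_one]
  intro a ha b hb
  simp only [longA, Finset.mem_filter] at ha hb
  by_contra hne
  rcases lt_or_gt_of_ne hne with h | h
  · have := size_mono hn (show a + 1 ≤ b from h); omega
  · have := size_mono hn (show b + 1 ≤ a from h); omega

lemma longB_card {n : ℕ → ℕ} (hn : StrictMono n) (M κ : ℕ) : (longB n M κ).card ≤ 1 := by
  rw [Finset.card_le_one]
  intro a ha b hb
  simp only [longB, Finset.mem_filter] at ha hb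
  by_contra hne
  rcases lt_or_gt_of_ne hne with h | h
  · have := size_mono hn (show a + 1 ≤ b from h); omega
  · have := size_mono hn (show b + 1 ≤ a from h); omega

lemma sum_card_le_one {I : Finset ℕ} (hI : I.card ≤ 1) {g : ℕ → ℝ} {B : ℝ} (hB : 0 ≤ B)
    (h : ∀ i ∈ I, g i ≤ B) : ∑ i ∈ I, g i ≤ B := by
  refine (Finset.sum_le_card_nsmul I g B h).trans ?_
  rw [nsmul_eq_mul]
  have : (I.card : ℝ) ≤ 1 := by exact_mod_cast hI
  nlinarith

lemma pt_total {n : ℕ → ℕ} (hn : StrictMono n) (hpos : ∀ i, 0 < n i) (M : ℕ) (a e : ℕ → ℝ) :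
    ∑ i ∈ Finset.range M, (a (n i) - a (n (i+1))) ^ 2 ≤
      ∑ κ ∈ Finset.range (Nat.size (n M) + 1), ∑ i ∈ shortI n M κ, (a (n i) - a (n (i+1))) ^ 2 +
      3 * ∑ κ ∈ Finset.range (Nat.size (n M) + 1), ∑ i ∈ longA n M κ, (a (n i) - e κ) ^ 2 +
      3 * ∑ κ ∈ Finset.range (Nat.size (n M) + 1), ∑ i ∈ longB n M κ, (a (n (i+1)) - e κ) ^ 2 +
      3 * ∑ i ∈ Finset.range M, (e (Nat.size (n i)) - e (Nat.size (n (i+1)))) ^ 2 := by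
  unfold shortI longA longB
  simp only [Finset.sum_filter]
  rw [Finset.sum_comm]
  rw [Finset.sum_comm (t := Finset.range M), Finset.sum_comm (t := Finset.range M)]
  rw [Finset.mul_sum, Finset.mul_sum, Finset.mul_sum, ← Finset.sum_add_distrib, ← Finset.sum_add_distrib, ← Finset.sum_add_distrib]
  refine Finset.sum_le_sum fun i hi => ?_
  rw [Finset.mem_range] at hi
  set K := Nat.size (n M) + 1
  have k1 : Nat.size (n i) ∈ Finset.range K := by
    rw [Finset.mem_range]; have := size_mono hn hi.le; omega
  have k2 : Nat.size (n (i+1)) ∈ Finset.range K := by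
    rw [Finset.mem_range]; have := size_mono hn (show i + 1 ≤ M from hi); omega
  have n1 : ∀ κ ∈ Finset.range K, 0 ≤ if 2 ^ κ ≤ 2 * n i ∧ n (i + 1) < 2 ^ κ then (a (n i) - a (n (i + 1))) ^ 2 else 0 :=
    fun κ _ => by split_ifs <;> positivity
  have n2 : ∀ κ ∈ Finset.range K, 0 ≤ if (n i).size = κ ∧ κ < (n (i + 1)).size then (a (n i) - e κ) ^ 2 else 0 :=
    fun κ _ => by split_ifs <;> positivity
  have n3 : ∀ κ ∈ Finset.range K, 0 ≤ if (n (i + 1)).size = κ ∧ (n i).size < κ then (a (n (i + 1)) - e κ) ^ 2 else 0 :=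
    fun κ _ => by split_ifs <;> positivity
  have s1 := Finset.sum_nonneg n1
  have s2 := Finset.sum_nonneg n2
  have s3 := Finset.sum_nonneg n3
  have s4 : 0 ≤ (e (Nat.size (n i)) - e (Nat.size (n (i+1)))) ^ 2 := sq_nonneg _
  rcases (size_mono hn (Nat.le_succ i)).eq_or_lt with h | h
  · have := Finset.single_le_sum n1 k1
    rw [if_pos ⟨size_lo (hpos i), by rw [h]; exact Nat.lt_size_self _⟩] at this
    linarith
  · have t1 := Finset.single_le_sum n2 k1
    rw [if_pos ⟨rfl, h⟩] at t1
    have t2 := Finset.single_le_sum n3 k2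
    rw [if_pos ⟨rfl, h⟩] at t2
    set p := a (n i)
    set q := a (n (i+1))
    set E1 := e (n i).size
    set E2 := e (n (i+1)).size
    have : (p - q) ^ 2 ≤ 3 * (p - E1) ^ 2 + 3 * (q - E2) ^ 2 + 3 * (E1 - E2) ^ 2 := by
      nlinarith [sq_nonneg ((p - E1) - (E1 - E2)), sq_nonneg ((p - E1) + (q - E2)), sq_nonneg ((E1 - E2) + (q - E2))]
    linarith

theorem main_weighted {L : ℕ} {w : ℕ → ℝ} (hw : ∀ x, 0 ≤ w x) {C ρ : ℝ} (hC : 0 ≤ C)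
    (h0 : 0 < ρ) (h1 : ρ < 1) (hU : WU L w C (2 * ρ ^ 2)) (f : ℕ → ℝ)
    {n : ℕ → ℕ} (hn : StrictMono n) (hpos : ∀ i, 0 < n i) {J M : ℕ}
    (hJ : J + 2 ^ Nat.size (n M) ≤ 2 ^ L) {R : ℝ}
    (hR : ∀ σ : ℕ → ℕ, Antitone σ → (∀ i, σ i ≤ L) → ∀ m,
      ∑ i ∈ Finset.range m, ∑ x ∈ Finset.range (2 ^ L),
        (ce L (σ (i + 1)) f x - ce L (σ i) f x) ^ 2 * w x ≤ R) :
    ∑ x ∈ Finset.range J, w x * ∑ i ∈ Finset.range M, (av (n i) f x - av (n (i+1)) f x) ^ 2 ≤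
      (7 * (320 * C / (1 - ρ)) * (2 / (1 - ρ)) + 3) * R := by
  have hρ : 0 < 1 - ρ := by linarith
  set K := Nat.size (n M) with hK
  have hJ' : J ≤ 2 ^ L := (Nat.le_add_right _ _).trans hJ
  have hKL : K ≤ L := by
    have : 2 ^ K ≤ 2 ^ L := (Nat.le_add_left _ _).trans hJ
    exact (Nat.pow_le_pow_iff_right (by norm_num)).1 this
  have hx : ∀ x < J, ∀ κ < K + 1, x + 2 ^ κ < 2 ^ L := fun x hx κ hκ => by
    have : 2 ^ κ ≤ 2 ^ K := Nat.pow_le_pow_right (by norm_num) (by omega)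
    omega
  set Md : ℕ → ℝ := fun j => ∑ x ∈ Finset.range (2 ^ L), md L f j x ^ 2 * w x with hMd
  have Md0 : ∀ j, 0 ≤ Md j := fun j => Finset.sum_nonneg fun x _ => mul_nonneg (sq_nonneg _) (hw x)
  have hMdR : ∑ j ∈ Finset.range L, Md j ≤ R := by
    have := hR (fun i => L - i) (anti_sub L) (fun i => Nat.sub_le _ _) L
    rw [← Finset.sum_range_reflect] at this
    refine le_trans (le_of_eq ?_) this
    refine Finset.sum_congr rfl fun j hj => ?_
    rw [Finset.mem_range] at hj
    simp only [hMd, md]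
    rw [show L - (L - 1 - j + 1) = j by omega, show L - (L - 1 - j) = j + 1 by omega]
  set c := 320 * C / (1 - ρ) with hc
  have c0 : 0 ≤ c := by positivity
  set Dk : ℕ → ℝ := fun κ => ∑ j ∈ Finset.range L, ρ ^ dst j κ * Md j with hDk
  have hD : ∑ κ ∈ Finset.range (K + 1), Dk κ ≤ 2 / (1 - ρ) * R := by
    simp only [hDk]
    rw [Finset.sum_comm]
    calc _ = ∑ j ∈ Finset.range L, (∑ κ ∈ Finset.range (K+1), ρ ^ dst κ j) * Md j := by
          refine Finset.sum_congr rfl fun j _ => ?_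
          rw [Finset.sum_mul]
          refine Finset.sum_congr rfl fun κ _ => by rw [dst_comm]
      _ ≤ ∑ j ∈ Finset.range L, 2 / (1 - ρ) * Md j := by
          refine Finset.sum_le_sum fun j _ => mul_le_mul_of_nonneg_right (geo h0 h1 _ _) (Md0 j)
      _ ≤ _ := by rw [← Finset.mul_sum]; gcongr
  have avf : ∀ x < J, ∀ m < 2 ^ K, av m f x = ce L L f x + ∑ j ∈ Finset.range L, av m (md L f j) x :=
    fun x hx m hm => av_md f (by omega)
  have T1 : ∀ κ < K + 1, ∑ x ∈ Finset.range J, w x * ∑ i ∈ shortI n M κ, (av (n i) f x - av (n (i+1)) f x) ^ 2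
      ≤ c * Dk κ := by
    intro κ hκ
    have := scale_bd hw h0 h1 hU f (κ := κ) hJ' (shortI n M κ)
      (fun i j x => av (n i) (md L f j) x - av (n (i+1)) (md L f j) x)
      (fun x hxJ j hj => pt_short f hn (hx x hxJ κ hκ) hj)
    refine le_trans (le_of_eq ?_) this
    refine Finset.sum_congr rfl fun x hxJ => ?_
    congr 1
    refine Finset.sum_congr rfl fun i hi => ?_
    simp only [shortI, Finset.mem_filter] at hi
    have hlt : n i < n (i+1) := hn (Nat.lt_succ_self i)
    have : 2 ^ κ ≤ 2 ^ K := Nat.pow_le_pow_right (by norm_num) (by omega)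
    rw [Finset.mem_range] at hxJ
    rw [avf x hxJ (n i) (by omega), avf x hxJ (n (i+1)) (by omega), Finset.sum_sub_distrib]
    congr 1; ring
  have gen : ∀ κ < K + 1, ∀ (I : Finset ℕ) (m : ℕ → ℕ), I.card ≤ 1 →
      (∀ i ∈ I, Nat.size (m i) = κ ∧ 0 < m i) →
      ∑ x ∈ Finset.range J, w x * ∑ i ∈ I, (av (m i) f x - ce L κ f x) ^ 2 ≤ c * Dk κ := by
    intro κ hκ I m hI hm
    have := scale_bd hw h0 h1 hU f (κ := κ) hJ' I
      (fun i j x => av (m i) (md L f j) x - if κ ≤ j then md L f j x else 0)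
      (fun x hxJ j hj => sum_card_le_one hI (by have := GG_nonneg (L := L) f κ j x; positivity)
        (fun i hi => pt_long f (hx x hxJ κ hκ) hj
          (by obtain ⟨h, h'⟩ := hm i hi; rw [← h]; exact size_lo h')
          (by obtain ⟨h, h'⟩ := hm i hi; rw [← h]; exact Nat.lt_size_self _)))
    refine le_trans (le_of_eq ?_) this
    refine Finset.sum_congr rfl fun x hxJ => ?_
    congr 1
    refine Finset.sum_congr rfl fun i hi => ?_
    rw [Finset.mem_range] at hxJ
    have hlt : m i < 2 ^ K := by
      refine lt_of_lt_of_le (Nat.lt_size_self _) (Nat.pow_le_pow_right (by norm_num) ?_)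
      rw [(hm i hi).1]; omega
    rw [avf x hxJ _ hlt, md_sum f x κ (by omega), Finset.sum_sub_distrib]
    congr 1; ring
  have T2 : ∀ κ < K + 1, ∑ x ∈ Finset.range J, w x * ∑ i ∈ longA n M κ, (av (n i) f x - ce L κ f x) ^ 2
      ≤ c * Dk κ := fun κ hκ => gen κ hκ _ n (longA_card hn M κ) fun i hi => by
    simp only [longA, Finset.mem_filter] at hi
    exact ⟨hi.2.1, hpos i⟩
  have T3 : ∀ κ < K + 1, ∑ x ∈ Finset.range J, w x * ∑ i ∈ longB n M κ, (av (n (i+1)) f x - ce L κ f x) ^ 2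
      ≤ c * Dk κ := fun κ hκ => gen κ hκ _ (fun i => n (i+1)) (longB_card hn M κ) fun i hi => by
    simp only [longB, Finset.mem_filter] at hi
    exact ⟨hi.2.1, hpos _⟩
  have T4 : ∑ x ∈ Finset.range J, w x * ∑ i ∈ Finset.range M,
      (ce L (Nat.size (n i)) f x - ce L (Nat.size (n (i+1))) f x) ^ 2 ≤ R := by
    have h := hR (fun i => Nat.size (n (M - i))) (fun a b hab => size_mono hn (by omega))
      (fun i => (size_mono hn (Nat.sub_le _ _)).trans hKL) M
    rw [← Finset.sum_range_reflect] at h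
    refine le_trans ?_ h
    rw [Finset.sum_comm]
    calc _ ≤ ∑ x ∈ Finset.range (2 ^ L), w x * ∑ i ∈ Finset.range M,
          (ce L (Nat.size (n i)) f x - ce L (Nat.size (n (i+1))) f x) ^ 2 :=
        Finset.sum_le_sum_of_subset_of_nonneg (Finset.range_subset_range.2 hJ') fun x _ _ =>
          mul_nonneg (hw x) (Finset.sum_nonneg fun _ _ => sq_nonneg _)
      _ = _ := by
        refine Finset.sum_congr rfl fun x _ => ?_
        rw [Finset.mul_sum]
        refine Finset.sum_congr rfl fun i hi => ?_
        rw [Finset.mem_range] at hi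
        rw [show M - (M - 1 - i + 1) = i by omega, show M - (M - 1 - i) = i + 1 by omega]
        ring
  have comb : ∀ G : ℕ → ℕ → ℝ, (∀ κ < K + 1, ∑ x ∈ Finset.range J, w x * G κ x ≤ c * Dk κ) →
      ∑ x ∈ Finset.range J, w x * ∑ κ ∈ Finset.range (K+1), G κ x ≤ c * (2 / (1 - ρ) * R) := by
    intro G hG
    simp only [Finset.mul_sum]
    rw [Finset.sum_comm]
    refine (Finset.sum_le_sum fun κ hκ => hG κ (Finset.mem_range.1 hκ)).trans ?_
    rw [← Finset.mul_sum]
    gcongr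
  have c1 := comb _ T1
  have c2 := comb _ T2
  have c3 := comb _ T3
  have tot : ∑ x ∈ Finset.range J, w x * ∑ i ∈ Finset.range M, (av (n i) f x - av (n (i+1)) f x) ^ 2 ≤
      ∑ x ∈ Finset.range J, w x * (∑ κ ∈ Finset.range (K + 1), ∑ i ∈ shortI n M κ, (av (n i) f x - av (n (i+1)) f x) ^ 2 +
      3 * ∑ κ ∈ Finset.range (K + 1), ∑ i ∈ longA n M κ, (av (n i) f x - ce L κ f x) ^ 2 +
      3 * ∑ κ ∈ Finset.range (K + 1), ∑ i ∈ longB n M κ, (av (n (i+1)) f x - ce L κ f x) ^ 2 +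
      3 * ∑ i ∈ Finset.range M, (ce L (Nat.size (n i)) f x - ce L (Nat.size (n (i+1))) f x) ^ 2) :=
    Finset.sum_le_sum fun x _ => mul_le_mul_of_nonneg_left
      (pt_total hn hpos M (fun m => av m f x) (fun κ => ce L κ f x)) (hw x)
  refine tot.trans ?_
  have split : ∀ a b c' d : ℕ → ℝ, ∑ x ∈ Finset.range J, w x * (a x + 3 * b x + 3 * c' x + 3 * d x) =
      ∑ x ∈ Finset.range J, w x * a x + 3 * ∑ x ∈ Finset.range J, w x * b x +
      3 * ∑ x ∈ Finset.range J, w x * c' x + 3 * ∑ x ∈ Finset.range J, w x * d x := by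
    intro a b c' d
    rw [Finset.mul_sum, Finset.mul_sum, Finset.mul_sum, ← Finset.sum_add_distrib,
      ← Finset.sum_add_distrib, ← Finset.sum_add_distrib]
    refine Finset.sum_congr rfl fun x _ => by ring
  rw [split]
  have e : (7 * c * (2 / (1 - ρ)) + 3) * R = 7 * (c * (2 / (1 - ρ) * R)) + 3 * R := by ring
  rw [e]
  linarith

end QME

namespace QME

lemma near_sum {L k : ℕ} {u : ℕ → ℝ} (hu : ∀ x, 0 ≤ u x) {B : ℝ}
    (hA : ∀ k, ∀ z < 2 ^ L, cm L k u z ≤ B * u z) {z : ℕ} (hz : z < 2 ^ L) {S : Finset ℕ}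
    (hS : S ⊆ Finset.range (2 ^ L)) (h : ∀ x ∈ S, x < z + 2 ^ k ∧ z < x + 2 ^ k) :
    ∑ x ∈ S, u x ≤ 2 ^ k * (B * u z) := by
  have h1 := hA k z hz
  unfold cm at h1
  rw [div_le_iff₀ (by positivity)] at h1
  refine le_trans ?_ (h1.trans (by rw [mul_comm]))
  refine Finset.sum_le_sum_of_subset_of_nonneg ?_ (fun x _ _ => hu x)
  intro x hx
  exact Finset.mem_filter.2 ⟨hS hx, h x hx⟩

lemma blk_near {k b y : ℕ} (h : b / 2 ^ k = y / 2 ^ k) : b < y + 2 ^ k ∧ y < b + 2 ^ k := by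
  have h2 : 0 < 2 ^ k := by positivity
  have e1 := Nat.div_add_mod b (2 ^ k)
  have e2 := Nat.div_add_mod y (2 ^ k)
  have l1 := Nat.mod_lt b h2
  have l2 := Nat.mod_lt y h2
  rw [h] at e1
  generalize 2 ^ k * (y / 2 ^ k) = q at *
  generalize b % 2 ^ k = r at *
  generalize y % 2 ^ k = s at *
  generalize 2 ^ k = P at *
  omega

lemma holder_card (S : Finset ℕ) {v : ℕ → ℝ} (hv : ∀ x, 0 ≤ v x) {θ : ℝ} (h0 : 0 < θ) (h1 : θ < 1)
    {N : ℝ} (hN : (S.card : ℝ) ≤ N) :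
    ∑ x ∈ S, v x ^ θ ≤ N ^ (1 - θ) * (∑ x ∈ S, v x) ^ θ := by
  have h := Real.rpow_sum_le_const_mul_sum_rpow_of_nonneg (s := S) (f := fun x => v x ^ θ)
    (p := 1 / θ) (by rw [le_div_iff₀ h0]; linarith) (fun i _ => Real.rpow_nonneg (hv i) _)
  have e : ∀ x, (v x ^ θ) ^ (1 / θ) = v x := fun x => by
    rw [← Real.rpow_mul (hv x), mul_one_div_cancel h0.ne', Real.rpow_one]
  simp only [e] at h
  have hs0 : 0 ≤ ∑ x ∈ S, v x ^ θ := Finset.sum_nonneg fun i _ => Real.rpow_nonneg (hv i) _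
  have hv0 : 0 ≤ ∑ x ∈ S, v x := Finset.sum_nonneg fun i _ => hv i
  have h' := Real.rpow_le_rpow (by positivity) h h0.le
  rw [← Real.rpow_mul hs0, one_div_mul_cancel h0.ne', Real.rpow_one,
    Real.mul_rpow (by positivity) hv0, ← Real.rpow_mul (by positivity),
    show (1 / θ - 1) * θ = 1 - θ by field_simp] at h'
  refine h'.trans ?_
  gcongr

lemma neg_tangent {δ t : ℝ} (hδ : 0 ≤ δ) (ht : 0 < t) : 1 - δ * (t - 1) ≤ t ^ (-δ) := by
  rw [Real.rpow_def_of_pos ht]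
  have h1 := Real.add_one_le_exp (Real.log t * -δ)
  have h2 := Real.log_le_sub_one_of_pos ht
  nlinarith

lemma jensen_neg {L k : ℕ} (hk : k ≤ L) {u : ℕ → ℝ} (hu : ∀ x < 2 ^ L, 0 < u x) {δ : ℝ} (hδ : 0 ≤ δ)
    {y : ℕ} (hy : y < 2 ^ L) : 0 < ce L k u y ∧ (ce L k u y) ^ (-δ) ≤ ce L k (fun x => u x ^ (-δ)) y := by
  have hc : 0 < ce L k u y := by
    unfold ce
    refine div_pos (Finset.sum_pos (fun b hb => hu b ?_) ⟨y, ?_⟩) (by positivity)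
    · exact Finset.mem_range.1 (Finset.mem_filter.1 hb).1
    · exact Finset.mem_filter.2 ⟨Finset.mem_range.2 hy, rfl⟩
  refine ⟨hc, ?_⟩
  set c := ce L k u y with hcd
  have hcs : (∑ b ∈ Finset.range (2 ^ L) with b / 2 ^ k = y / 2 ^ k, u b) = c * 2 ^ k := by
    rw [hcd, ce, div_mul_cancel₀ _ (by positivity)]
  have key : ∀ b ∈ (Finset.range (2 ^ L)).filter (fun b => b / 2 ^ k = y / 2 ^ k),
      c ^ (-δ) * (1 - δ * (u b / c - 1)) ≤ u b ^ (-δ) := by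
    intro b hb
    have hb0 := hu b (Finset.mem_range.1 (Finset.mem_filter.1 hb).1)
    have h := neg_tangent hδ (div_pos hb0 hc)
    calc _ ≤ c ^ (-δ) * (u b / c) ^ (-δ) := by gcongr
      _ = u b ^ (-δ) := by
        rw [← Real.mul_rpow hc.le (by positivity), mul_div_cancel₀ _ hc.ne']
  have h := Finset.sum_le_sum key
  rw [← Finset.mul_sum, Finset.sum_sub_distrib, ← Finset.mul_sum, Finset.sum_sub_distrib,
    ← Finset.sum_div, hcs] at h
  simp only [Finset.sum_const, blk_card L k y hk hy, nsmul_eq_mul] at h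
  unfold ce
  rw [le_div_iff₀ (by positivity)]
  refine le_trans (le_of_eq ?_) h
  push_cast
  field_simp
  ring

lemma WU_low {L : ℕ} {u : ℕ → ℝ} (hu0 : ∀ x, 0 ≤ u x) (hu : ∀ x < 2 ^ L, 0 < u x) {B : ℝ} (hB : 1 ≤ B)
    (hA : ∀ k, ∀ z < 2 ^ L, cm L k u z ≤ B * u z) {δ : ℝ} (hδ : 0 ≤ δ) :
    WU L (fun x => u x ^ (-δ)) (2 * (4 * B) ^ δ) (2 ^ δ) := by
  intro κ j y S hj hy hS hcard hnear
  obtain ⟨hc, hjen⟩ := jensen_neg hj hu hδ hy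
  set c := ce L j u y with hcd
  set E := ce L j (fun x => u x ^ (-δ)) y with hE
  set m := max j κ with hm
  have hjm : j ≤ m := le_max_left _ _
  obtain ⟨d, hd⟩ := Nat.exists_eq_add_of_le hjm
  have hdd : d ≤ dst j κ := by unfold dst; omega
  have hz : ∀ z ∈ S, u z ^ (-δ) ≤ (4 * B) ^ δ * (2 ^ δ) ^ dst j κ * E := by
    intro z hz
    have hzL := Finset.mem_range.1 (hS hz)
    have h1 := near_sum hu0 hA (k := m + 2) hzL
      (S := (Finset.range (2 ^ L)).filter (fun b => b / 2 ^ j = y / 2 ^ j))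
      (Finset.filter_subset _ _) (fun b hb => by
        have hb1 := blk_near (Finset.mem_filter.1 hb).2
        have hz1 := hnear z hz
        have hp : 2 ^ j ≤ 2 ^ m := Nat.pow_le_pow_right (by norm_num) hjm
        rw [pow_add]
        generalize 2 ^ j = P at *
        generalize 2 ^ m = Q at *
        omega)
    have hcs : (∑ b ∈ Finset.range (2 ^ L) with b / 2 ^ j = y / 2 ^ j, u b) = c * 2 ^ j := by
      rw [hcd, ce, div_mul_cancel₀ _ (by positivity)]
    rw [hcs, hd, show j + d + 2 = j + (d + 2) by ring, pow_add] at h1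
    have h2 : c ≤ (4 * B * 2 ^ d) * u z := by
      have hp : (0:ℝ) < 2 ^ j := by positivity
      have : c * 2 ^ j ≤ ((4 * B * 2 ^ d) * u z) * 2 ^ j := h1.trans (le_of_eq (by ring))
      exact le_of_mul_le_mul_right this hp
    have hK : 0 < 4 * B * 2 ^ d := by positivity
    have h3 : u z ^ (-δ) ≤ (c / (4 * B * 2 ^ d)) ^ (-δ) :=
      Real.rpow_le_rpow_of_nonpos (by positivity) (by rw [div_le_iff₀ hK]; linarith) (by linarith)
    refine h3.trans ?_
    rw [Real.div_rpow hc.le hK.le, Real.rpow_neg hK.le, div_inv_eq_mul,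
      Real.mul_rpow (by positivity) (by positivity)]
    have e : ((2:ℝ) ^ d) ^ δ = (2 ^ δ) ^ d := by
      rw [← Real.rpow_natCast, ← Real.rpow_natCast, ← Real.rpow_mul (by norm_num),
        ← Real.rpow_mul (by norm_num), mul_comm]
    rw [e]
    have h4 : ((2:ℝ) ^ δ) ^ d ≤ (2 ^ δ) ^ dst j κ :=
      pow_le_pow_right₀ (Real.one_le_rpow (by norm_num) hδ) hdd
    have hE0 : 0 ≤ E := le_trans (by positivity) hjen
    calc _ ≤ E * ((4 * B) ^ δ * (2 ^ δ) ^ dst j κ) := by gcongr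
      _ = _ := by ring
  have hE0 : 0 ≤ E := le_trans (by positivity) hjen
  calc ∑ x ∈ S, u x ^ (-δ) ≤ ∑ x ∈ S, (4 * B) ^ δ * (2 ^ δ) ^ dst j κ * E := Finset.sum_le_sum hz
    _ = S.card * ((4 * B) ^ δ * (2 ^ δ) ^ dst j κ * E) := by simp
    _ ≤ (2 * 2 ^ κ) * ((4 * B) ^ δ * (2 ^ δ) ^ dst j κ * E) := by
        gcongr
        exact_mod_cast hcard
    _ = _ := by ring

lemma ce_A1 {L : ℕ} {v : ℕ → ℝ} (hv : ∀ x, 0 ≤ v x) {B : ℝ} (hB : 1 ≤ B)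
    (hA : ∀ k, ∀ z < 2 ^ L, cm L k v z ≤ B * v z) {θ : ℝ} (h0 : 0 < θ) (h1 : θ < 1)
    {k : ℕ} (hk : k ≤ L) (x : ℕ) :
    ce L k (fun x => v x ^ θ) x ≤ B ^ θ * v x ^ θ := by
  rcases lt_or_ge x (2 ^ L) with hx | hx
  · have hs := near_sum hv hA (k := k) hx (S := (Finset.range (2 ^ L)).filter (fun b => b / 2 ^ k = x / 2 ^ k))
      (Finset.filter_subset _ _) (fun b hb => blk_near (Finset.mem_filter.1 hb).2)
    have hh := holder_card ((Finset.range (2 ^ L)).filter (fun b => b / 2 ^ k = x / 2 ^ k)) hv h0 h1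
      (N := 2 ^ k) (by rw [blk_card L k x hk hx]; push_cast; exact le_rfl)
    unfold ce
    rw [div_le_iff₀ (by positivity)]
    refine hh.trans ?_
    have hx0 := hv x
    have hsum0 : 0 ≤ ∑ b ∈ Finset.range (2 ^ L) with b / 2 ^ k = x / 2 ^ k, v b := Finset.sum_nonneg fun i _ => hv i
    calc _ ≤ ((2:ℝ) ^ k) ^ (1 - θ) * (2 ^ k * (B * v x)) ^ θ := by gcongr
      _ = ((2:ℝ) ^ k) ^ (1 - θ) * (2 ^ k) ^ θ * (B ^ θ * v x ^ θ) := by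
        rw [Real.mul_rpow (by positivity) (by positivity), Real.mul_rpow (by positivity) hx0]; ring
      _ = _ := by rw [← Real.rpow_add (by positivity)]; norm_num; ring
  · rw [ce_outside hk _ hx]
    have := hv x
    positivity

lemma WU_high {L : ℕ} {v : ℕ → ℝ} (hv : ∀ x, 0 ≤ v x) {B : ℝ} (hB : 1 ≤ B)
    (hA : ∀ k, ∀ z < 2 ^ L, cm L k v z ≤ B * v z) {θ : ℝ} (h0 : 0 < θ) (h1 : θ < 1) :
    WU L (fun x => v x ^ θ) (2 * (4 * B) ^ θ) (2 ^ θ) := by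
  intro κ j y S hj hy hS hcard hnear
  set m := max j κ with hm
  have hjm : j ≤ m := le_max_left _ _
  have hκm : κ ≤ m := le_max_right _ _
  obtain ⟨d, hd⟩ := Nat.exists_eq_add_of_le hκm
  have hdd : d ≤ dst j κ := by unfold dst; omega
  set c := 2 * (4 * B) ^ θ * 2 ^ κ * (2 ^ θ) ^ dst j κ with hcd
  have hz : ∀ x ∈ (Finset.range (2 ^ L)).filter (fun b => b / 2 ^ j = y / 2 ^ j),
      ∑ z ∈ S, v z ^ θ ≤ c * v x ^ θ := by
    intro x hx
    have hxL := Finset.mem_range.1 (Finset.mem_filter.1 hx).1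
    have hx0 := hv x
    have hs := near_sum hv hA (k := m + 2) hxL hS (fun z hz => by
        have hb1 := blk_near (Finset.mem_filter.1 hx).2
        have hz1 := hnear z hz
        have hp : 2 ^ j ≤ 2 ^ m := Nat.pow_le_pow_right (by norm_num) hjm
        rw [pow_add]
        generalize 2 ^ j = P at *
        generalize 2 ^ m = Q at *
        omega)
    have hh := holder_card S hv h0 h1 (N := 2 * 2 ^ κ) (by exact_mod_cast hcard)
    have hsum0 : 0 ≤ ∑ b ∈ S, v b := Finset.sum_nonneg fun i _ => hv i
    have e : ((2:ℝ) ^ d) ^ θ = (2 ^ θ) ^ d := by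
      rw [← Real.rpow_natCast, ← Real.rpow_natCast, ← Real.rpow_mul (by norm_num),
        ← Real.rpow_mul (by norm_num), mul_comm]
    have h4 : ((2:ℝ) ^ θ) ^ d ≤ (2 ^ θ) ^ dst j κ :=
      pow_le_pow_right₀ (Real.one_le_rpow (by norm_num) h0.le) hdd
    have h5 : (2:ℝ) ^ (1 - θ) ≤ 2 := by
      calc (2:ℝ) ^ (1 - θ) ≤ 2 ^ (1:ℝ) := Real.rpow_le_rpow_of_exponent_le (by norm_num) (by linarith)
        _ = 2 := Real.rpow_one 2
    calc _ ≤ ((2:ℝ) * 2 ^ κ) ^ (1 - θ) * (2 ^ (m + 2) * (B * v x)) ^ θ := hh.trans (by gcongr)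
      _ = ((2:ℝ) * 2 ^ κ) ^ (1 - θ) * (2 ^ κ * (2 ^ d * ((4 * B) * v x))) ^ θ := by
        rw [hd]; congr 2; ring
      _ = 2 ^ (1 - θ) * ((2 ^ κ) ^ (1 - θ) * (2 ^ κ) ^ θ) * ((2 ^ d) ^ θ * ((4 * B) ^ θ * v x ^ θ)) := by
        rw [Real.mul_rpow (by norm_num) (by positivity), Real.mul_rpow (by positivity) (by positivity),
          Real.mul_rpow (by positivity) (by positivity), Real.mul_rpow (by positivity) hx0]
        ring
      _ = 2 ^ (1 - θ) * 2 ^ κ * ((2 ^ θ) ^ d * ((4 * B) ^ θ * v x ^ θ)) := by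
        rw [← Real.rpow_add (by positivity), e]; norm_num
      _ ≤ 2 * 2 ^ κ * ((2 ^ θ) ^ dst j κ * ((4 * B) ^ θ * v x ^ θ)) := by gcongr
      _ = _ := by rw [hcd]; ring
  have h := Finset.sum_le_sum hz
  rw [← Finset.mul_sum, Finset.sum_const, blk_card L j y hj hy, nsmul_eq_mul] at h
  push_cast at h
  change ∑ z ∈ S, v z ^ θ ≤ c * _
  unfold ce
  rw [← mul_div_assoc, le_div_iff₀ (by positivity)]
  linarith
end QME

namespace QME

/-- squared square function -/
noncomputable def SQ (n : ℕ → ℕ) (M : ℕ) (f : ℕ → ℝ) (x : ℕ) : ℝ :=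
  ∑ i ∈ Finset.range M, (av (n i) f x - av (n (i+1)) f x) ^ 2

lemma SQ_nonneg (n : ℕ → ℕ) (M : ℕ) (f : ℕ → ℝ) (x : ℕ) : 0 ≤ SQ n M f x :=
  Finset.sum_nonneg fun _ _ => sq_nonneg _

lemma av_congr {n : ℕ} {f g : ℕ → ℝ} {x : ℕ} (h : ∀ y ≤ x + n, f y = g y) : av n f x = av n g x := by
  unfold av
  congr 1
  refine Finset.sum_congr rfl fun t ht => h _ ?_
  rw [Finset.mem_range] at ht; omega

lemma SQ_congr {n : ℕ → ℕ} (hn : StrictMono n) {M : ℕ} {f g : ℕ → ℝ} {x : ℕ}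
    (h : ∀ y ≤ x + n M, f y = g y) : SQ n M f x = SQ n M g x := by
  unfold SQ
  refine Finset.sum_congr rfl fun i hi => ?_
  rw [Finset.mem_range] at hi
  have h1 : n i ≤ n M := hn.monotone hi.le
  have h2 : n (i+1) ≤ n M := hn.monotone hi
  rw [av_congr (fun y hy => h y (by omega)), av_congr (n := n (i+1)) (fun y hy => h y (by omega))]

lemma rho_ex {θ : ℝ} (h1 : θ < 1) : ∃ ρ : ℝ, 0 < ρ ∧ ρ < 1 ∧ 2 * ρ ^ 2 = 2 ^ θ := by
  refine ⟨Real.sqrt (2 ^ θ / 2), Real.sqrt_pos.2 (by positivity), ?_, ?_⟩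
  · rw [Real.sqrt_lt' one_pos]
    have : (2:ℝ) ^ θ < 2 ^ (1:ℝ) := Real.rpow_lt_rpow_of_exponent_lt (by norm_num) h1
    rw [Real.rpow_one] at this
    linarith
  · rw [Real.sq_sqrt (by positivity)]; ring

lemma sq_pt {p s u : ℝ} (hp : 0 < p) (hp2 : p ≤ 2) (hs : 0 ≤ s) (hu : 0 < u) :
    s ^ (p / 2) ≤ u ^ (p - 2) * s + u ^ p := by
  have e : (u ^ 2) ^ (p / 2) = u ^ p := by
    rw [← Real.rpow_natCast, ← Real.rpow_mul hu.le]; congr 1; push_cast; ring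
  rcases le_or_gt s (u ^ 2) with h | h
  · have h1 := Real.rpow_le_rpow hs h (z := p / 2) (by positivity)
    rw [e] at h1
    have : 0 ≤ u ^ (p - 2) * s := by positivity
    linarith
  · have hs' : 0 < s := lt_trans (by positivity) h
    have h1 : s ^ (p / 2 - 1) ≤ (u ^ 2) ^ (p / 2 - 1) :=
      Real.rpow_le_rpow_of_nonpos (by positivity) h.le (by linarith)
    have e2 : (u ^ 2) ^ (p / 2 - 1) = u ^ (p - 2) := by
      rw [← Real.rpow_natCast, ← Real.rpow_mul hu.le]; congr 1; push_cast; ring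
    rw [e2] at h1
    have : s ^ (p / 2) = s ^ (p / 2 - 1) * s := by
      rw [← Real.rpow_add_one hs'.ne']; congr 1; ring
    rw [this]
    have : 0 ≤ u ^ p := by positivity
    nlinarith

theorem sq_low_thm {p : ℝ} (hp : 1 < p) (hp2 : p ≤ 2) : ∃ C : ℝ, 0 ≤ C ∧
    ∀ (L : ℕ) (f : ℕ → ℝ), (∀ x, 0 ≤ f x) → ∀ n : ℕ → ℕ, StrictMono n → (∀ i, 0 < n i) →
    ∀ M J, J + 2 ^ Nat.size (n M) ≤ 2 ^ L →
    ∑ x ∈ Finset.range J, SQ n M f x ^ (p / 2) ≤ C * ∑ x ∈ Finset.range (2 ^ L), f x ^ p := by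
  obtain ⟨B, hB, hrdf⟩ := rdf hp
  obtain ⟨ρ, h0, h1, hρ⟩ := rho_ex (θ := 2 - p) (by linarith)
  have hB0 : 0 ≤ B := by linarith
  have hp0 : 0 ≤ p - 1 := by linarith
  have hρ' : 0 < 1 - ρ := by linarith
  set D := 2 * (4 * B) ^ (2 - p) with hD
  have hD0 : 0 ≤ D := by positivity
  refine ⟨(7 * (320 * D / (1 - ρ)) * (2 / (1 - ρ)) + 3) * (2 / (p * (p - 1))) + B ^ p * B,
    by positivity, ?_⟩
  intro L f hf n hn hpos M J hJ
  have hJ' : J ≤ 2 ^ L := (Nat.le_add_right _ _).trans hJ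
  by_cases hf0 : ∃ x₀ < 2 ^ L, 0 < f x₀
  swap
  · push Not at hf0
    have hz : ∀ x < 2 ^ L, f x = 0 := fun x hx => le_antisymm (hf0 x hx) (hf x)
    have e1 : ∑ x ∈ Finset.range J, SQ n M f x ^ (p / 2) = 0 := by
      refine Finset.sum_eq_zero fun x hx => ?_
      rw [Finset.mem_range] at hx
      rw [SQ_congr hn (g := fun _ => 0) (fun y hy => hz y ?_)]
      · have : SQ n M (fun _ => 0) x = 0 := by simp [SQ, av]
        rw [this, Real.zero_rpow (by positivity)]
      · have := Nat.lt_size_self (n M); omega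
    rw [e1]
    exact mul_nonneg (by positivity) (Finset.sum_nonneg fun x _ => Real.rpow_nonneg (hf x) _)
  obtain ⟨x₀, hx₀, hfx₀⟩ := hf0
  obtain ⟨u, hu0, hfu, hus, huA⟩ := hrdf L f hf
  have hup : ∀ x < 2 ^ L, 0 < u x := by
    intro x hx
    have h := near_sum hu0 huA (k := L) hx (S := {x₀})
      (by simpa using hx₀) (by intro z hz; rw [Finset.mem_singleton] at hz; subst hz; omega)
    rw [Finset.sum_singleton] at h
    have h2 := hfu x₀ hx₀
    by_contra hc
    have : u x = 0 := le_antisymm (not_lt.1 hc) (hu0 x)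
    rw [this] at h; simp at h; linarith
  set u1 : ℕ → ℝ := fun x => B * u x with hu1
  have hu10 : ∀ x, 0 ≤ u1 x := fun x => mul_nonneg hB0 (hu0 x)
  have hu1p : ∀ x < 2 ^ L, 0 < u1 x := fun x hx => mul_pos (by linarith) (hup x hx)
  have hu1A : ∀ k, ∀ z < 2 ^ L, cm L k u1 z ≤ B * u1 z := by
    intro k z hz
    have : cm L k u1 z = B * cm L k u z := by simp only [cm, hu1, ← Finset.mul_sum, mul_div_assoc]
    rw [this]
    exact mul_le_mul_of_nonneg_left (huA k z hz) hB0
  have hWU := WU_low hu10 hu1p hB hu1A (δ := 2 - p) (by linarith)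
  rw [← hρ] at hWU
  have hR := main_weighted (L := L) (w := fun x => u1 x ^ (-(2 - p)))
    (fun x => Real.rpow_nonneg (hu10 x) _) hD0 h0 h1 hWU f hn hpos hJ
    (R := 2 / (p * (p - 1)) * ∑ x ∈ Finset.range (2 ^ L), f x ^ p) (by
      intro σ hσ hL m
      have := sq_low (L := L) (f := f) (u := u1) hσ hL hf hp hp2 hu1p (fun i x hx => by
        have hs := near_sum hu0 huA (k := σ i) hx (S := (Finset.range (2 ^ L)).filter (fun b => b / 2 ^ (σ i) = x / 2 ^ (σ i)))
          (Finset.filter_subset _ _) (fun b hb => blk_near (Finset.mem_filter.1 hb).2)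
        unfold ce
        rw [div_le_iff₀ (by positivity)]
        refine (Finset.sum_le_sum fun b hb => hfu b (Finset.mem_range.1 (Finset.mem_filter.1 hb).1)).trans ?_
        refine hs.trans (le_of_eq ?_)
        simp only [hu1]; ring) m
      simpa only [neg_sub] using this)
  simp only [neg_sub] at hR
  have hpt : ∀ x ∈ Finset.range J, SQ n M f x ^ (p / 2) ≤ u1 x ^ (p - 2) * SQ n M f x + u1 x ^ p :=
    fun x hx => sq_pt (by linarith) hp2 (SQ_nonneg _ _ _ _)
      (hu1p x (lt_of_lt_of_le (Finset.mem_range.1 hx) hJ'))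
  refine (Finset.sum_le_sum hpt).trans ?_
  rw [Finset.sum_add_distrib, add_mul]
  refine add_le_add (hR.trans (le_of_eq (by ring))) ?_
  calc ∑ x ∈ Finset.range J, u1 x ^ p ≤ ∑ x ∈ Finset.range (2 ^ L), u1 x ^ p :=
        Finset.sum_le_sum_of_subset_of_nonneg (Finset.range_subset_range.2 hJ') fun x _ _ =>
          Real.rpow_nonneg (hu10 x) _
    _ = B ^ p * ∑ x ∈ Finset.range (2 ^ L), u x ^ p := by
        rw [Finset.mul_sum]
        exact Finset.sum_congr rfl fun x _ => Real.mul_rpow hB0 (hu0 x)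
    _ ≤ B ^ p * (B * ∑ x ∈ Finset.range (2 ^ L), f x ^ p) := by gcongr
    _ = _ := by ring

theorem sq_high_thm {p : ℝ} (hp2 : 2 < p) : ∃ C : ℝ, 0 ≤ C ∧
    ∀ (L : ℕ) (f : ℕ → ℝ), (∀ x, 0 ≤ f x) → ∀ n : ℕ → ℕ, StrictMono n → (∀ i, 0 < n i) →
    ∀ M J, J + 2 ^ Nat.size (n M) ≤ 2 ^ L →
    ∑ x ∈ Finset.range J, SQ n M f x ^ (p / 2) ≤ C * ∑ x ∈ Finset.range (2 ^ L), f x ^ p := by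
  set r := p / (p - 2) with hr
  have hp20 : 0 < p - 2 := by linarith
  have hr1 : 1 < r := by rw [hr, lt_div_iff₀ hp20]; linarith
  set q := (1 + r) / 2 with hq
  have hq1 : 1 < q := by rw [hq]; linarith
  have hqr : q < r := by rw [hq]; linarith
  set θ := q / r with hθ
  have hθ0 : 0 < θ := by positivity
  have hθ1 : θ < 1 := by rw [hθ, div_lt_one (by linarith)]; exact hqr
  set s := r / q with hs
  have hs0 : 0 < s := by positivity
  have hsθ : s * θ = 1 := by rw [hs, hθ]; field_simp
  obtain ⟨B, hB, hrdf⟩ := rdf hq1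
  obtain ⟨ρ, h0, h1, hρ⟩ := rho_ex (θ := θ) hθ1
  have hB0 : 0 < B := by linarith
  have hρ' : 0 < 1 - ρ := by linarith
  set D := 2 * (4 * B) ^ θ with hD
  have hD0 : 0 ≤ D := by positivity
  set c := (7 * (320 * D / (1 - ρ)) * (2 / (1 - ρ)) + 3) * (5 * B ^ θ) with hc
  have hc0 : 0 < c := by positivity
  set P := p / 2 with hP
  have hP1 : 1 < P := by rw [hP]; linarith
  set Db := 2 * (p / (p - 1) * (2 * (p / (p - 1))) ^ (p - 1)) with hDb
  have hDb0 : 0 ≤ Db := by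
    have : 0 < p - 1 := by linarith
    have : 0 < p := by linarith
    positivity
  refine ⟨2 * (c * (2 * (c * B)) ^ (P - 1) * Db), by positivity, ?_⟩
  intro L f hf n hn hpos M J hJ
  have hJ' : J ≤ 2 ^ L := (Nat.le_add_right _ _).trans hJ
  set φ : ℕ → ℝ := fun x => if x < J then SQ n M f x ^ (P - 1) else 0 with hφ
  have hφ0 : ∀ x, 0 ≤ φ x := fun x => by
    simp only [hφ]; split_ifs; exact Real.rpow_nonneg (SQ_nonneg _ _ _ _) _; exact le_rfl
  obtain ⟨v, hv0, hfv, hvs, hvA⟩ := hrdf L (fun x => φ x ^ s) (fun x => Real.rpow_nonneg (hφ0 x) _)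
  set w : ℕ → ℝ := fun x => v x ^ θ with hw
  have hw0 : ∀ x, 0 ≤ w x := fun x => Real.rpow_nonneg (hv0 x) _
  have hφw : ∀ x < 2 ^ L, φ x ≤ w x := by
    intro x hx
    have := Real.rpow_le_rpow (Real.rpow_nonneg (hφ0 x) _) (hfv x hx) hθ0.le
    rwa [← Real.rpow_mul (hφ0 x), hsθ, Real.rpow_one] at this
  set Sg := ∑ x ∈ Finset.range J, SQ n M f x ^ P with hSg
  have hwr : ∑ x ∈ Finset.range (2 ^ L), w x ^ r ≤ B * Sg := by
    have e1 : ∀ x, w x ^ r = v x ^ q := fun x => by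
      simp only [hw]
      rw [← Real.rpow_mul (hv0 x)]; congr 1; rw [hθ]; field_simp
    have e2 : ∀ x, (φ x ^ s) ^ q = if x < J then SQ n M f x ^ P else 0 := fun x => by
      rw [← Real.rpow_mul (hφ0 x)]
      have : s * q = r := by rw [hs]; field_simp
      rw [this]
      simp only [hφ]
      split_ifs
      · rw [← Real.rpow_mul (SQ_nonneg _ _ _ _)]; congr 1; rw [hP, hr]; field_simp
      · exact Real.zero_rpow (by linarith)
    simp only [e1]
    refine hvs.trans (le_of_eq ?_)
    simp only [e2]
    rw [← Finset.sum_filter]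
    congr 2
    ext x; simp only [Finset.mem_filter, Finset.mem_range]
    omega
  set F := rmax L (fun i => L - i) f L with hF
  have hF0 : ∀ x, 0 ≤ F x := fun x => rmax_nonneg hf _ x
  have hFs := doob (anti_sub L) (fun i => Nat.sub_le L i) hf (p := p) (by linarith) L
  have hWU := WU_high hv0 hB hvA hθ0 hθ1
  rw [← hρ] at hWU
  have hR := main_weighted (L := L) (w := w) hw0 hD0 h0 h1 hWU f hn hpos hJ
    (R := 5 * ∑ x ∈ Finset.range (2 ^ L), F x ^ 2 * (B ^ θ * w x)) (by
      intro σ hσ hL m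
      refine sq_high hσ hL hw0 (fun i x => ?_) (fun i x => ce_A1 hv0 hB hvA hθ0 hθ1 (hL i) x) m
      rw [abs_of_nonneg (ce_nonneg hf x)]
      have h1 := ce_le_rmax L (fun i => L - i) f (L - σ i) x
      have h2 : L - (L - σ i) = σ i := by have := hL i; omega
      simp only [h2] at h1
      exact h1.trans (rmax_mono L _ f x (Nat.sub_le _ _)))
  have step1 : Sg ≤ c * ∑ x ∈ Finset.range (2 ^ L), F x ^ 2 * w x := by
    calc Sg ≤ ∑ x ∈ Finset.range J, w x * SQ n M f x := by
          refine Finset.sum_le_sum fun x hx => ?_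
          rw [Finset.mem_range] at hx
          have h := hφw x (by omega)
          simp only [hφ, if_pos hx] at h
          have e : SQ n M f x ^ P = SQ n M f x ^ (P - 1) * SQ n M f x := by
            rw [← Real.rpow_add_one' (SQ_nonneg _ _ _ _) (by linarith)]; congr 1; ring
          rw [e]
          exact mul_le_mul_of_nonneg_right h (SQ_nonneg _ _ _ _)
      _ ≤ _ := hR
      _ = _ := by
        have : ∑ x ∈ Finset.range (2 ^ L), F x ^ 2 * (B ^ θ * w x) = B ^ θ * ∑ x ∈ Finset.range (2 ^ L), F x ^ 2 * w x := by
          rw [Finset.mul_sum]; exact Finset.sum_congr rfl fun x _ => by ring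
        rw [this, hc]; ring
  have step2 : c * B * ∑ x ∈ Finset.range (2 ^ L), F x ^ 2 * w x ≤
      B * Sg / 2 + c * B * (2 * (c * B)) ^ (P - 1) * (Db * ∑ x ∈ Finset.range (2 ^ L), f x ^ p) := by
    have hpt : ∀ x ∈ Finset.range (2 ^ L), c * B * (F x ^ 2 * w x) ≤
        w x ^ r / 2 + c * B * (2 * (c * B)) ^ (P - 1) * F x ^ p := by
      intro x _
      have h := absorb hP1 (c := c * B) (a := F x ^ 2) (b := w x ^ (1 / (P - 1))) (by positivity)
        (sq_nonneg _) (Real.rpow_nonneg (hw0 x) _)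
      have hP10 : P - 1 ≠ 0 := by linarith
      rw [← Real.rpow_mul (hw0 x), ← Real.rpow_mul (hw0 x), one_div_mul_cancel hP10, Real.rpow_one] at h
      have e1 : 1 / (P - 1) * P = r := by
        have : p - 2 ≠ 0 := by linarith
        rw [hP, hr]; field_simp
      have e2 : (F x ^ 2) ^ P = F x ^ p := by
        rw [← Real.rpow_natCast, ← Real.rpow_mul (hF0 x)]; congr 1; rw [hP]; push_cast; ring
      rw [e1, e2] at h
      linarith
    rw [Finset.mul_sum]
    refine (Finset.sum_le_sum hpt).trans ?_
    rw [Finset.sum_add_distrib, ← Finset.sum_div, ← Finset.mul_sum]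
    gcongr
  have step3 : B * Sg ≤ B * Sg / 2 + c * B * (2 * (c * B)) ^ (P - 1) * (Db * ∑ x ∈ Finset.range (2 ^ L), f x ^ p) :=
    le_trans (by nlinarith) step2
  refine le_of_mul_le_mul_left ?_ hB0
  nlinarith

/-- final real nonnegative version -/
theorem sq_thm {p : ℝ} (hp : 1 < p) : ∃ C : ℝ, 0 ≤ C ∧
    ∀ (f : ℕ → ℝ), (∀ x, 0 ≤ f x) → ∀ n : ℕ → ℕ, StrictMono n → (∀ i, 0 < n i) →
    ∀ M J, ∑ x ∈ Finset.range J, SQ n M f x ^ (p / 2) ≤ C * ∑ x ∈ Finset.range (J + n M), f x ^ p := by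
  have : ∃ C : ℝ, 0 ≤ C ∧
    ∀ (L : ℕ) (f : ℕ → ℝ), (∀ x, 0 ≤ f x) → ∀ n : ℕ → ℕ, StrictMono n → (∀ i, 0 < n i) →
    ∀ M J, J + 2 ^ Nat.size (n M) ≤ 2 ^ L →
    ∑ x ∈ Finset.range J, SQ n M f x ^ (p / 2) ≤ C * ∑ x ∈ Finset.range (2 ^ L), f x ^ p := by
    rcases le_or_gt p 2 with h | h
    · exact sq_low_thm hp h
    · exact sq_high_thm h
  obtain ⟨C, hC, h⟩ := this
  refine ⟨C, hC, fun f hf n hn hpos M J => ?_⟩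
  set g : ℕ → ℝ := fun x => if x < J + n M then f x else 0 with hg
  have hg0 : ∀ x, 0 ≤ g x := fun x => by simp only [hg]; split_ifs; exact hf x; exact le_rfl
  have hL := Nat.lt_two_pow_self (n := J + 2 ^ Nat.size (n M))
  have h1 := h _ g hg0 n hn hpos M J hL.le
  generalize J + 2 ^ Nat.size (n M) = L at h1 hL
  have e1 : ∑ x ∈ Finset.range J, SQ n M g x ^ (p / 2) = ∑ x ∈ Finset.range J, SQ n M f x ^ (p / 2) := by
    refine Finset.sum_congr rfl fun x hx => ?_
    rw [Finset.mem_range] at hx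
    rw [SQ_congr hn (g := f) (fun y hy => ?_)]
    simp only [hg]; rw [if_pos (by omega)]
  rw [e1] at h1
  refine h1.trans ?_
  gcongr
  have e2 : ∀ x, g x ^ p = if x < J + n M then f x ^ p else 0 := fun x => by
    simp only [hg]; split_ifs; rfl; exact Real.zero_rpow (by linarith)
  simp only [e2]
  rw [← Finset.sum_filter]
  refine Finset.sum_le_sum_of_subset_of_nonneg ?_ fun x _ _ => Real.rpow_nonneg (hf x) _
  intro x hx
  exact Finset.mem_range.2 (Finset.mem_filter.1 hx).2
end QME

namespace QME

/-- prepend `c` to `s * a`. -/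
def sqc (c s : ℝ) (a : ℕ → ℝ) : ℕ → ℝ
  | 0 => c
  | k + 1 => s * a k

/-- path expectation -/
def An {ι : Type*} [Fintype ι] (P m : ι → ι → ℝ) (f : ι → ℝ) : ℕ → ((ℕ → ℝ) → ℝ) → ι → ℝ
  | 0, H, x => H (sqc (f x) 0 0)
  | n + 1, H, x => ∑ y, P x y * An P m f n (fun a => H (sqc (f x) (m x y) a)) y

section
variable {ι : Type*} [Fintype ι] {P m : ι → ι → ℝ} {f : ι → ℝ}

lemma sqc_nonneg {c s : ℝ} {a : ℕ → ℝ} (hc : 0 ≤ c) (hs : 0 ≤ s) (ha : ∀ k, 0 ≤ a k) (k : ℕ) :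
    0 ≤ sqc c s a k := by
  cases k with
  | zero => exact hc
  | succ k => exact mul_nonneg hs (ha k)

lemma An_mono (hP : ∀ x y, 0 ≤ P x y) (hm : ∀ x y, 0 ≤ m x y) (hf : ∀ x, 0 ≤ f x) (n : ℕ)
    {H H' : (ℕ → ℝ) → ℝ} (h : ∀ a : ℕ → ℝ, (∀ k, 0 ≤ a k) → H a ≤ H' a) (x : ι) :
    An P m f n H x ≤ An P m f n H' x := by
  induction n generalizing H H' x with
  | zero => exact h _ (sqc_nonneg (hf x) le_rfl (fun _ => le_rfl))
  | succ n ih =>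
    simp only [An]
    refine Finset.sum_le_sum fun y _ => mul_le_mul_of_nonneg_left (ih (fun a ha => ?_) y) (hP x y)
    exact h _ (sqc_nonneg (hf x) (hm x y) ha)

lemma An_congr (hP : ∀ x y, 0 ≤ P x y) (hm : ∀ x y, 0 ≤ m x y) (hf : ∀ x, 0 ≤ f x) (n : ℕ)
    {H H' : (ℕ → ℝ) → ℝ} (h : ∀ a : ℕ → ℝ, (∀ k, 0 ≤ a k) → H a = H' a) (x : ι) :
    An P m f n H x = An P m f n H' x :=
  le_antisymm (An_mono hP hm hf n (fun a ha => (h a ha).le) x)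
    (An_mono hP hm hf n (fun a ha => (h a ha).ge) x)

lemma An_const (hP1 : ∀ x, ∑ y, P x y = 1) (n : ℕ) (c : ℝ) (x : ι) :
    An P m f n (fun _ => c) x = c := by
  induction n generalizing x with
  | zero => rfl
  | succ n ih => simp only [An, ih, ← Finset.sum_mul, hP1, one_mul]

lemma An_smul (n : ℕ) (c : ℝ) (H : (ℕ → ℝ) → ℝ) (x : ι) :
    An P m f n (fun a => c * H a) x = c * An P m f n H x := by
  induction n generalizing H x with
  | zero => rfl
  | succ n ih =>
    simp only [An]
    rw [Finset.mul_sum]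
    refine Finset.sum_congr rfl fun y _ => ?_
    rw [ih (fun a => H (sqc (f x) (m x y) a))]; ring

lemma An_sum (n : ℕ) (s : Finset ℕ) (H : ℕ → (ℕ → ℝ) → ℝ) (x : ι) :
    An P m f n (fun a => ∑ j ∈ s, H j a) x = ∑ j ∈ s, An P m f n (H j) x := by
  induction n generalizing H x with
  | zero => rfl
  | succ n ih =>
    simp only [An]
    rw [Finset.sum_comm]
    refine Finset.sum_congr rfl fun y _ => ?_
    rw [ih (fun j a => H j (sqc (f x) (m x y) a)), Finset.mul_sum]

lemma An_coord [DecidableEq ι] (hP1 : ∀ x, ∑ y, P x y = 1) {t : Matrix ι ι ℝ}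
    (ht : ∀ x y, t x y = P x y * m x y) (n k : ℕ) (hk : k ≤ n) (x : ι) :
    An P m f n (fun a => a k) x = ((t ^ k).mulVec f) x := by
  induction n generalizing k x with
  | zero =>
    obtain rfl : k = 0 := by omega
    simp [An, sqc]
  | succ n ih =>
    cases k with
    | zero => simp only [An, sqc, An_const hP1, ← Finset.sum_mul, hP1]; simp
    | succ k =>
      rw [pow_succ', ← Matrix.mulVec_mulVec]
      simp only [An, sqc]
      rw [Matrix.mulVec, dotProduct]
      refine Finset.sum_congr rfl fun y _ => ?_
      rw [An_smul n (m x y) (fun a => a k), ih k (by omega), ht]; ring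

lemma An_pow [DecidableEq ι] (hP : ∀ x y, 0 ≤ P x y) (hm : ∀ x y, 0 ≤ m x y) (hf : ∀ x, 0 ≤ f x)
    (hP1 : ∀ x, ∑ y, P x y = 1) {r : Matrix ι ι ℝ} {p : ℝ}
    (hr : ∀ x y, r x y = P x y * m x y ^ p) (n k : ℕ) (hk : k ≤ n) (x : ι) :
    An P m f n (fun a => a k ^ p) x = ((r ^ k).mulVec (fun x => f x ^ p)) x := by
  induction n generalizing k x with
  | zero =>
    obtain rfl : k = 0 := by omega
    simp [An, sqc]
  | succ n ih =>
    cases k with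
    | zero => simp only [An, sqc, An_const hP1, ← Finset.sum_mul, hP1]; simp
    | succ k =>
      rw [pow_succ', ← Matrix.mulVec_mulVec]
      simp only [An, sqc]
      rw [Matrix.mulVec, dotProduct]
      refine Finset.sum_congr rfl fun y _ => ?_
      rw [An_congr hP hm hf n (H' := fun a => m x y ^ p * a k ^ p)
        (fun a ha => Real.mul_rpow (hm x y) (ha k)),
        An_smul n (m x y ^ p) (fun a => a k ^ p), ih k (by omega), hr]; ring

lemma An_shift [DecidableEq ι] (hm : ∀ x y, 0 ≤ m x y)
    {r : Matrix ι ι ℝ} {p : ℝ}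
    (hr : ∀ x y, r x y = P x y * m x y ^ p) {Ψ : (ℕ → ℝ) → ℝ}
    (hΨ : ∀ (c : ℝ) (a : ℕ → ℝ), 0 ≤ c → Ψ (fun k => c * a k) = c ^ p * Ψ a) (n j : ℕ) (x : ι) :
    An P m f (n + j) (fun a => Ψ (fun k => a (k + j))) x = ((r ^ j).mulVec (An P m f n Ψ)) x := by
  induction j generalizing x with
  | zero => simp
  | succ j ih =>
    rw [pow_succ', ← Matrix.mulVec_mulVec, ← add_assoc]
    simp only [An, sqc, Nat.add_eq]
    rw [Matrix.mulVec, dotProduct]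
    refine Finset.sum_congr rfl fun y _ => ?_
    simp only [hΨ _ _ (hm x y)]
    rw [An_smul (n + j) (m x y ^ p) (fun a => Ψ (fun k => a (k + j))), ih, hr]; ring

lemma An_jensen (hP : ∀ x y, 0 ≤ P x y)
    (hP1 : ∀ x, ∑ y, P x y = 1) (n : ℕ) {Ψ : (ℕ → ℝ) → ℝ} (hΨ : ConvexOn ℝ Set.univ Ψ) (x : ι) :
    Ψ (fun k => An P m f n (fun a => a k) x) ≤ An P m f n Ψ x := by
  induction n generalizing Ψ x with
  | zero => exact le_rfl
  | succ n ih =>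
    have h1 : ∀ y, ConvexOn ℝ Set.univ (fun a => Ψ (sqc (f x) (m x y) a)) := by
      intro y
      refine ⟨convex_univ, fun a _ b _ s t hs ht hst => ?_⟩
      have e : sqc (f x) (m x y) (s • a + t • b) =
          s • sqc (f x) (m x y) a + t • sqc (f x) (m x y) b := by
        funext k
        cases k with
        | zero => simp only [sqc, Pi.add_apply, Pi.smul_apply, smul_eq_mul]; rw [← add_mul, hst, one_mul]
        | succ k => simp only [sqc, Pi.add_apply, Pi.smul_apply, smul_eq_mul]; ring
      simp only [e]
      exact hΨ.2 (Set.mem_univ _) (Set.mem_univ _) hs ht hst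
    have e : (fun k => An P m f (n+1) (fun a => a k) x) =
        ∑ y, P x y • sqc (f x) (m x y) (fun k => An P m f n (fun a => a k) y) := by
      funext k
      rw [Finset.sum_apply]
      simp only [An, Pi.smul_apply, smul_eq_mul]
      refine Finset.sum_congr rfl fun y _ => ?_
      cases k with
      | zero => simp only [sqc, An_const hP1]
      | succ k => simp only [sqc]; rw [An_smul n (m x y) (fun a => a k)]
    rw [e]
    refine (hΨ.map_sum_le (fun y _ => hP x y) (hP1 x) (fun y _ => Set.mem_univ _)).trans ?_
    simp only [An, smul_eq_mul]
    exact Finset.sum_le_sum fun y _ => mul_le_mul_of_nonneg_left (ih (h1 y) y) (hP x y)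

lemma mulVec_mono {r : Matrix ι ι ℝ} (hr : ∀ x y, 0 ≤ r x y) {a b : ι → ℝ} (h : ∀ x, a x ≤ b x) (x : ι) :
    r.mulVec a x ≤ r.mulVec b x :=
  Finset.sum_le_sum fun y _ => mul_le_mul_of_nonneg_left (h y) (hr x y)

lemma mpow_nonneg [DecidableEq ι] {r : Matrix ι ι ℝ} (hr : ∀ x y, 0 ≤ r x y) (j : ℕ) (x y : ι) : 0 ≤ (r ^ j) x y := by
  induction j generalizing x y with
  | zero => rw [pow_zero, Matrix.one_apply]; split_ifs <;> norm_num
  | succ j ih => rw [pow_succ, Matrix.mul_apply]; exact Finset.sum_nonneg fun z _ => mul_nonneg (ih x z) (hr z y)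

/-- the transference step (♠) -/
lemma spade [DecidableEq ι] (hP : ∀ x y, 0 ≤ P x y) (hm : ∀ x y, 0 ≤ m x y) (hf : ∀ x, 0 ≤ f x)
    (hP1 : ∀ x, ∑ y, P x y = 1) {t r : Matrix ι ι ℝ} {p : ℝ}
    (ht : ∀ x y, t x y = P x y * m x y) (hr : ∀ x y, r x y = P x y * m x y ^ p)
    {Ψ : (ℕ → ℝ) → ℝ} (hconv : ConvexOn ℝ Set.univ Ψ)
    (hΨ : ∀ (c : ℝ) (a : ℕ → ℝ), 0 ≤ c → Ψ (fun k => c * a k) = c ^ p * Ψ a)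
    {K : ℕ} (hK : ∀ a b : ℕ → ℝ, (∀ k ≤ K, a k = b k) → Ψ a = Ψ b) {C : ℝ}
    (hseq : ∀ a : ℕ → ℝ, (∀ k, 0 ≤ a k) → ∀ J, ∑ j ∈ Finset.range J, Ψ (fun k => a (k + j)) ≤
      C * ∑ k ∈ Finset.range (J + K), a k ^ p) (J : ℕ) (x : ι) :
    ∑ j ∈ Finset.range J, ((r ^ j).mulVec (fun x => Ψ (fun k => ((t ^ k).mulVec f) x))) x ≤
      C * ∑ k ∈ Finset.range (J + K), ((r ^ k).mulVec (fun x => f x ^ p)) x := by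
  have hr0 : ∀ x y, 0 ≤ r x y := fun x y => by
    rw [hr]; exact mul_nonneg (hP x y) (Real.rpow_nonneg (hm x y) _)
  have h1 : ∀ j ∈ Finset.range J, ((r ^ j).mulVec (fun x => Ψ (fun k => ((t ^ k).mulVec f) x))) x ≤
      An P m f (J + K) (fun a => Ψ (fun k => a (k + j))) x := by
    intro j hj
    rw [Finset.mem_range] at hj
    have e : J + K = (J + K - j) + j := by omega
    rw [e, An_shift hm hr hΨ]
    refine mulVec_mono (mpow_nonneg hr0 j) (fun y => ?_) x
    rw [← hK _ _ (fun k hk => An_coord (f := f) hP1 ht (J + K - j) k (by omega) y)]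
    exact An_jensen hP hP1 _ hconv y
  refine (Finset.sum_le_sum h1).trans ?_
  rw [← An_sum (J + K) (Finset.range J) (fun j a => Ψ (fun k => a (k + j)))]
  refine (An_mono hP hm hf _ (fun a ha => hseq a ha J) x).trans (le_of_eq ?_)
  rw [An_smul (J + K) C (fun a => ∑ k ∈ Finset.range (J + K), a k ^ p),
    An_sum (J + K) _ (fun k a => a k ^ p)]
  congr 1
  refine Finset.sum_congr rfl fun k hk => ?_
  rw [Finset.mem_range] at hk
  exact An_pow hP hm hf hP1 hr _ k hk.le x

/-- averaging -/
lemma avg_out [DecidableEq ι] {r : Matrix ι ι ℝ} (hr0 : ∀ x y, 0 ≤ r x y) (hc : ∀ y, ∑ x, r x y ≤ 1)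
    {σ g : ι → ℝ} (hg : ∀ x, 0 ≤ g x) {C : ℝ} (hC : 0 ≤ C) {K : ℕ}
    (h : ∀ J x, ∑ j ∈ Finset.range J, ((r ^ j).mulVec σ) x ≤
      C * ∑ k ∈ Finset.range (J + K), ((r ^ k).mulVec g) x) :
    ∑ x, σ x ≤ C * ∑ x, g x := by
  set S : (ι → ℝ) → ℕ → ℝ := fun e j => ∑ x, ((r ^ j).mulVec e) x with hS
  set d : ι → ℝ := fun y => 1 - ∑ x, r x y with hd
  have hd0 : ∀ y, 0 ≤ d y := fun y => sub_nonneg.2 (hc y)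
  have step : ∀ (e : ι → ℝ) j, S e j - S e (j + 1) = ∑ y, d y * ((r ^ j).mulVec e) y := by
    intro e j
    simp only [hS, hd, sub_mul, one_mul, Finset.sum_sub_distrib]
    congr 1
    rw [pow_succ', ← Matrix.mulVec_mulVec]
    simp only [Matrix.mulVec, dotProduct, Finset.sum_mul]
    rw [Finset.sum_comm]
  have tele : ∀ (e : ι → ℝ) J, S e 0 - S e J = ∑ y, d y * ∑ j ∈ Finset.range J, ((r ^ j).mulVec e) y := by
    intro e J
    rw [← Finset.sum_range_sub' (S e) J]
    simp only [step, Finset.mul_sum]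
    rw [Finset.sum_comm]
  have A1 : ∀ J, S σ 0 - S σ J ≤ C * (S g 0 - S g (J + K)) := by
    intro J
    rw [tele, tele, Finset.mul_sum]
    refine Finset.sum_le_sum fun y _ => ?_
    calc _ ≤ d y * (C * ∑ k ∈ Finset.range (J + K), ((r ^ k).mulVec g) y) :=
          mul_le_mul_of_nonneg_left (h J y) (hd0 y)
      _ = _ := by ring
  have A2 : ∀ J, ∑ j ∈ Finset.range J, S σ j ≤ C * ∑ k ∈ Finset.range (J + K), S g k := by
    intro J
    simp only [hS]
    rw [Finset.sum_comm, Finset.sum_comm (s := Finset.range (J + K)), Finset.mul_sum]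
    exact Finset.sum_le_sum fun x _ => h J x
  have ganti : ∀ k, S g k ≤ S g 0 := by
    intro k
    have : 0 ≤ S g 0 - S g k := by
      rw [tele]
      refine Finset.sum_nonneg fun y _ => mul_nonneg (hd0 y) (Finset.sum_nonneg fun j _ =>
        Finset.sum_nonneg fun z _ => mul_nonneg (mpow_nonneg hr0 j y z) (hg z))
    linarith
  have A3 : ∀ J : ℕ, J * S σ 0 ≤ C * (J * S g 0) + C * (K * S g 0) := by
    intro J
    have h1 := Finset.sum_le_sum fun j (_ : j ∈ Finset.range J) => A1 j
    rw [Finset.sum_sub_distrib, ← Finset.mul_sum, Finset.sum_sub_distrib] at h1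
    simp only [Finset.sum_const, Finset.card_range, nsmul_eq_mul] at h1
    have h2 := A2 J
    rw [add_comm J K, Finset.sum_range_add] at h2
    have h3 : ∑ k ∈ Finset.range K, S g k ≤ K * S g 0 := by
      calc _ ≤ ∑ k ∈ Finset.range K, S g 0 := Finset.sum_le_sum fun k _ => ganti k
        _ = _ := by simp
    have h4 : ∑ x ∈ Finset.range J, S g (K + x) = ∑ x ∈ Finset.range J, S g (x + K) :=
      Finset.sum_congr rfl fun x _ => by rw [add_comm]
    rw [h4] at h2
    have h5 := mul_le_mul_of_nonneg_left h3 hC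
    nlinarith
  have e0 : ∀ e, S e 0 = ∑ x, e x := fun e => by simp [hS]
  rw [e0, e0] at A3
  by_contra hlt
  push Not at hlt
  obtain ⟨J, hJ⟩ := exists_nat_gt ((C * (K * ∑ x, g x)) / (∑ x, σ x - C * ∑ x, g x))
  rw [div_lt_iff₀ (by linarith)] at hJ
  have := A3 J
  nlinarith
end
end QME

namespace QME

lemma tang {p a x : ℝ} (hp : 1 ≤ p) (ha : 0 < a) (hx : 0 ≤ x) :
    a ^ p + p * a ^ (p - 1) * (x - a) ≤ x ^ p := by
  have h := one_add_mul_self_le_rpow_one_add (s := x / a - 1) (by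
    have : 0 ≤ x / a := by positivity
    linarith) hp
  have e : (1 + (x / a - 1)) ^ p = x ^ p / a ^ p := by
    rw [← Real.div_rpow hx ha.le]; congr 1; ring
  rw [e, le_div_iff₀ (by positivity)] at h
  have e2 : a ^ p = a ^ (p - 1) * a := by
    rw [← Real.rpow_add_one ha.ne']; congr 1; ring
  refine le_trans (le_of_eq ?_) h
  rw [e2]; field_simp

section
variable {ι : Type*} [Fintype ι] [DecidableEq ι]

lemma eigen [Nonempty ι] {t : Matrix ι ι ℝ} (ht : ∀ x y, 0 < t x y) {p : ℝ} (hp : 1 < p)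
    (hcon : ∀ f : ι → ℝ, (∀ x, 0 ≤ f x) → ∑ x, (t.mulVec f x) ^ p ≤ ∑ x, f x ^ p) :
    ∃ u : ι → ℝ, (∀ x, 0 < u x) ∧ ∀ y, ∑ x, (t.mulVec u x) ^ (p - 1) * t x y ≤ u y ^ (p - 1) := by
  have hp0 : 0 < p := by linarith
  have hp1 : 0 < p - 1 := by linarith
  set S : Set (ι → ℝ) := {u | (∀ x, 0 ≤ u x) ∧ ∑ x, u x ^ p = 1} with hS
  have hcont : Continuous fun u : ι → ℝ => ∑ x, u x ^ p :=
    continuous_finsetSum _ fun x _ => (continuous_apply x).rpow_const fun _ => Or.inr hp0.le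
  have hclosed : IsClosed S := by
    have : S = (⋂ x, {u : ι → ℝ | 0 ≤ u x}) ∩ {u | ∑ x, u x ^ p = 1} := by
      ext u; simp [hS]
    rw [this]
    exact (isClosed_iInter fun x => isClosed_le continuous_const (continuous_apply x)).inter
      (isClosed_eq hcont continuous_const)
  have hcomp : IsCompact S := by
    refine (isCompact_Icc (a := (0 : ι → ℝ)) (b := 1)).of_isClosed_subset hclosed ?_
    rintro u ⟨h1, h2⟩
    refine ⟨fun x => h1 x, fun x => ?_⟩
    have : u x ^ p ≤ 1 := h2 ▸ Finset.single_le_sum (f := fun x => u x ^ p)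
      (fun y _ => Real.rpow_nonneg (h1 y) _) (Finset.mem_univ x)
    by_contra hc
    push Not at hc
    have := Real.one_lt_rpow hc hp0
    linarith
  have hne : S.Nonempty := by
    obtain ⟨i⟩ := ‹Nonempty ι›
    refine ⟨Pi.single i 1, fun x => ?_, ?_⟩
    · by_cases h : x = i
      · subst h; simp
      · simp [Pi.single_eq_of_ne h]
    · rw [Finset.sum_eq_single i]
      · simp
      · intro b _ hb; rw [Pi.single_eq_of_ne hb, Real.zero_rpow hp0.ne']
      · simp
  have hmv : ∀ x, Continuous fun u : ι → ℝ => t.mulVec u x := fun x => by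
    simp only [Matrix.mulVec, dotProduct]; fun_prop
  have hφ : Continuous fun u : ι → ℝ => ∑ x, (t.mulVec u x) ^ p :=
    continuous_finsetSum _ fun x _ => (hmv x).rpow_const fun _ => Or.inr hp0.le
  obtain ⟨u, hu, hmax⟩ := hcomp.exists_isMaxOn hne hφ.continuousOn
  set lam := ∑ x, (t.mulVec u x) ^ p with hlam
  have hlam1 : lam ≤ 1 := by rw [← hu.2]; exact hcon u hu.1
  have hlam0 : 0 ≤ lam := Finset.sum_nonneg fun x _ => Real.rpow_nonneg
    (Finset.sum_nonneg fun y _ => mul_nonneg (ht x y).le (hu.1 y)) _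
  have hom : ∀ w : ι → ℝ, (∀ x, 0 ≤ w x) → 0 < ∑ x, w x ^ p →
      ∑ x, (t.mulVec w x) ^ p ≤ lam * ∑ x, w x ^ p := by
    intro w hw hN
    set N := ∑ x, w x ^ p with hNd
    set c := N ^ (-(1 / p)) with hc
    have hc0 : 0 < c := by positivity
    have hcp : c ^ p = N⁻¹ := by
      rw [hc, ← Real.rpow_mul hN.le, show -(1 / p) * p = -1 by field_simp, Real.rpow_neg_one]
    have hmem : c • w ∈ S := by
      refine ⟨fun x => mul_nonneg hc0.le (hw x), ?_⟩
      simp only [Pi.smul_apply, smul_eq_mul]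
      rw [Finset.sum_congr rfl fun x _ => Real.mul_rpow hc0.le (hw x), ← Finset.mul_sum, hcp,
        ← hNd, inv_mul_cancel₀ hN.ne']
    have h := hmax hmem
    simp only [Set.mem_ofPred_eq, Matrix.mulVec_smul, Pi.smul_apply, smul_eq_mul] at h
    have htw : ∀ x, 0 ≤ t.mulVec w x := fun x =>
      Finset.sum_nonneg fun y _ => mul_nonneg (ht x y).le (hw y)
    rw [Finset.sum_congr rfl fun x _ => Real.mul_rpow hc0.le (htw x), ← Finset.mul_sum, hcp,
      inv_mul_le_iff₀ hN] at h
    linarith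
  set v := t.mulVec u with hv
  have hv0 : ∀ x, 0 < v x := by
    intro x
    have h0 : 0 ≤ v x := Finset.sum_nonneg fun y _ => mul_nonneg (ht x y).le (hu.1 y)
    rcases h0.eq_or_lt with h | h
    swap
    · exact h
    exfalso
    have h' : ∑ y, t x y * u y = 0 := h.symm
    rw [Finset.sum_eq_zero_iff_of_nonneg fun y _ => mul_nonneg (ht x y).le (hu.1 y)] at h'
    have : ∑ y, u y ^ p = 0 := Finset.sum_eq_zero fun y hy => by
      have := h' y hy
      rcases mul_eq_zero.1 this with h1 | h1
      · exact absurd h1 (ht x y).ne'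
      · rw [h1, Real.zero_rpow hp0.ne']
    rw [hu.2] at this; norm_num at this
  have key : ∀ y, ∀ s : ℝ, 0 < s → ∑ x, v x ^ (p - 1) * t x y ≤ (u y + s) ^ (p - 1) := by
    intro y s hs
    set w := u + s • Pi.single y (1:ℝ) with hw
    have hwx : ∀ x, w x = if x = y then u y + s else u x := by
      intro x
      simp only [hw, Pi.add_apply, Pi.smul_apply, smul_eq_mul, Pi.single_apply]
      split_ifs with h
      · rw [h, mul_one]
      · ring
    have hwv : ∀ x, t.mulVec w x = v x + s * t x y := by
      intro x
      simp [hw, Matrix.mulVec_add, Matrix.mulVec_smul, hv]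
    have hw0 : ∀ x, 0 ≤ w x := fun x => by
      rw [hwx]; split_ifs
      · have := hu.1 y; linarith
      · exact hu.1 x
    have hsum : ∑ x, w x ^ p = 1 + ((u y + s) ^ p - u y ^ p) := by
      rw [← hu.2, ← Finset.add_sum_erase _ _ (Finset.mem_univ y),
        ← Finset.add_sum_erase _ (fun x => u x ^ p) (Finset.mem_univ y), hwx y, if_pos rfl]
      have : ∑ x ∈ Finset.univ.erase y, w x ^ p = ∑ x ∈ Finset.univ.erase y, u x ^ p :=
        Finset.sum_congr rfl fun x hx => by rw [hwx, if_neg (Finset.ne_of_mem_erase hx)]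
      rw [this]; ring
    have huys : 0 < u y + s := by have := hu.1 y; linarith
    have hup : (u y + s) ^ p - u y ^ p ≤ p * s * (u y + s) ^ (p - 1) := by
      have := tang hp.le huys (hu.1 y)
      nlinarith
    have hup0 : u y ^ p ≤ (u y + s) ^ p := Real.rpow_le_rpow (hu.1 y) (by linarith) hp0.le
    have h1 := hom w hw0 (by rw [hsum]; linarith)
    rw [hsum] at h1
    have h2 : lam + p * s * ∑ x, v x ^ (p - 1) * t x y ≤ ∑ x, (t.mulVec w x) ^ p := by
      rw [hlam, Finset.mul_sum, ← Finset.sum_add_distrib]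
      refine Finset.sum_le_sum fun x _ => ?_
      rw [hwv]
      have := tang hp.le (hv0 x) (x := v x + s * t x y) (by
        have := hv0 x; have := ht x y; positivity)
      refine le_trans (le_of_eq ?_) this
      ring
    have h3 : p * s * ∑ x, v x ^ (p - 1) * t x y ≤ p * s * (u y + s) ^ (p - 1) := by
      have : lam * ((u y + s) ^ p - u y ^ p) ≤ 1 * ((u y + s) ^ p - u y ^ p) :=
        mul_le_mul_of_nonneg_right hlam1 (by linarith)
      nlinarith
    exact le_of_mul_le_mul_left h3 (by positivity)
  have key2 : ∀ y, ∑ x, v x ^ (p - 1) * t x y ≤ u y ^ (p - 1) := by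
    intro y
    have hc : Filter.Tendsto (fun s : ℝ => (u y + s) ^ (p - 1)) (nhdsWithin 0 (Set.Ioi 0))
        (nhds ((u y + 0) ^ (p - 1))) := by
      have : Continuous fun s : ℝ => (u y + s) ^ (p - 1) :=
        (continuous_const.add continuous_id).rpow_const fun _ => Or.inr hp1.le
      exact (this.tendsto 0).mono_left nhdsWithin_le_nhds
    rw [add_zero] at hc
    exact ge_of_tendsto hc (Filter.eventually_of_mem self_mem_nhdsWithin fun s hs => key y s hs)
  refine ⟨u, fun y => ?_, key2⟩
  rcases (hu.1 y).eq_or_lt with h | h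
  swap
  · exact h
  exfalso
  have h1 := key2 y
  rw [← h, Real.zero_rpow hp1.ne'] at h1
  have : 0 < ∑ x, v x ^ (p - 1) * t x y := Finset.sum_pos
    (fun x _ => mul_pos (Real.rpow_pos_of_pos (hv0 x) _) (ht x y)) Finset.univ_nonempty
  linarith

lemma transfer_pos {t : Matrix ι ι ℝ} (ht : ∀ x y, 0 < t x y) {p : ℝ} (hp : 1 < p)
    (hcon : ∀ f : ι → ℝ, (∀ x, 0 ≤ f x) → ∑ x, (t.mulVec f x) ^ p ≤ ∑ x, f x ^ p)
    {Ψ : (ℕ → ℝ) → ℝ} (hconv : ConvexOn ℝ Set.univ Ψ)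
    (hΨ : ∀ (c : ℝ) (a : ℕ → ℝ), 0 ≤ c → Ψ (fun k => c * a k) = c ^ p * Ψ a)
    {K : ℕ} (hK : ∀ a b : ℕ → ℝ, (∀ k ≤ K, a k = b k) → Ψ a = Ψ b) {C : ℝ} (hC : 0 ≤ C)
    (hseq : ∀ a : ℕ → ℝ, (∀ k, 0 ≤ a k) → ∀ J, ∑ j ∈ Finset.range J, Ψ (fun k => a (k + j)) ≤
      C * ∑ k ∈ Finset.range (J + K), a k ^ p) {f : ι → ℝ} (hf : ∀ x, 0 ≤ f x) :
    ∑ x, Ψ (fun k => ((t ^ k).mulVec f) x) ≤ C * ∑ x, f x ^ p := by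
  cases isEmpty_or_nonempty ι with
  | inl h => simp
  | inr h =>
  obtain ⟨u, hu, hcol⟩ := eigen ht hp hcon
  set v := t.mulVec u with hv
  have hv0 : ∀ x, 0 < v x := fun x =>
    Finset.sum_pos (fun y _ => mul_pos (ht x y) (hu y)) Finset.univ_nonempty
  set P : ι → ι → ℝ := fun x y => t x y * u y / v x with hP
  set m : ι → ι → ℝ := fun x y => v x / u y with hm
  set r : Matrix ι ι ℝ := fun x y => P x y * m x y ^ p with hr
  have hP0 : ∀ x y, 0 ≤ P x y := fun x y =>
    (div_pos (mul_pos (ht x y) (hu y)) (hv0 x)).le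
  have hm0 : ∀ x y, 0 ≤ m x y := fun x y => (div_pos (hv0 x) (hu y)).le
  have hP1 : ∀ x, ∑ y, P x y = 1 := fun x => by
    simp only [hP]; rw [← Finset.sum_div]; exact div_self (hv0 x).ne'
  have hr0 : ∀ x y, 0 ≤ r x y := fun x y => mul_nonneg (hP0 x y) (Real.rpow_nonneg (hm0 x y) _)
  refine avg_out (r := r) (K := K) hr0 (fun y => ?_) (fun x => Real.rpow_nonneg (hf x) _) hC
    (fun J x => spade hP0 hm0 hf hP1 (t := t) (r := r) (fun x y => ?_) (fun _ _ => rfl) hconv hΨ hK hseq J x)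
  · have e : ∀ x, r x y = (v x ^ (p - 1) * t x y) / u y ^ (p - 1) := by
      intro x
      have e1 : v x ^ p = v x ^ (p - 1) * v x := by
        rw [← Real.rpow_add_one (hv0 x).ne']; congr 1; ring
      have e2 : u y ^ p = u y ^ (p - 1) * u y := by
        rw [← Real.rpow_add_one (hu y).ne']; congr 1; ring
      simp only [hr, hP, hm]
      have h1 := (hv0 x).ne'
      have h2 := (hu y).ne'
      have h3 := (Real.rpow_pos_of_pos (hu y) (p - 1)).ne'
      rw [Real.div_rpow (hv0 x).le (hu y).le, e1, e2]
      field_simp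
    rw [Finset.sum_congr rfl fun x _ => e x, ← Finset.sum_div,
      div_le_one (Real.rpow_pos_of_pos (hu y) _)]
    exact hcol y
  · have h1 := (hv0 x).ne'
    have h2 := (hu y).ne'
    simp only [hP, hm]; field_simp
end
end QME

namespace QME

section
variable {ι : Type*} [Fintype ι] [DecidableEq ι]

lemma transfer {t : Matrix ι ι ℝ} (ht : ∀ x y, 0 ≤ t x y) {p : ℝ} (hp : 1 < p)
    (hcon : ∀ f : ι → ℝ, (∀ x, 0 ≤ f x) → ∑ x, (t.mulVec f x) ^ p ≤ ∑ x, f x ^ p)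
    {Ψ : (ℕ → ℝ) → ℝ} (hcts : Continuous Ψ) (hconv : ConvexOn ℝ Set.univ Ψ)
    (hΨ : ∀ (c : ℝ) (a : ℕ → ℝ), 0 ≤ c → Ψ (fun k => c * a k) = c ^ p * Ψ a)
    {K : ℕ} (hK : ∀ a b : ℕ → ℝ, (∀ k ≤ K, a k = b k) → Ψ a = Ψ b) {C : ℝ} (hC : 0 ≤ C)
    (hseq : ∀ a : ℕ → ℝ, (∀ k, 0 ≤ a k) → ∀ J, ∑ j ∈ Finset.range J, Ψ (fun k => a (k + j)) ≤
      C * ∑ k ∈ Finset.range (J + K), a k ^ p) {f : ι → ℝ} (hf : ∀ x, 0 ≤ f x) :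
    ∑ x, Ψ (fun k => ((t ^ k).mulVec f) x) ≤ C * ∑ x, f x ^ p := by
  cases isEmpty_or_nonempty ι with
  | inl h => simp
  | inr h =>
  set N : ℝ := (Fintype.card ι : ℝ) with hN
  have hN0 : 0 < N := by rw [hN]; exact_mod_cast Fintype.card_pos
  set te : ℝ → Matrix ι ι ℝ := fun ε => (1 + ε * N)⁻¹ • (t + ε • Matrix.of fun _ _ => 1) with hte
  have hlim : Filter.Tendsto te (nhdsWithin 0 (Set.Ioi 0)) (nhds t) := by
    have h1 : ContinuousAt te 0 := by
      have a1 : ContinuousAt (fun ε : ℝ => (1 + ε * N)⁻¹) 0 :=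
        ContinuousAt.inv₀ (by fun_prop) (by simp)
      have a2 : ContinuousAt (fun ε : ℝ => t + ε • (Matrix.of fun (_ _ : ι) => (1:ℝ))) 0 := by
        fun_prop
      exact a1.smul a2
    have h2 := h1.tendsto
    have e : te 0 = t := by simp [hte]
    rw [e] at h2
    exact h2.mono_left nhdsWithin_le_nhds
  have hmain : ∀ ε > 0, ∑ x, Ψ (fun k => ((te ε ^ k).mulVec f) x) ≤ C * ∑ x, f x ^ p := by
    intro ε hε
    have hd : 0 < 1 + ε * N := by positivity
    refine transfer_pos (t := te ε) (fun x y => ?_) hp (fun f hf => ?_) hconv hΨ hK hC hseq hf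
    · have := ht x y
      simp only [hte, Matrix.smul_apply, Matrix.add_apply, Matrix.of_apply, smul_eq_mul]
      positivity
    · set s := ∑ y, f y with hs
      have hs0 : 0 ≤ s := Finset.sum_nonneg fun y _ => hf y
      have e1 : ∀ x, (te ε).mulVec f x = (1 + ε * N)⁻¹ * t.mulVec f x + (ε * N / (1 + ε * N)) * (s / N) := by
        intro x
        simp only [hte, Matrix.smul_mulVec, Matrix.add_mulVec, Pi.smul_apply, Pi.add_apply, smul_eq_mul]
        have : (Matrix.of fun (_ _ : ι) => (1:ℝ)).mulVec f x = s := by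
          simp [Matrix.mulVec, dotProduct, hs]
        rw [this]
        field_simp
      have h2 : ∀ x, ((te ε).mulVec f x) ^ p ≤ (1 + ε * N)⁻¹ * (t.mulVec f x) ^ p +
          (ε * N / (1 + ε * N)) * (s / N) ^ p := by
        intro x
        rw [e1]
        exact (convexOn_rpow hp.le).2
          (Finset.sum_nonneg fun y _ => mul_nonneg (ht x y) (hf y) : (0:ℝ) ≤ t.mulVec f x)
          (by positivity : (0:ℝ) ≤ s / N) (by positivity) (by positivity) (by field_simp)
      refine (Finset.sum_le_sum fun x _ => h2 x).trans ?_
      rw [Finset.sum_add_distrib, ← Finset.mul_sum, Finset.sum_const, Finset.card_univ, nsmul_eq_mul, ← hN]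
      have h3 : N * (s / N) ^ p ≤ ∑ x, f x ^ p := by
        have h := Real.rpow_sum_le_const_mul_sum_rpow_of_nonneg (s := Finset.univ) (f := f) hp.le (fun i _ => hf i)
        rw [Finset.card_univ, ← hN, ← hs] at h
        rw [Real.div_rpow hs0 hN0.le]
        have e : N ^ p = N ^ (p - 1) * N := by rw [← Real.rpow_add_one hN0.ne']; congr 1; ring
        rw [e]
        have : 0 < N ^ (p - 1) := by positivity
        calc N * (s ^ p / (N ^ (p - 1) * N)) = s ^ p / N ^ (p - 1) := by field_simp
          _ ≤ _ := by rw [div_le_iff₀ this]; linarith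
      have h4 := hcon f hf
      calc _ = (1 + ε * N)⁻¹ * ∑ x, (t.mulVec f x) ^ p + (ε * N / (1 + ε * N)) * (N * (s / N) ^ p) := by ring
        _ ≤ (1 + ε * N)⁻¹ * ∑ x, f x ^ p + (ε * N / (1 + ε * N)) * ∑ x, f x ^ p := by gcongr
        _ = _ := by field_simp
  have hl2 : Filter.Tendsto (fun ε => ∑ x, Ψ (fun k => ((te ε ^ k).mulVec f) x)) (nhdsWithin 0 (Set.Ioi 0))
      (nhds (∑ x, Ψ (fun k => ((t ^ k).mulVec f) x))) := by
    refine tendsto_finsetSum _ fun x _ => ?_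
    refine (hcts.tendsto _).comp (tendsto_pi_nhds.2 fun k => ?_)
    have hc : Continuous fun A : Matrix ι ι ℝ => A.mulVec f x := by
      simp only [Matrix.mulVec, dotProduct]; fun_prop
    exact (hc.tendsto _).comp (hlim.pow k)
  exact le_of_tendsto hl2 (Filter.eventually_of_mem self_mem_nhdsWithin fun ε hε => hmain ε hε)
end

lemma av_shift (n : ℕ) (a : ℕ → ℝ) (j : ℕ) : av n (fun k => a (k + j)) 0 = av n a j := by
  unfold av; congr 1; refine Finset.sum_congr rfl fun t _ => ?_; rw [zero_add, add_comm]

lemma av_lin (n : ℕ) (s t : ℝ) (a b : ℕ → ℝ) (x : ℕ) :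
    av n (s • a + t • b) x = s * av n a x + t * av n b x := by
  simp only [av, Pi.add_apply, Pi.smul_apply, smul_eq_mul, Finset.sum_add_distrib, ← Finset.mul_sum]; ring

/-- the functional -/
noncomputable def PsiF (p : ℝ) (n : ℕ → ℕ) (M : ℕ) (a : ℕ → ℝ) : ℝ := SQ n M a 0 ^ (p / 2)

lemma PsiF_cts {p : ℝ} (hp : 1 < p) (n : ℕ → ℕ) (M : ℕ) : Continuous (PsiF p n M) := by
  unfold PsiF SQ av
  refine Continuous.rpow_const (by fun_prop) fun _ => Or.inr (by linarith)

lemma PsiF_hom {p : ℝ} (hp : 1 < p) (n : ℕ → ℕ) (M : ℕ) (c : ℝ) (a : ℕ → ℝ) (hc : 0 ≤ c) :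
    PsiF p n M (fun k => c * a k) = c ^ p * PsiF p n M a := by
  have e : SQ n M (fun k => c * a k) 0 = c ^ 2 * SQ n M a 0 := by
    simp only [SQ, av, ← Finset.mul_sum]
    rw [Finset.mul_sum]
    refine Finset.sum_congr rfl fun i _ => by ring
  unfold PsiF
  rw [e, Real.mul_rpow (sq_nonneg _) (SQ_nonneg _ _ _ _), ← Real.rpow_natCast, ← Real.rpow_mul hc]
  congr 2; push_cast; ring

lemma PsiF_conv {p : ℝ} (hp : 1 < p) (n : ℕ → ℕ) (M : ℕ) : ConvexOn ℝ Set.univ (PsiF p n M) := by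
  set Lf : (ℕ → ℝ) → EuclideanSpace ℝ (Fin M) := fun a =>
    WithLp.toLp 2 fun i => av (n i) a 0 - av (n (i+1)) a 0 with hL
  have e : ∀ a, PsiF p n M a = ‖Lf a‖ ^ p := by
    intro a
    rw [EuclideanSpace.norm_eq, Real.sqrt_eq_rpow, ← Real.rpow_mul (by positivity)]
    unfold PsiF SQ
    rw [Finset.sum_range]
    congr 1
    · refine Finset.sum_congr rfl fun i _ => ?_
      simp [hL]
    · ring
  refine ⟨convex_univ, fun a _ b _ s t hs ht hst => ?_⟩
  rw [e, e, e]
  have e2 : Lf (s • a + t • b) = s • Lf a + t • Lf b := by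
    ext i
    simp only [hL, av_lin, PiLp.add_apply, PiLp.smul_apply, smul_eq_mul]
    ring
  rw [e2]
  have h1 : ‖s • Lf a + t • Lf b‖ ≤ s * ‖Lf a‖ + t * ‖Lf b‖ := by
    refine (norm_add_le _ _).trans (le_of_eq ?_)
    rw [norm_smul, norm_smul, Real.norm_of_nonneg hs, Real.norm_of_nonneg ht]
  refine (Real.rpow_le_rpow (norm_nonneg _) h1 (by linarith)).trans ?_
  exact (convexOn_rpow hp.le).2 (norm_nonneg _ : (0:ℝ) ≤ ‖Lf a‖) (norm_nonneg _ : (0:ℝ) ≤ ‖Lf b‖) hs ht hst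

theorem fin_nonneg {p : ℝ} (hp : 1 < p) : ∃ C : ℝ, 0 ≤ C ∧
    ∀ (ι : Type) [Fintype ι] [DecidableEq ι] (t : Matrix ι ι ℝ), (∀ x y, 0 ≤ t x y) →
    (∀ f : ι → ℝ, (∀ x, 0 ≤ f x) → ∑ x, (t.mulVec f x) ^ p ≤ ∑ x, f x ^ p) →
    ∀ n : ℕ → ℕ, StrictMono n → (∀ i, 0 < n i) → ∀ M, ∀ f : ι → ℝ, (∀ x, 0 ≤ f x) →
    ∑ x, SQ n M (fun k => ((t ^ k).mulVec f) x) 0 ^ (p / 2) ≤ C * ∑ x, f x ^ p := by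
  obtain ⟨C, hC, h⟩ := sq_thm hp
  refine ⟨C, hC, fun ι _ _ t ht hcon n hn hpos M f hf => ?_⟩
  refine transfer ht hp hcon (PsiF_cts hp n M) (PsiF_conv hp n M) (PsiF_hom hp n M) (K := n M)
    (fun a b hab => ?_) hC (fun a ha J => ?_) hf
  · unfold PsiF
    rw [SQ_congr hn (fun y hy => hab y (by omega))]
  · refine le_trans (le_of_eq ?_) (h a ha n hn hpos M J)
    refine Finset.sum_congr rfl fun j _ => ?_
    simp only [PsiF, SQ, av_shift]

/-- complex average -/
noncomputable def avc (n : ℕ) (a : ℕ → ℂ) : ℂ := (∑ k ∈ Finset.range (n + 1), a k) / (n + 1)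

lemma avc_split (n m : ℕ) (b1 b2 b3 b4 : ℕ → ℝ) :
    ‖avc n (fun k => ((b1 k - b2 k : ℝ) : ℂ) + ((b3 k - b4 k : ℝ) : ℂ) * Complex.I)
      - avc m (fun k => ((b1 k - b2 k : ℝ) : ℂ) + ((b3 k - b4 k : ℝ) : ℂ) * Complex.I)‖ ^ 2 ≤
    2 * ((av n b1 0 - av m b1 0) ^ 2 + (av n b2 0 - av m b2 0) ^ 2 + (av n b3 0 - av m b3 0) ^ 2
      + (av n b4 0 - av m b4 0) ^ 2) := by
  have e : ∀ n, avc n (fun k => ((b1 k - b2 k : ℝ) : ℂ) + ((b3 k - b4 k : ℝ) : ℂ) * Complex.I) =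
      ((av n b1 0 - av n b2 0 : ℝ) : ℂ) + ((av n b3 0 - av n b4 0 : ℝ) : ℂ) * Complex.I := by
    intro n
    simp only [avc, av, zero_add]
    push_cast
    rw [Finset.sum_add_distrib, ← Finset.sum_mul, Finset.sum_sub_distrib, Finset.sum_sub_distrib]
    ring
  rw [e, e]
  have e2 : ((av n b1 0 - av n b2 0 : ℝ) : ℂ) + ((av n b3 0 - av n b4 0 : ℝ) : ℂ) * Complex.I -
      (((av m b1 0 - av m b2 0 : ℝ) : ℂ) + ((av m b3 0 - av m b4 0 : ℝ) : ℂ) * Complex.I) =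
      ((av n b1 0 - av n b2 0 - (av m b1 0 - av m b2 0) : ℝ) : ℂ) +
      ((av n b3 0 - av n b4 0 - (av m b3 0 - av m b4 0) : ℝ) : ℂ) * Complex.I := by push_cast; ring
  rw [e2, ← Complex.normSq_eq_norm_sq, Complex.normSq_add_mul_I]
  nlinarith [sq_nonneg ((av n b1 0 - av m b1 0) + (av n b2 0 - av m b2 0)),
    sq_nonneg ((av n b3 0 - av m b3 0) + (av n b4 0 - av m b4 0))]

lemma four_pow {q s1 s2 s3 s4 : ℝ} (hq : 0 < q) (h1 : 0 ≤ s1) (h2 : 0 ≤ s2) (h3 : 0 ≤ s3) (h4 : 0 ≤ s4) :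
    (2 * (s1 + s2 + s3 + s4)) ^ q ≤ 8 ^ q * (s1 ^ q + s2 ^ q + s3 ^ q + s4 ^ q) := by
  have key : ∀ s, 0 ≤ s → s1 ≤ s → s2 ≤ s → s3 ≤ s → s4 ≤ s →
      (2 * (s1 + s2 + s3 + s4)) ^ q ≤ 8 ^ q * s ^ q := by
    intro s hs a b c d
    rw [← Real.mul_rpow (by norm_num) hs]
    exact Real.rpow_le_rpow (by positivity) (by linarith) hq.le
  have p1 := Real.rpow_nonneg h1 q
  have p2 := Real.rpow_nonneg h2 q
  have p3 := Real.rpow_nonneg h3 q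
  have p4 := Real.rpow_nonneg h4 q
  have e8 : (0:ℝ) ≤ 8 ^ q := by positivity
  rcases le_total s1 s2 with a | a <;> rcases le_total s3 s4 with b | b
  · rcases le_total s2 s4 with c | c
    · exact (key s4 h4 (by linarith) c b le_rfl).trans (by gcongr; linarith)
    · exact (key s2 h2 a le_rfl (by linarith) c).trans (by gcongr; linarith)
  · rcases le_total s2 s3 with c | c
    · exact (key s3 h3 (by linarith) c le_rfl b).trans (by gcongr; linarith)
    · exact (key s2 h2 a le_rfl c (by linarith)).trans (by gcongr; linarith)
  · rcases le_total s1 s4 with c | c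
    · exact (key s4 h4 c (by linarith) b le_rfl).trans (by gcongr; linarith)
    · exact (key s1 h1 le_rfl a (by linarith) c).trans (by gcongr; linarith)
  · rcases le_total s1 s3 with c | c
    · exact (key s3 h3 c (by linarith) le_rfl b).trans (by gcongr; linarith)
    · exact (key s1 h1 le_rfl a c (by linarith)).trans (by gcongr; linarith)

theorem fin_complex {p : ℝ} (hp : 1 < p) : ∃ C : ℝ, 0 ≤ C ∧
    ∀ (ι : Type) [Fintype ι] (t : ι → ι → ℝ), (∀ x y, 0 ≤ t x y) →
    (∀ f : ι → ℝ, (∀ x, 0 ≤ f x) → ∑ x, (∑ y, t x y * f y) ^ p ≤ ∑ x, f x ^ p) →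
    ∀ n : ℕ → ℕ, StrictMono n → (∀ i, 0 < n i) → ∀ M, ∀ g : ℕ → ι → ℂ,
    (∀ k x, g (k + 1) x = ∑ y, (t x y : ℂ) * g k y) →
    ∑ x, (∑ i ∈ Finset.range M, ‖avc (n i) (fun k => g k x) - avc (n (i+1)) (fun k => g k x)‖ ^ 2) ^ (p / 2)
      ≤ C * ∑ x, ‖g 0 x‖ ^ p := by
  obtain ⟨C, hC, h⟩ := fin_nonneg hp
  refine ⟨8 ^ (p / 2) * (4 * C), by positivity, fun ι _ t ht hcon n hn hpos M g hg => ?_⟩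
  classical
  set t' : Matrix ι ι ℝ := Matrix.of t with ht'
  set f1 : ι → ℝ := fun x => max (g 0 x).re 0 with hf1
  set f2 : ι → ℝ := fun x => max (-(g 0 x).re) 0 with hf2
  set f3 : ι → ℝ := fun x => max (g 0 x).im 0 with hf3
  set f4 : ι → ℝ := fun x => max (-(g 0 x).im) 0 with hf4
  set b : (ι → ℝ) → ι → ℕ → ℝ := fun f x k => ((t' ^ k).mulVec f) x with hb
  have hbs : ∀ f x k, b f x (k + 1) = ∑ y, t x y * b f y k := by
    intro f x k
    simp only [hb]
    rw [pow_succ', ← Matrix.mulVec_mulVec]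
    rfl
  have hb0 : ∀ f x, b f x 0 = f x := fun f x => by simp [hb]
  have hdec : ∀ r : ℝ, max r 0 - max (-r) 0 = r := fun r => by
    rcases le_total r 0 with h | h
    · rw [max_eq_right h, max_eq_left (by linarith)]; ring
    · rw [max_eq_left h, max_eq_right (by linarith)]; ring
  have hgk : ∀ k x, g k x = ((b f1 x k - b f2 x k : ℝ) : ℂ) + ((b f3 x k - b f4 x k : ℝ) : ℂ) * Complex.I := by
    intro k
    induction k with
    | zero =>
      intro x
      simp only [hb0, hf1, hf2, hf3, hf4, hdec, Complex.re_add_im]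
    | succ k ih =>
      intro x
      rw [hg]
      simp only [hbs, ih]
      push_cast
      rw [← Finset.sum_sub_distrib, ← Finset.sum_sub_distrib, Finset.sum_mul, ← Finset.sum_add_distrib]
      exact Finset.sum_congr rfl fun y _ => by ring
  have hcon' : ∀ f : ι → ℝ, (∀ x, 0 ≤ f x) → ∑ x, (t'.mulVec f x) ^ p ≤ ∑ x, f x ^ p := hcon
  have hone : ∀ f : ι → ℝ, (∀ x, 0 ≤ f x) → (∀ x, f x ≤ ‖g 0 x‖) →
      ∑ x, SQ n M (b f x) 0 ^ (p / 2) ≤ C * ∑ x, ‖g 0 x‖ ^ p := by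
    intro f hf hfg
    refine (h ι t' ht hcon' n hn hpos M f hf).trans ?_
    gcongr with x
    · exact hf x
    · exact hfg x
  have k1 := hone f1 (fun x => le_max_right _ _) (fun x => max_le ((le_abs_self _).trans (Complex.abs_re_le_norm _)) (norm_nonneg _))
  have k2 := hone f2 (fun x => le_max_right _ _) (fun x => max_le ((neg_le_abs _).trans (Complex.abs_re_le_norm _)) (norm_nonneg _))
  have k3 := hone f3 (fun x => le_max_right _ _) (fun x => max_le ((le_abs_self _).trans (Complex.abs_im_le_norm _)) (norm_nonneg _))
  have k4 := hone f4 (fun x => le_max_right _ _) (fun x => max_le ((neg_le_abs _).trans (Complex.abs_im_le_norm _)) (norm_nonneg _))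
  have hpt : ∀ x, (∑ i ∈ Finset.range M, ‖avc (n i) (fun k => g k x) - avc (n (i+1)) (fun k => g k x)‖ ^ 2) ^ (p / 2) ≤
      8 ^ (p / 2) * (SQ n M (b f1 x) 0 ^ (p / 2) + SQ n M (b f2 x) 0 ^ (p / 2) + SQ n M (b f3 x) 0 ^ (p / 2) + SQ n M (b f4 x) 0 ^ (p / 2)) := by
    intro x
    refine le_trans ?_ (four_pow (by linarith) (SQ_nonneg _ _ _ _) (SQ_nonneg _ _ _ _) (SQ_nonneg _ _ _ _) (SQ_nonneg _ _ _ _))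
    refine Real.rpow_le_rpow (Finset.sum_nonneg fun _ _ => by positivity) ?_ (by linarith)
    simp only [SQ]
    rw [← Finset.sum_add_distrib, ← Finset.sum_add_distrib, ← Finset.sum_add_distrib, Finset.mul_sum]
    refine Finset.sum_le_sum fun i _ => ?_
    simp only [hgk]
    exact avc_split _ _ _ _ _ _
  refine (Finset.sum_le_sum fun x _ => hpt x).trans ?_
  rw [← Finset.mul_sum, Finset.sum_add_distrib, Finset.sum_add_distrib, Finset.sum_add_distrib, mul_assoc]
  have : (0:ℝ) ≤ 8 ^ (p / 2) := by positivity
  refine mul_le_mul_of_nonneg_left ?_ this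
  linarith
end QME

namespace QME

section
variable {X : Type} [MeasurableSpace X] {μ : Measure X} {p : ℝ≥0∞}
  {ι : Type} [Fintype ι]

/-- step function adapted to a partition, with `L^p` normalization -/
noncomputable def stp (μ : Measure X) (q : ℝ) (A : ι → Set X) {E : Type} [NormedAddCommGroup E]
    [NormedSpace ℝ E] (v : ι → E) (ω : X) : E :=
  ∑ i, (A i).indicator (fun _ => ((μ (A i)).toReal ^ (-(1 / q)) : ℝ) • v i) ω

lemma stp_mem {A : ι → Set X} (hd : Pairwise (Function.onFun Disjoint A)) {q : ℝ} {E : Type}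
    [NormedAddCommGroup E] [NormedSpace ℝ E] (v : ι → E) {ω : X} {i : ι} (h : ω ∈ A i) :
    stp μ q A v ω = ((μ (A i)).toReal ^ (-(1 / q)) : ℝ) • v i := by
  unfold stp
  rw [Finset.sum_eq_single i]
  · simp [h]
  · intro j _ hj
    rw [Set.indicator_of_notMem]
    exact fun h' => Set.disjoint_left.mp (hd hj) h' h
  · simp

lemma stp_notMem {A : ι → Set X} {q : ℝ} {E : Type}
    [NormedAddCommGroup E] [NormedSpace ℝ E] (v : ι → E) {ω : X} (h : ∀ i, ω ∉ A i) :
    stp μ q A v ω = 0 := by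
  unfold stp
  apply Finset.sum_eq_zero
  intro i _
  simp [h i]

lemma eLpNorm_pow {q : ℝ} (hq : 0 < q) {E : Type} [NormedAddCommGroup E] (f : X → E) :
    eLpNorm f (ENNReal.ofReal q) μ ^ q = ∫⁻ ω, ‖f ω‖ₑ ^ q ∂μ := by
  rw [eLpNorm_eq_lintegral_rpow_enorm_toReal (by simpa using hq) (by simp),
    ENNReal.toReal_ofReal hq.le, ← ENNReal.rpow_mul, one_div_mul_cancel hq.ne', ENNReal.rpow_one]

lemma stp_norm {A : ι → Set X} (hA : ∀ i, MeasurableSet (A i)) (h0 : ∀ i, μ (A i) ≠ 0)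
    (hT : ∀ i, μ (A i) ≠ ∞)
    (hd : Pairwise (Function.onFun Disjoint A)) {q : ℝ} (hq : 1 < q) {E : Type}
    [NormedAddCommGroup E] [NormedSpace ℝ E] (v : ι → E) :
    eLpNorm (stp μ q A v) (ENNReal.ofReal q) μ ^ q = ENNReal.ofReal (∑ i, ‖v i‖ ^ q) := by
  have hq0 : 0 < q := by linarith
  rw [eLpNorm_pow hq0]
  have h1 : ∀ ω, ‖stp μ q A v ω‖ₑ ^ q = ∑ i, (A i).indicator
      (fun _ => ‖((μ (A i)).toReal ^ (-(1 / q)) : ℝ) • v i‖ₑ ^ q) ω := by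
    intro ω
    by_cases h : ∃ i, ω ∈ A i
    · obtain ⟨i, hi⟩ := h
      rw [stp_mem hd v hi, Finset.sum_eq_single i]
      · simp [hi]
      · intro j _ hj
        rw [Set.indicator_of_notMem]
        exact fun h' => Set.disjoint_left.mp (hd hj) h' hi
      · simp
    · push Not at h
      rw [stp_notMem v h]
      simp [h, hq0]
  simp_rw [h1]
  rw [lintegral_finsetSum _ (fun i _ => (measurable_const.indicator (hA i)))]
  rw [ENNReal.ofReal_sum_of_nonneg (fun i _ => by positivity)]
  apply Finset.sum_congr rfl
  intro i _
  rw [lintegral_indicator (hA i), lintegral_const, Measure.restrict_apply_univ]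
  have hm : 0 < (μ (A i)).toReal := ENNReal.toReal_pos (h0 i) (hT i)
  rw [← ofReal_norm, ENNReal.ofReal_rpow_of_nonneg (by positivity) hq0.le, norm_smul]
  nth_rw 2 [← ENNReal.ofReal_toReal (hT i)]
  rw [← ENNReal.ofReal_mul (by positivity)]
  congr 1
  rw [Real.mul_rpow (by positivity) (by positivity), Real.norm_of_nonneg (by positivity),
    ← Real.rpow_mul hm.le]
  have : -(1 / q) * q = -1 := by field_simp
  rw [this, Real.rpow_neg_one]
  field_simp

/-- projection coefficients -/
noncomputable def prj (μ : Measure X) (q : ℝ) (A : ι → Set X) (g : X → ℂ) (i : ι) : ℂ :=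
  ((μ (A i)).toReal ^ (1 / q - 1) : ℝ) • ∫ ω in A i, g ω ∂μ

lemma prj_le {A : ι → Set X} (hA : ∀ i, MeasurableSet (A i)) (h0 : ∀ i, μ (A i) ≠ 0)
    (hT : ∀ i, μ (A i) ≠ ∞)
    (hd : Pairwise (Function.onFun Disjoint A)) {q : ℝ} (hq : 1 < q) {g : X → ℂ}
    (hg : AEStronglyMeasurable g μ) :
    ENNReal.ofReal (∑ i, ‖prj μ q A g i‖ ^ q) ≤ eLpNorm g (ENNReal.ofReal q) μ ^ q := by
  have hq0 : 0 < q := by linarith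
  rw [ENNReal.ofReal_sum_of_nonneg (fun i _ => by positivity)]
  have h1 : ∀ i, ENNReal.ofReal (‖prj μ q A g i‖ ^ q) ≤ ∫⁻ ω in A i, ‖g ω‖ₑ ^ q ∂μ := by
    intro i
    rw [← ENNReal.ofReal_rpow_of_nonneg (by positivity) hq0.le, ofReal_norm, ← eLpNorm_pow hq0]
    apply ENNReal.rpow_le_rpow _ hq0.le
    have h2 := eLpNorm_le_eLpNorm_mul_rpow_measure_univ (μ := μ.restrict (A i)) (p := 1)
      (q := ENNReal.ofReal q) (by simpa using hq.le) hg.restrict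
    rw [Measure.restrict_apply_univ, ENNReal.toReal_ofReal hq0.le, eLpNorm_one_eq_lintegral_enorm] at h2
    have h3 := enorm_integral_le_lintegral_enorm (μ := μ.restrict (A i)) g
    have hm : 0 < (μ (A i)).toReal := ENNReal.toReal_pos (h0 i) (hT i)
    unfold prj
    rw [enorm_smul]
    have h4 : ‖((μ (A i)).toReal ^ (1 / q - 1) : ℝ)‖ₑ = μ (A i) ^ (1 / q - 1) := by
      rw [Real.enorm_of_nonneg (by positivity), ← ENNReal.ofReal_rpow_of_pos hm,
        ENNReal.ofReal_toReal (hT i)]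
    rw [h4]
    calc _ ≤ μ (A i) ^ (1 / q - 1) * (eLpNorm g (ENNReal.ofReal q) (μ.restrict (A i)) *
          μ (A i) ^ (1 / (1:ℝ≥0∞).toReal - 1 / q)) := by
          gcongr
          exact h3.trans h2
      _ = eLpNorm g (ENNReal.ofReal q) (μ.restrict (A i)) *
          (μ (A i) ^ (1 / q - 1) * μ (A i) ^ (1 / (1:ℝ≥0∞).toReal - 1 / q)) := by ring
      _ = _ := by
          rw [← ENNReal.rpow_add _ _ (h0 i) (hT i)]
          simp
  refine (Finset.sum_le_sum fun i _ => h1 i).trans ?_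
  rw [eLpNorm_pow hq0]
  have h5 := lintegral_iUnion hA hd (μ := μ) (fun ω => ‖g ω‖ₑ ^ q)
  rw [tsum_fintype] at h5
  rw [← h5]
  exact setLIntegral_le_lintegral _ _

lemma prj_stp {A : ι → Set X} (hA : ∀ i, MeasurableSet (A i)) (h0 : ∀ i, μ (A i) ≠ 0)
    (hT : ∀ i, μ (A i) ≠ ∞)
    (hd : Pairwise (Function.onFun Disjoint A)) {q : ℝ} (v : ι → ℂ) :
    prj μ q A (stp μ q A v) = v := by
  funext i
  have hm : 0 < (μ (A i)).toReal := ENNReal.toReal_pos (h0 i) (hT i)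
  unfold prj
  rw [setIntegral_congr_fun (hA i) (g := fun _ => ((μ (A i)).toReal ^ (-(1 / q)) : ℝ) • v i)
    (fun ω h => stp_mem hd v h)]
  rw [setIntegral_const, smul_smul, smul_smul, Measure.real]
  rw [mul_assoc, mul_comm, mul_assoc, ← Real.rpow_add hm]
  have : -(1 / q) + (1 / q - 1) = -1 := by ring
  rw [this, Real.rpow_neg_one, mul_inv_cancel₀ hm.ne', one_smul]

end
end QME

namespace QME

/-- finite-dimensional model of `L^q` -/
structure FD (X : Type) [MeasurableSpace X] (μ : Measure X) (q : ℝ)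
    [Fact (1 ≤ ENNReal.ofReal q)] (ι : Type) [Fintype ι] where
  E : (ι → ℂ) →ₗ[ℂ] Lp ℂ (ENNReal.ofReal q) μ
  P : Lp ℂ (ENNReal.ofReal q) μ →ₗ[ℂ] (ι → ℂ)
  hP : ∀ g, ∑ i, ‖P g i‖ ^ q ≤ ‖g‖ ^ q
  hE : ∀ v, ‖E v‖ ^ q = ∑ i, ‖v i‖ ^ q
  PE : ∀ v, P (E v) = v
  Epos : ∀ v : ι → ℂ, (∀ i, 0 ≤ v i) → ∀ᵐ ω ∂μ, 0 ≤ (E v : X → ℂ) ω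
  Ppos : ∀ g : Lp ℂ (ENNReal.ofReal q) μ, (∀ᵐ ω ∂μ, 0 ≤ (g : X → ℂ) ω) → ∀ i, 0 ≤ P g i
  sq : ∀ (N : ℕ) (w : ℕ → ι → ℂ),
    eLpNorm (fun ω => (∑ j ∈ Finset.range N, ‖(E (w j) : X → ℂ) ω‖ ^ 2 : ℝ) ^ (1 / 2 : ℝ))
      (ENNReal.ofReal q) μ ^ q
      = ENNReal.ofReal (∑ i, (∑ j ∈ Finset.range N, ‖w j i‖ ^ 2) ^ (q / 2))

section
variable {X : Type} [MeasurableSpace X] {μ : Measure X}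
  {ι : Type} [Fintype ι]

lemma stp_meas {A : ι → Set X} (hA : ∀ i, MeasurableSet (A i)) {q : ℝ} (v : ι → ℂ) :
    Measurable (stp μ q A v) := by
  unfold stp
  exact Finset.measurable_fun_sum _ (fun i _ => measurable_const.indicator (hA i))

lemma stp_memLp {A : ι → Set X} (hA : ∀ i, MeasurableSet (A i)) (h0 : ∀ i, μ (A i) ≠ 0)
    (hT : ∀ i, μ (A i) ≠ ∞)
    (hd : Pairwise (Function.onFun Disjoint A)) {q : ℝ} (hq : 1 < q) (v : ι → ℂ) :
    MemLp (stp μ q A v) (ENNReal.ofReal q) μ := by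
  refine ⟨(stp_meas hA v).aestronglyMeasurable, ?_⟩
  have h := stp_norm hA h0 hT hd hq v
  by_contra hc
  rw [not_lt, top_le_iff] at hc
  rw [hc, ENNReal.top_rpow_of_pos (by linarith)] at h
  exact ENNReal.ofReal_ne_top h.symm

lemma norm_rpow_eq {q : ℝ} [Fact (1 ≤ ENNReal.ofReal q)] (hq : 0 < q)
    (g : Lp ℂ (ENNReal.ofReal q) μ) :
    ‖g‖ ^ q = (eLpNorm g (ENNReal.ofReal q) μ ^ q).toReal := by
  rw [Lp.norm_def, ENNReal.toReal_rpow]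

/-- model from a finite disjoint family -/
noncomputable def mkFD {A : ι → Set X} (hA : ∀ i, MeasurableSet (A i)) (h0 : ∀ i, μ (A i) ≠ 0)
    (hT : ∀ i, μ (A i) ≠ ∞)
    (hd : Pairwise (Function.onFun Disjoint A)) {q : ℝ} (hq : 1 < q)
    [Fact (1 ≤ ENNReal.ofReal q)] : FD X μ q ι where
  E :=
    { toFun := fun v => (stp_memLp hA h0 hT hd hq v).toLp _
      map_add' := by
        intro v w
        rw [← MemLp.toLp_add]
        apply MemLp.toLp_congr
        filter_upwards with ω
        simp only [stp, Pi.add_apply, ← Finset.sum_add_distrib]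
        refine Finset.sum_congr rfl fun i _ => ?_
        by_cases h : ω ∈ A i <;> simp [h, mul_add]
      map_smul' := by
        intro c w
        rw [RingHom.id_apply, ← MemLp.toLp_const_smul]
        apply MemLp.toLp_congr
        filter_upwards with ω
        simp only [stp, Pi.smul_apply, Finset.smul_sum]
        refine Finset.sum_congr rfl fun i _ => ?_
        by_cases h : ω ∈ A i <;> simp [h]
        ring }
  P :=
    { toFun := fun g => prj μ q A g
      map_add' := by
        intro f g
        funext i
        simp only [prj, Pi.add_apply]
        rw [← smul_add, ← integral_add]
        · congr 1
          apply integral_congr_ae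
          exact ae_restrict_of_ae (Lp.coeFn_add f g)
        · exact integrableOn_Lp_of_measure_ne_top f (Fact.out) (hT i)
        · exact integrableOn_Lp_of_measure_ne_top g (Fact.out) (hT i)
      map_smul' := by
        intro c g
        funext i
        simp only [prj, Pi.smul_apply, RingHom.id_apply]
        rw [smul_comm c, ← integral_smul c]
        congr 1
        apply integral_congr_ae
        exact ae_restrict_of_ae (Lp.coeFn_smul c g) }
  hP := by
    intro g
    rw [norm_rpow_eq (by linarith) g]
    have h := prj_le hA h0 hT hd hq (Lp.aestronglyMeasurable g)
    have h2 := ENNReal.toReal_mono ?_ h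
    · rwa [ENNReal.toReal_ofReal (by positivity)] at h2
    · exact ENNReal.rpow_ne_top_of_nonneg (by linarith) (Lp.eLpNorm_ne_top g)
  hE := by
    intro v
    rw [norm_rpow_eq (by linarith)]
    simp only [LinearMap.coe_mk, AddHom.coe_mk]
    rw [eLpNorm_congr_ae (MemLp.coeFn_toLp _), stp_norm hA h0 hT hd hq,
      ENNReal.toReal_ofReal (by positivity)]
  PE := by
    intro v
    simp only [LinearMap.coe_mk, AddHom.coe_mk]
    refine Eq.trans ?_ (prj_stp hA h0 hT hd (q := q) v)
    funext i
    simp only [prj]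
    congr 1
    apply integral_congr_ae
    exact ae_restrict_of_ae (MemLp.coeFn_toLp _)
  Epos := by
    intro v hv
    simp only [LinearMap.coe_mk, AddHom.coe_mk]
    filter_upwards [MemLp.coeFn_toLp (stp_memLp hA h0 hT hd hq v)] with ω h
    rw [h]
    apply Finset.sum_nonneg
    intro i _
    apply Set.indicator_nonneg
    intro _ _
    exact smul_nonneg (by positivity) (hv i)
  Ppos := by
    intro g hg i
    simp only [LinearMap.coe_mk, AddHom.coe_mk, prj]
    apply smul_nonneg (by positivity)
    have h1 : ∫ ω in A i, (g : X → ℂ) ω ∂μ = ∫ ω in A i, (((g : X → ℂ) ω).re : ℂ) ∂μ := by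
      apply integral_congr_ae
      filter_upwards [ae_restrict_of_ae hg] with ω h
      exact Complex.ext rfl (Complex.nonneg_iff.mp h).2.symm
    rw [h1, integral_complex_ofReal, Complex.zero_le_real]
    apply integral_nonneg_of_ae
    filter_upwards [ae_restrict_of_ae hg] with ω h
    exact (Complex.nonneg_iff.mp h).1
  sq := by
    intro N w
    have h1 := stp_norm hA h0 hT hd hq (fun i => (∑ j ∈ Finset.range N, ‖w j i‖ ^ 2 : ℝ) ^ (1 / 2 : ℝ))
    have h2 : ∀ i, ‖(∑ j ∈ Finset.range N, ‖w j i‖ ^ 2 : ℝ) ^ (1 / 2 : ℝ)‖ ^ q =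
        (∑ j ∈ Finset.range N, ‖w j i‖ ^ 2) ^ (q / 2) := by
      intro i
      rw [Real.norm_of_nonneg (by positivity), ← Real.rpow_mul (by positivity)]
      congr 1; ring
    simp_rw [h2] at h1
    rw [← h1]
    congr 1
    apply eLpNorm_congr_ae
    have h3 : ∀ᵐ ω ∂μ, ∀ j, ((stp_memLp hA h0 hT hd hq (w j)).toLp _ : X → ℂ) ω
        = stp μ q A (w j) ω := by
      rw [ae_all_iff]
      intro j
      exact MemLp.coeFn_toLp _
    filter_upwards [h3] with ω h
    simp only [LinearMap.coe_mk, AddHom.coe_mk, h]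
    by_cases h : ∃ i, ω ∈ A i
    · obtain ⟨i, hi⟩ := h
      simp only [stp_mem hd _ hi]
      have hm : 0 ≤ (μ (A i)).toReal ^ (-(1 / q)) := by positivity
      simp only [norm_smul, mul_pow, ← Finset.mul_sum, Real.norm_of_nonneg hm]
      rw [Real.mul_rpow (by positivity) (by positivity), ← Real.sqrt_eq_rpow, Real.sqrt_sq hm]
      rfl
    · push Not at h
      simp only [stp_notMem _ h]
      simp

lemma mkFD_E {A : ι → Set X} (hA : ∀ i, MeasurableSet (A i)) (h0 : ∀ i, μ (A i) ≠ 0)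
    (hT : ∀ i, μ (A i) ≠ ∞)
    (hd : Pairwise (Function.onFun Disjoint A)) {q : ℝ} (hq : 1 < q)
    [Fact (1 ≤ ENNReal.ofReal q)] (v : ι → ℂ) :
    ((mkFD hA h0 hT hd hq).E v : X → ℂ) =ᵐ[μ] stp μ q A v := by
  exact MemLp.coeFn_toLp (stp_memLp hA h0 hT hd hq v)

end

section
variable {X : Type} [MeasurableSpace X] {μ : Measure X} {q : ℝ} [Fact (1 ≤ ENNReal.ofReal q)]
  {ι : Type} [Fintype ι]

lemma FD.norm_P (F : FD X μ q ι) (hq : 1 < q) (g : Lp ℂ (ENNReal.ofReal q) μ) :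
    ‖F.E (F.P g)‖ ≤ ‖g‖ := by
  have h := F.hP g
  rw [← F.hE] at h
  exact (Real.rpow_le_rpow_iff (by positivity) (by positivity) (by linarith)).mp h

/-- approximation by models -/
lemma exists_FD (hq : 1 < q) (K : ℕ) (y : ℕ → Lp ℂ (ENNReal.ofReal q) μ) {ε : ℝ} (hε : 0 < ε) :
    ∃ (ι : Type) (_ : Fintype ι) (F : FD X μ q ι), ∀ k ≤ K, ‖F.E (F.P (y k)) - y k‖ ≤ 2 * ε := by
  classical
  have h1 : ∀ k, ∃ s : SimpleFunc X ℂ, ∃ hs : MemLp s (ENNReal.ofReal q) μ,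
      ‖hs.toLp s - y k‖ ≤ ε := by
    intro k
    obtain ⟨s, h1, h2⟩ := (Lp.memLp (y k)).exists_simpleFunc_eLpNorm_sub_lt (by simp)
      (ε := ENNReal.ofReal ε) (by simpa using hε)
    refine ⟨s, h2, ?_⟩
    rw [← Lp.toLp_coeFn (y k) (Lp.memLp (y k)), ← MemLp.toLp_sub, Lp.norm_toLp, eLpNorm_sub_comm]
    exact ENNReal.toReal_le_of_le_ofReal hε.le h1.le
  choose s hs hys using h1
  -- joint map
  let Φ : X → (Fin (K + 1) → ℂ) := fun ω k => s k ω
  have hΦm : Measurable Φ := measurable_pi_lambda _ (fun k => (s k).measurable)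
  have hfin : (Set.range Φ).Finite := by
    refine (Set.Finite.pi' (t := fun k : Fin (K+1) => Set.range (s k))
      (fun k => (s k).finite_range)).subset ?_
    rintro _ ⟨ω, rfl⟩ k
    exact ⟨ω, rfl⟩
  let S : Set (Fin (K + 1) → ℂ) := {c | c ∈ Set.range Φ ∧ c ≠ 0 ∧ μ (Φ ⁻¹' {c}) ≠ 0}
  have hS : S.Finite := hfin.subset (fun c h => h.1)
  let A : S → Set X := fun c => Φ ⁻¹' {c.1}
  haveI : Fintype S := hS.fintype
  have hA : ∀ c, MeasurableSet (A c) := fun c => hΦm (measurableSet_singleton _)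
  have h0 : ∀ c, μ (A c) ≠ 0 := fun c => c.2.2.2
  have hT : ∀ c, μ (A c) ≠ ∞ := by
    intro c
    obtain ⟨k, hk⟩ := Function.ne_iff.mp c.2.2.1
    have h2 := SimpleFunc.measure_preimage_lt_top_of_memLp (p := ENNReal.ofReal q)
      (by simp; linarith) (by simp) (s k) (hs k) (c.1 k) hk
    refine ((measure_mono ?_).trans_lt h2).ne
    intro ω h
    exact congrFun h k
  have hd : Pairwise (Function.onFun Disjoint A) := by
    intro c d hcd
    apply Set.disjoint_left.mpr
    intro ω h h'
    exact hcd (Subtype.ext (h.symm.trans h'))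
  refine ⟨S, inferInstance, mkFD hA h0 hT hd hq, ?_⟩
  set F := mkFD hA h0 hT hd hq with hF
  intro k hk
  let k' : Fin (K + 1) := ⟨k, by omega⟩
  let v : S → ℂ := fun c => ((μ (A c)).toReal ^ (1 / q) : ℝ) • c.1 k'
  have hv : F.E v = (hs k).toLp (s k) := by
    apply Lp.ext
    refine (mkFD_E hA h0 hT hd hq v).trans ?_
    refine Filter.EventuallyEq.trans ?_ (MemLp.coeFn_toLp (hs k)).symm
    have hnull : ∀ᵐ ω ∂μ, μ (Φ ⁻¹' {Φ ω}) ≠ 0 := by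
      rw [ae_iff]
      have : {ω | ¬ μ (Φ ⁻¹' {Φ ω}) ≠ 0} ⊆ ⋃ c ∈ {c ∈ Set.range Φ | μ (Φ ⁻¹' {c}) = 0}, Φ ⁻¹' {c} := by
        intro ω h
        simp only [Set.mem_iUnion]
        exact ⟨Φ ω, ⟨⟨ω, rfl⟩, by simpa using h⟩, rfl⟩
      refine measure_mono_null this ?_
      rw [measure_biUnion_null_iff (hfin.subset (fun c h => h.1)).countable]
      exact fun c h => h.2
    filter_upwards [hnull] with ω hω
    by_cases hz : Φ ω = 0
    · rw [stp_notMem]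
      · exact (congrFun hz k').symm
      · intro c hc
        exact c.2.2.1 (hc.symm.trans hz)
    · let c : S := ⟨Φ ω, ⟨ω, rfl⟩, hz, hω⟩
      have hc : ω ∈ A c := rfl
      rw [stp_mem hd v hc]
      have hm : 0 < (μ (A c)).toReal := ENNReal.toReal_pos (h0 c) (hT c)
      simp only [v]
      rw [smul_smul, ← Real.rpow_add hm]
      simp [c, Φ, k']
  have e : F.E (F.P (y k)) - y k = -(F.E (F.P ((hs k).toLp (s k) - y k))) + ((hs k).toLp (s k) - y k) := by
    rw [map_sub, map_sub]
    have : F.E (F.P ((hs k).toLp (s k))) = (hs k).toLp (s k) := by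
      rw [← hv, F.PE]
    rw [this]; abel
  rw [e]
  refine (norm_add_le _ _).trans ?_
  rw [norm_neg]
  have := F.norm_P hq ((hs k).toLp (s k) - y k)
  linarith [hys k]

end
end QME

namespace QME

lemma sq_point (N : ℕ) (a b : ℕ → ℂ) :
    (∑ i ∈ Finset.range N, ‖a i‖ ^ 2 : ℝ) ^ (1 / 2 : ℝ) ≤
    (∑ i ∈ Finset.range N, ‖b i‖ ^ 2 : ℝ) ^ (1 / 2 : ℝ) + ∑ i ∈ Finset.range N, ‖a i - b i‖ := by
  have h1 := Real.Lp_add_le_of_nonneg (p := 2) (Finset.range N) (f := fun i => ‖b i‖)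
    (g := fun i => ‖a i - b i‖) (by norm_num) (fun i _ => norm_nonneg _) (fun i _ => norm_nonneg _)
  simp only [Real.rpow_two] at h1
  have h2 : (∑ i ∈ Finset.range N, ‖a i - b i‖ ^ 2 : ℝ) ^ (1 / 2 : ℝ) ≤
      ∑ i ∈ Finset.range N, ‖a i - b i‖ := by
    rw [← Real.sqrt_eq_rpow]
    apply Real.sqrt_le_iff.mpr
    exact ⟨by positivity, Finset.sum_sq_le_sq_sum_of_nonneg (fun i _ => norm_nonneg _)⟩
  have h3 : (∑ i ∈ Finset.range N, ‖a i‖ ^ 2 : ℝ) ^ (1 / 2 : ℝ) ≤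
      (∑ i ∈ Finset.range N, (‖b i‖ + ‖a i - b i‖) ^ 2 : ℝ) ^ (1 / 2 : ℝ) := by
    gcongr with i _
    calc ‖a i‖ = ‖b i + (a i - b i)‖ := by congr 1; ring
      _ ≤ _ := norm_add_le _ _
  linarith

section
variable {X : Type} [MeasurableSpace X] {μ : Measure X} {p : ℝ≥0∞} [Fact (1 ≤ p)]

lemma aesm_sq (N : ℕ) (b : ℕ → Lp ℂ p μ) : AEStronglyMeasurable
    (fun ω => (∑ i ∈ Finset.range N, ‖(b i : X → ℂ) ω‖ ^ 2 : ℝ) ^ (1 / 2 : ℝ)) μ := by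
  simp_rw [← Real.sqrt_eq_rpow]
  apply Real.continuous_sqrt.comp_aestronglyMeasurable
  refine Finset.aestronglyMeasurable_fun_sum _ fun i _ => ?_
  exact ((Lp.aestronglyMeasurable (b i)).norm).pow 2

lemma sq_approx (N : ℕ) (a b : ℕ → Lp ℂ p μ) :
    eLpNorm (fun ω => (∑ i ∈ Finset.range N, ‖(a i : X → ℂ) ω‖ ^ 2 : ℝ) ^ (1 / 2 : ℝ)) p μ ≤
    eLpNorm (fun ω => (∑ i ∈ Finset.range N, ‖(b i : X → ℂ) ω‖ ^ 2 : ℝ) ^ (1 / 2 : ℝ)) p μ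
      + ENNReal.ofReal (∑ i ∈ Finset.range N, ‖a i - b i‖) := by
  have hp : 1 ≤ p := Fact.out
  have h1 : eLpNorm (fun ω => (∑ i ∈ Finset.range N, ‖(a i : X → ℂ) ω‖ ^ 2 : ℝ) ^ (1 / 2 : ℝ)) p μ ≤
      eLpNorm (fun ω => (∑ i ∈ Finset.range N, ‖(b i : X → ℂ) ω‖ ^ 2 : ℝ) ^ (1 / 2 : ℝ)
        + ∑ i ∈ Finset.range N, ‖((a i - b i : Lp ℂ p μ) : X → ℂ) ω‖) p μ := by
    apply eLpNorm_mono_ae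
    have : ∀ᵐ ω ∂μ, ∀ i, ((a i - b i : Lp ℂ p μ) : X → ℂ) ω = (a i : X → ℂ) ω - (b i : X → ℂ) ω := by
      rw [ae_all_iff]
      exact fun i => Lp.coeFn_sub _ _
    filter_upwards [this] with ω h
    simp only [h]
    rw [Real.norm_of_nonneg (by positivity), Real.norm_of_nonneg (by positivity)]
    exact sq_point N (fun i => (a i : X → ℂ) ω) (fun i => (b i : X → ℂ) ω)
  refine h1.trans ((eLpNorm_add_le (aesm_sq N b) ?_ hp).trans ?_)
  · exact Finset.aestronglyMeasurable_fun_sum _ fun i _ => (Lp.aestronglyMeasurable _).norm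
  · gcongr
    rw [ENNReal.ofReal_sum_of_nonneg (fun i _ => norm_nonneg _)]
    have h2 := eLpNorm_sum_le (s := Finset.range N) (μ := μ) (p := p)
      (f := fun i ω => ‖((a i - b i : Lp ℂ p μ) : X → ℂ) ω‖)
      (fun i _ => (Lp.aestronglyMeasurable _).norm) hp
    have h3 : (∑ i ∈ Finset.range N, fun ω => ‖((a i - b i : Lp ℂ p μ) : X → ℂ) ω‖) =
       fun ω => ∑ i ∈ Finset.range N, ‖((a i - b i : Lp ℂ p μ) : X → ℂ) ω‖ := by
      funext ω; simp
    rw [h3] at h2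
    refine h2.trans (Finset.sum_le_sum fun i _ => ?_)
    rw [eLpNorm_norm, ofReal_norm, Lp.enorm_def]

end

section
variable {X : Type} [MeasurableSpace X] {μ : Measure X} {q : ℝ} [Fact (1 ≤ ENNReal.ofReal q)]
  {ι : Type} [Fintype ι]

lemma iter_close (F : FD X μ q ι) (hq : 1 < q)
    (T : Lp ℂ (ENNReal.ofReal q) μ →L[ℂ] Lp ℂ (ENNReal.ofReal q) μ) (hT : ‖T‖ ≤ 1)
    (x : Lp ℂ (ENNReal.ofReal q) μ) (g : ℕ → ι → ℂ) (g0 : g 0 = F.P x)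
    (gs : ∀ k, g (k + 1) = F.P (T (F.E (g k)))) {K : ℕ} {δ : ℝ}
    (h : ∀ k ≤ K, ‖F.E (F.P ((T ^ k) x)) - (T ^ k) x‖ ≤ δ) (k : ℕ) (hk : k ≤ K) :
    ‖F.E (g k) - (T ^ k) x‖ ≤ (k + 1) * δ := by
  induction k with
  | zero => simpa [g0] using h 0 hk
  | succ k ih =>
    have ih := ih (by omega)
    have e : F.E (g (k+1)) - (T ^ (k+1)) x = F.E (F.P (T (F.E (g k) - (T ^ k) x))) +
        (F.E (F.P ((T ^ (k+1)) x)) - (T ^ (k+1)) x) := by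
      rw [gs]
      simp only [map_sub, pow_succ', ContinuousLinearMap.mul_apply]
      abel
    rw [e]
    refine (norm_add_le _ _).trans ?_
    have h1 := F.norm_P hq (T (F.E (g k) - (T ^ k) x))
    have h2 := T.le_opNorm (F.E (g k) - (T ^ k) x)
    have h3 : ‖T‖ * ‖F.E (g k) - (T ^ k) x‖ ≤ 1 * ‖F.E (g k) - (T ^ k) x‖ := by gcongr
    have h4 := h _ hk
    have hcast : ((k + 1 : ℕ) : ℝ) = (k : ℝ) + 1 := Nat.cast_succ k
    rw [hcast]
    have h5 := h1.trans (h2.trans h3)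
    linarith

lemma fd_contr (F : FD X μ q ι) (hq : 1 < q)
    (T : Lp ℂ (ENNReal.ofReal q) μ →L[ℂ] Lp ℂ (ENNReal.ofReal q) μ) (hT : ‖T‖ ≤ 1)
    (hpos : IsPositiveOp T) : ∃ t : ι → ι → ℝ, (∀ i j, 0 ≤ t i j) ∧
      (∀ (v : ι → ℂ) i, F.P (T (F.E v)) i = ∑ j, (t i j : ℂ) * v j) ∧
      (∀ f : ι → ℝ, (∀ x, 0 ≤ f x) → ∑ x, (∑ y, t x y * f y) ^ q ≤ ∑ x, f x ^ q) := by
  classical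
  let L : (ι → ℂ) →ₗ[ℂ] (ι → ℂ) := F.P ∘ₗ T.toLinearMap ∘ₗ F.E
  have hL : ∀ i j, 0 ≤ L (Pi.single j 1) i := by
    intro i j
    apply F.Ppos
    apply hpos
    apply F.Epos
    intro k
    by_cases h : k = j
    · subst h; simp
    · simp [Pi.single_eq_of_ne h]
  have ht : ∀ i j, (((L (Pi.single j 1) i).re : ℝ) : ℂ) = L (Pi.single j 1) i := by
    intro i j
    exact Complex.ext rfl (Complex.nonneg_iff.mp (hL i j)).2
  have hmul : ∀ (v : ι → ℂ) i, F.P (T (F.E v)) i =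
      ∑ j, (((L (Pi.single j 1) i).re : ℝ) : ℂ) * v j := by
    intro v i
    have h1 := L.pi_apply_eq_sum_univ v
    have h2 := congrFun h1 i
    refine h2.trans ?_
    rw [Finset.sum_apply]
    refine Finset.sum_congr rfl fun j _ => ?_
    rw [ht, Pi.smul_apply, smul_eq_mul, mul_comm]
    have e0 : (fun j_1 => if j = j_1 then (1:ℂ) else 0) = Pi.single j 1 := by
      funext k
      simp [Pi.single_apply, eq_comm]
    rw [e0]
  refine ⟨fun i j => (L (Pi.single j 1) i).re, fun i j => (Complex.nonneg_iff.mp (hL i j)).1,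
    hmul, ?_⟩
  intro f hf
  have h1 := F.hP (T (F.E (fun i => (f i : ℂ))))
  have h2 : ‖T (F.E (fun i => (f i : ℂ)))‖ ≤ ‖F.E (fun i => (f i : ℂ))‖ := by
    have := T.le_opNorm (F.E (fun i => (f i : ℂ)))
    nlinarith [norm_nonneg (F.E (fun i => (f i : ℂ)))]
  have h3 := Real.rpow_le_rpow (norm_nonneg _) h2 (by linarith : 0 ≤ q)
  rw [F.hE] at h3
  have h4 := h1.trans h3
  have e1 : ∀ i, ‖(f i : ℂ)‖ = f i := fun i => by
    rw [Complex.norm_real, Real.norm_of_nonneg (hf i)]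
  simp only [e1] at h4
  refine le_trans (le_of_eq ?_) h4
  refine Finset.sum_congr rfl fun i _ => ?_
  congr 1
  rw [hmul]
  have e2 : ∑ j, (((L (Pi.single j 1) i).re : ℝ) : ℂ) * (f j : ℂ) =
      ((∑ j, (L (Pi.single j 1) i).re * f j : ℝ) : ℂ) := by push_cast; rfl
  rw [e2, Complex.norm_real, Real.norm_of_nonneg]
  exact Finset.sum_nonneg fun j _ => mul_nonneg (Complex.nonneg_iff.mp (hL i j)).1 (hf j)

lemma erg_close (F : FD X μ q ι)
    (T : Lp ℂ (ENNReal.ofReal q) μ →L[ℂ] Lp ℂ (ENNReal.ofReal q) μ)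
    (x : Lp ℂ (ENNReal.ofReal q) μ) (g : ℕ → ι → ℂ) {K : ℕ} {δ : ℝ}
    (h : ∀ k ≤ K, ‖F.E (g k) - (T ^ k) x‖ ≤ δ) (m : ℕ) (hm : m ≤ K) :
    ‖ergAvg T m x - F.E (fun i => avc m (fun k => g k i))‖ ≤ δ := by
  have e1 : (fun i => avc m (fun k => g k i)) =
      ((m : ℂ) + 1)⁻¹ • ∑ k ∈ Finset.range (m + 1), g k := by
    funext i
    simp [avc, div_eq_inv_mul]
  rw [e1, map_smul, map_sum]
  have e2 : ergAvg T m x = ((m : ℂ) + 1)⁻¹ • ∑ k ∈ Finset.range (m + 1), (T ^ k) x := by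
    rw [ergAvg, ContinuousLinearMap.smul_apply, ContinuousLinearMap.sum_apply]
  rw [e2, ← smul_sub, ← Finset.sum_sub_distrib, norm_smul]
  have e3 : ‖((m : ℂ) + 1)⁻¹‖ = ((m : ℝ) + 1)⁻¹ := by
    rw [norm_inv]
    congr 1
    exact_mod_cast Complex.norm_natCast (m + 1)
  rw [e3]
  have h2 : ‖∑ k ∈ Finset.range (m + 1), ((T ^ k) x - F.E (g k))‖ ≤ (m + 1) * δ := by
    refine (norm_sum_le _ _).trans ?_
    refine (Finset.sum_le_card_nsmul _ _ δ ?_).trans (by simp)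
    intro k hk
    rw [norm_sub_rev]
    exact h k (by simp at hk; omega)
  calc _ ≤ ((m : ℝ) + 1)⁻¹ * ((m + 1) * δ) := by gcongr
    _ = δ := by field_simp

end

theorem main_q {q : ℝ} (hq : 1 < q) [Fact (1 ≤ ENNReal.ofReal q)] :
    ∃ C : ℝ, 0 < C ∧
      ∀ (X : Type) [MeasurableSpace X] (μ : Measure X)
        (T : Lp ℂ (ENNReal.ofReal q) μ →L[ℂ] Lp ℂ (ENNReal.ofReal q) μ),
        ‖T‖ ≤ 1 → IsPositiveOp T →
        ∀ (N : ℕ) (n : ℕ → ℕ), StrictMono n → (∀ i, 0 < n i) →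
        ∀ x : Lp ℂ (ENNReal.ofReal q) μ,
          eLpNorm
            (fun ω => (∑ i ∈ Finset.range N,
                ‖(ergAvg T (n i) x) ω - (ergAvg T (n (i + 1)) x) ω‖ ^ 2 : ℝ)
              ^ (1 / 2 : ℝ)) (ENNReal.ofReal q) μ
          ≤ ENNReal.ofReal (C * ‖x‖) := by
  obtain ⟨C, hC, hfin⟩ := fin_complex hq
  have hq0 : 0 < q := by linarith
  refine ⟨(C + 1) ^ (1 / q), by positivity, ?_⟩
  intro X _ μ T hT hpos N n hn hn0 x
  have hcongr : eLpNorm (fun ω => (∑ i ∈ Finset.range N,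
                ‖(ergAvg T (n i) x) ω - (ergAvg T (n (i + 1)) x) ω‖ ^ 2 : ℝ)
              ^ (1 / 2 : ℝ)) (ENNReal.ofReal q) μ = eLpNorm (fun ω => (∑ i ∈ Finset.range N,
                ‖((ergAvg T (n i) x - ergAvg T (n (i + 1)) x :
                  Lp ℂ (ENNReal.ofReal q) μ) : X → ℂ) ω‖ ^ 2 : ℝ)
              ^ (1 / 2 : ℝ)) (ENNReal.ofReal q) μ := by
    apply eLpNorm_congr_ae
    have : ∀ᵐ ω ∂μ, ∀ i, ((ergAvg T (n i) x - ergAvg T (n (i + 1)) x :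
        Lp ℂ (ENNReal.ofReal q) μ) : X → ℂ) ω =
        (ergAvg T (n i) x : X → ℂ) ω - (ergAvg T (n (i + 1)) x : X → ℂ) ω := by
      rw [ae_all_iff]
      exact fun i => Lp.coeFn_sub _ _
    filter_upwards [this] with ω h
    simp only [h]
  rw [hcongr]
  set K := n N with hK
  have key : ∀ ε : ℝ, 0 < ε → eLpNorm (fun ω => (∑ i ∈ Finset.range N,
                ‖((ergAvg T (n i) x - ergAvg T (n (i + 1)) x :
                  Lp ℂ (ENNReal.ofReal q) μ) : X → ℂ) ω‖ ^ 2 : ℝ)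
              ^ (1 / 2 : ℝ)) (ENNReal.ofReal q) μ ≤
      ENNReal.ofReal ((C + 1) ^ (1 / q) * ‖x‖ + N * (2 * ((K + 1) * (2 * ε)))) := by
    intro ε hε
    obtain ⟨ι, _, F, hF⟩ := exists_FD hq K (fun k => (T ^ k) x) hε
    obtain ⟨t, ht, hmul, hcon⟩ := fd_contr F hq T hT hpos
    let g : ℕ → ι → ℂ := fun k => Nat.rec (F.P x) (fun _ v => F.P (T (F.E v))) k
    have g0 : g 0 = F.P x := rfl
    have gs : ∀ k, g (k + 1) = F.P (T (F.E (g k))) := fun k => rfl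
    have hclose : ∀ k ≤ K, ‖F.E (g k) - (T ^ k) x‖ ≤ (K + 1) * (2 * ε) := by
      intro k hk
      refine (iter_close F hq T hT x g g0 gs hF k hk).trans ?_
      have : (k : ℝ) ≤ K := by exact_mod_cast hk
      gcongr
    have hav := fun m hm => erg_close F T x g hclose m hm
    have hfd := hfin ι t ht hcon n hn hn0 N g (fun k i => by rw [gs]; exact hmul _ _)
    let w : ℕ → ι → ℂ := fun j i => avc (n j) (fun k => g k i) - avc (n (j+1)) (fun k => g k i)
    have h1 := sq_approx N (fun i => ergAvg T (n i) x - ergAvg T (n (i + 1)) x)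
      (fun i => F.E (w i))
    refine h1.trans ?_
    rw [ENNReal.ofReal_add (by positivity) (by positivity)]
    gcongr
    · have h2 := F.sq N w
      rw [← ENNReal.rpow_le_rpow_iff hq0, h2, ENNReal.ofReal_rpow_of_nonneg (by positivity) hq0.le]
      apply ENNReal.ofReal_le_ofReal
      rw [Real.mul_rpow (by positivity) (by positivity), ← Real.rpow_mul (by positivity),
        one_div_mul_cancel hq0.ne', Real.rpow_one]
      refine hfd.trans ?_
      have h3 := F.hP x
      rw [g0]
      have : 0 ≤ ‖x‖ ^ q := by positivity
      have := mul_le_mul_of_nonneg_left h3 hC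
      linarith
    · refine (Finset.sum_le_card_nsmul _ _ (2 * ((K + 1) * (2 * ε))) ?_).trans (by simp)
      intro i hi
      have hi' : i < N := by simpa using hi
      have k1 := hav (n i) (hn.monotone hi'.le)
      have k2 := hav (n (i+1)) (hn.monotone hi')
      have e : F.E (w i) = F.E (fun i_1 => avc (n i) (fun k => g k i_1)) -
          F.E (fun i_1 => avc (n (i+1)) (fun k => g k i_1)) := by
        rw [← map_sub]; rfl
      rw [e, sub_sub_sub_comm]
      refine (norm_sub_le _ _).trans ?_
      linarith
  have hlim : Filter.Tendsto (fun ε : ℝ =>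
      ENNReal.ofReal ((C + 1) ^ (1 / q) * ‖x‖ + N * (2 * ((K + 1) * (2 * ε)))))
      (nhdsWithin 0 (Set.Ioi 0)) (nhds (ENNReal.ofReal ((C + 1) ^ (1 / q) * ‖x‖))) := by
    have : Continuous (fun ε : ℝ =>
      ENNReal.ofReal ((C + 1) ^ (1 / q) * ‖x‖ + N * (2 * ((K + 1) * (2 * ε))))) := by
      apply ENNReal.continuous_ofReal.comp
      fun_prop
    have h := (this.tendsto 0).mono_left (nhdsWithin_le_nhds (s := Set.Ioi 0))
    simpa using h
  refine ge_of_tendsto hlim ?_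
  filter_upwards [self_mem_nhdsWithin] with ε hε
  exact key ε hε

end QME


/-- Quantitative mean ergodic inequality for positive contractions of `L^p`
(commutative content of the final Remark, via Akcoglu's dilation theorem). -/
theorem quantitative_mean_ergodic_positive_contraction
    (p : ℝ≥0∞) [Fact (1 ≤ p)] (hp : 1 < p) (hp' : p ≠ ∞) :
    ∃ C : ℝ, 0 < C ∧
      ∀ (X : Type) [MeasurableSpace X] (μ : Measure X) [SigmaFinite μ]
        (T : Lp ℂ p μ →L[ℂ] Lp ℂ p μ),
        ‖T‖ ≤ 1 → IsPositiveOp T →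
        ∀ (N : ℕ) (n : ℕ → ℕ), StrictMono n → (∀ i, 0 < n i) →
        ∀ x : Lp ℂ p μ,
          eLpNorm
            (fun ω => (∑ i ∈ Finset.range N,
                ‖(ergAvg T (n i) x) ω - (ergAvg T (n (i + 1)) x) ω‖ ^ 2 : ℝ)
              ^ (1 / 2 : ℝ)) p μ
          ≤ ENNReal.ofReal (C * ‖x‖) := by
  have h : ENNReal.ofReal p.toReal = p := ENNReal.ofReal_toReal hp'
  have hq : 1 < p.toReal := by
    rw [← ENNReal.toReal_one]
    exact (ENNReal.toReal_lt_toReal ENNReal.one_ne_top hp').mpr hp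
  generalize p.toReal = q at h hq
  subst h
  obtain ⟨C, hC, hmain⟩ := QME.main_q hq
  exact ⟨C, hC, fun X _ μ _ T => hmain X μ T⟩
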